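/- Let Ω ⊂ ℝ² be a UBC domain. There exists an independent constant C such that (i) ∫_Ω |∇X − (∇X)_Ω|² dx ≤ C (|Ω| P(Ω) / r_Ω³) ∫_Ω |∇_sym X − (∇_sym X)_Ω|² dx for all X ∈ H¹(Ω; ℝ²), and (ii) ∫_Ω |∇X|² dx ≤ C (|Ω| P(Ω) / r_Ω³) ∫_Ω |∇_sym X|² dx for every X ∈ H¹(Ω; ℝ²) for which the matrix ∫_Ω ∇X dx is symmetric. -/

import Mathlib

open MeasureTheory Metric Set Filter
open scoped RealInnerProductSpace ENNReal Topology NNReal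

noncomputable section

abbrev E2 : Type := EuclideanSpace ℝ (Fin 2)

namespace StokesPaper

/-- The `i`-th standard basis vector of `ℝ²`. -/
def e (i : Fin 2) : E2 := EuclideanSpace.single i (1 : ℝ)

/-- Rotation by +90°; produces the right-handed unit tangent `τ = (-ν₂, ν₁)`
from the outer normal `ν`. -/
def rot (v : E2) : E2 := ⟪v, e 0⟫ • e 1 - ⟪v, e 1⟫ • e 0

/-- The uniform ball condition (UBC) with radius `r`: at every boundary point there are
an open interior ball and an open exterior ball of radius `r` whose boundary spheres
meet exactly at that point. -/
def IsUBCWith (Ω : Set E2) (r : ℝ) : Prop :=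
  0 < r ∧ ∀ x ∈ frontier Ω, ∃ cIn cOut : E2,
    ball cIn r ⊆ Ω ∧ ball cOut r ⊆ Ωᶜ ∧ sphere cIn r ∩ sphere cOut r = {x}

/-- A UBC domain: a bounded domain satisfying the UBC for some radius. -/
def IsUBCDomain (Ω : Set E2) : Prop :=
  IsOpen Ω ∧ IsConnected Ω ∧ Bornology.IsBounded Ω ∧ ∃ r : ℝ, IsUBCWith Ω r

/-- The maximal UBC radius `r_Ω`. -/
def ubcRadius (Ω : Set E2) : ℝ := sSup {r : ℝ | IsUBCWith Ω r}

/-- The perimeter `P(Ω) = H¹(∂Ω)`. -/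
def perim (Ω : Set E2) : ℝ := (μH[1] (frontier Ω)).toReal

/-- The area `|Ω|`. -/
def area (Ω : Set E2) : ℝ := (volume Ω).toReal

/-- Boundary integral with respect to the 1-dimensional Hausdorff measure. -/
def bInt (Ω : Set E2) (f : E2 → ℝ) : ℝ := ∫ x in frontier Ω, f x ∂μH[1]

open Classical in
/-- The signed distance function `d_Ω` (negative inside `Ω`). -/
def sdist (Ω : Set E2) (x : E2) : ℝ :=
  if x ∈ Ω then -(infDist x (frontier Ω)) else infDist x Ω

/-- The tubular neighborhood `N_r(∂Ω)`. -/
def tubNbhd (Ω : Set E2) (r : ℝ) : Set E2 := {x : E2 | infDist x (frontier Ω) < r}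

/-- Pointwise vector Laplacian. -/
def vLap (u : E2 → E2) (x : E2) : E2 :=
  ∑ i : Fin 2, fderiv ℝ (fderiv ℝ u) x (e i) (e i)

/-- Pointwise gradient of a scalar function. -/
def gradv (f : E2 → ℝ) (x : E2) : E2 := ∑ i : Fin 2, fderiv ℝ f x (e i) • e i

/-- Pointwise divergence of a vector field. -/
def divg (u : E2 → E2) (x : E2) : ℝ := ∑ i : Fin 2, ⟪fderiv ℝ u x (e i), e i⟫

/-- The entry `(∇u)_{ij} = ∂_j u_i` of the gradient matrix. -/
def gradEntry (u : E2 → E2) (x : E2) (i j : Fin 2) : ℝ := ⟪fderiv ℝ u x (e j), e i⟫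

/-- The entry of the symmetric gradient `∇_sym u = (∇u + (∇u)ᵀ)/2`. -/
def symGradEntry (u : E2 → E2) (x : E2) (i j : Fin 2) : ℝ :=
  (gradEntry u x i j + gradEntry u x j i) / 2

/-- The symmetric gradient applied to a vector. -/
def symGradApp (u : E2 → E2) (x v : E2) : E2 :=
  ∑ i : Fin 2, (∑ j : Fin 2, symGradEntry u x i j * ⟪v, e j⟫) • e i

/-- Squared Frobenius norm `|∇u|²`. -/
def gradNormSq (u : E2 → E2) (x : E2) : ℝ :=
  ∑ i : Fin 2, ∑ j : Fin 2, (gradEntry u x i j)^2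

/-- Squared Frobenius norm `|∇_sym u|²`. -/
def symGradNormSq (u : E2 → E2) (x : E2) : ℝ :=
  ∑ i : Fin 2, ∑ j : Fin 2, (symGradEntry u x i j)^2

/-- `ν` is the outer unit normal of `Ω` at the boundary point `x`, characterized via the
interior and exterior tangent balls of the uniform ball condition. -/
def IsOuterNormalAt (Ω : Set E2) (x ν : E2) : Prop :=
  ‖ν‖ = 1 ∧ ∀ r : ℝ, IsUBCWith Ω r →
    ball (x - r • ν) r ⊆ Ω ∧ ball (x + r • ν) r ⊆ Ωᶜ

/-- `∫_Ω |∇^k u|² dx`. -/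
def derivSq (k : ℕ) (Ω : Set E2) (u : E2 → E2) : ℝ :=
  ∫ x in Ω, ‖iteratedFDeriv ℝ k u x‖^2

/-- Squared Sobolev norm `‖u‖²_{H^n(Ω)}`. -/
def hSobSq (n : ℕ) (Ω : Set E2) (u : E2 → E2) : ℝ :=
  ∑ k ∈ Finset.range (n + 1), derivSq k Ω u

lemma ftc_sq {u u' : ℝ → ℝ} (hu : ∀ t ∈ Icc (0:ℝ) 1, HasDerivAt u (u' t) t)
    (hm : Measurable u') :
    ENNReal.ofReal ((u 1 - u 0)^2) ≤ ∫⁻ t in Ioc (0:ℝ) 1, ENNReal.ofReal ((u' t)^2) := by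
  by_cases htop : ∫⁻ t in Ioc (0:ℝ) 1, ENNReal.ofReal ((u' t)^2) = ⊤
  · rw [htop]; exact le_top
  have hint2 : IntegrableOn (fun t => (u' t)^2) (Ioc (0:ℝ) 1) := by
    refine ⟨(hm.pow_const 2).aestronglyMeasurable, ?_⟩
    rw [hasFiniteIntegral_iff_ofReal (ae_of_all _ fun t => sq_nonneg _)]
    exact lt_top_iff_ne_top.2 htop
  have hmem : MemLp u' 2 (volume.restrict (Ioc (0:ℝ) 1)) :=
    (memLp_two_iff_integrable_sq hm.aestronglyMeasurable).2 hint2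
  have hgInt : IntegrableOn u' (Ioc (0:ℝ) 1) := hmem.integrable (by norm_num)
  have hftc : ∫ t in (0:ℝ)..1, u' t = u 1 - u 0 := by
    apply intervalIntegral.integral_eq_sub_of_hasDerivAt
    · intro t ht; rw [uIcc_of_le zero_le_one] at ht; exact hu t ht
    · rw [intervalIntegrable_iff_integrableOn_Ioc_of_le zero_le_one]; exact hgInt
  rw [intervalIntegral.integral_of_le zero_le_one] at hftc
  set c := u 1 - u 0
  have h0 : 0 ≤ ∫ t in Ioc (0:ℝ) 1, (u' t - c)^2 := integral_nonneg fun t => sq_nonneg _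
  have hexp : ∫ t in Ioc (0:ℝ) 1, (u' t - c)^2 = (∫ t in Ioc (0:ℝ) 1, (u' t)^2) - c^2 := by
    have : ∀ t, (u' t - c)^2 = (u' t)^2 - ((2*c) * u' t - c^2) := fun t => by ring
    simp_rw [this]
    have h3 : Integrable (fun t => (2*c) * u' t - c^2) (volume.restrict (Ioc 0 1)) :=
      (hgInt.const_mul _).sub (integrable_const _)
    rw [integral_sub hint2 h3,
      integral_sub (hgInt.const_mul _) (integrable_const _), integral_const_mul, hftc]
    simp; ring
  rw [← ofReal_integral_eq_lintegral_ofReal hint2 (ae_of_all _ fun t => sq_nonneg _)]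
  apply ENNReal.ofReal_le_ofReal
  linarith

lemma meas_fd {F : Type*} [NormedAddCommGroup F] [NormedSpace ℝ F] [CompleteSpace F]
    [MeasurableSpace F] [BorelSpace F]
    (f : E2 → F) (v : E2) : Measurable fun x => fderiv ℝ f x v :=
  measurable_fderiv_apply_const ℝ f v

/-- difference bound -/
lemma dq_bound {f : E2 → ℝ} (hf : Differentiable ℝ f) (v : E2) :
    ∫⁻ x, ENNReal.ofReal ((f (x + v) - f x)^2) ≤ ∫⁻ x, ENNReal.ofReal ((fderiv ℝ f x v)^2) := by
  have hmm : Measurable fun x => ENNReal.ofReal ((fderiv ℝ f x v)^2) :=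
    ((meas_fd f v).pow_const 2).ennreal_ofReal
  have hj : Measurable fun p : E2 × ℝ => ENNReal.ofReal ((fderiv ℝ f (p.1 + p.2 • v) v)^2) :=
    hmm.comp (by fun_prop : Measurable fun p : E2 × ℝ => p.1 + p.2 • v)
  have h1 : ∀ x, ENNReal.ofReal ((f (x + v) - f x)^2) ≤
      ∫⁻ t in Ioc (0:ℝ) 1, ENNReal.ofReal ((fderiv ℝ f (x + t • v) v)^2) := by
    intro x
    have := ftc_sq (u := fun t => f (x + t • v)) (u' := fun t => fderiv ℝ f (x + t • v) v)
      (fun t _ => by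
        have h2 : HasDerivAt (fun t : ℝ => x + t • v) v t := by
          simpa using ((hasDerivAt_id t).smul_const v).const_add x
        exact (hf (x + t • v)).hasFDerivAt.comp_hasDerivAt t h2)
      ((meas_fd f v).comp (by fun_prop : Measurable fun t : ℝ => x + t • v))
    simpa using this
  calc _ ≤ ∫⁻ x, ∫⁻ t in Ioc (0:ℝ) 1, ENNReal.ofReal ((fderiv ℝ f (x + t • v) v)^2) :=
        lintegral_mono h1
    _ = ∫⁻ t in Ioc (0:ℝ) 1, ∫⁻ x, ENNReal.ofReal ((fderiv ℝ f (x + t • v) v)^2) :=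
        lintegral_lintegral_swap hj.aemeasurable
    _ = ∫⁻ t in Ioc (0:ℝ) 1, ∫⁻ x, ENNReal.ofReal ((fderiv ℝ f x v)^2) := by
        congr 1; ext t
        exact lintegral_add_right_eq_self (fun x => ENNReal.ofReal ((fderiv ℝ f x v)^2)) (t • v)
    _ = _ := by simp

lemma eLpNorm_two_le {F : E2 → ℝ} {M : ℝ≥0∞} (h : ∫⁻ x, ENNReal.ofReal ((F x)^2) ≤ M) :
    eLpNorm F 2 volume ≤ M ^ (1/2 : ℝ) := by
  rw [eLpNorm_eq_lintegral_rpow_enorm_toReal (by norm_num) (by norm_num)]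
  simp only [ENNReal.toReal_ofNat]
  apply ENNReal.rpow_le_rpow _ (by norm_num)
  refine le_trans (le_of_eq ?_) h
  congr 1; ext x
  rw [Real.enorm_eq_ofReal_abs, ENNReal.ofReal_rpow_of_nonneg (abs_nonneg _) (by norm_num)]
  congr 1
  rw [Real.rpow_ofNat, sq_abs]

lemma weak_conv {Fn : ℕ → E2 → ℝ} {F φ : E2 → ℝ} {K : Set E2} (hK : IsCompact K)
    (hφK : ∀ x ∉ K, φ x = 0) (hφ : MemLp φ 2 volume) (hFm : ∀ n, AEStronglyMeasurable (Fn n) volume)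
    {M : ℝ≥0∞} (hM : M ≠ ⊤) (hb : ∀ n, eLpNorm (Fn n) 2 volume ≤ M) (hF : MemLp F 2 volume)
    (hlim : ∀ x, Tendsto (fun n => Fn n x) atTop (𝓝 (F x))) :
    Tendsto (fun n => ∫ x, Fn n x * φ x) atTop (𝓝 (∫ x, F x * φ x)) := by
  set μ := (volume : Measure E2).restrict K
  have : IsFiniteMeasure μ := ⟨by simpa [μ] using hK.measure_lt_top⟩
  have hφ' : MemLp φ 2 μ := hφ.restrict K
  have e1 : ∀ G : E2 → ℝ, ∫ x, G x * φ x = ∫ x, G x * φ x ∂μ := fun G =>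
    (setIntegral_eq_integral_of_forall_compl_eq_zero (fun x hx => by simp [hφK x hx])).symm
  simp_rw [e1]
  have hgInt : ∀ G, MemLp G 2 (volume : Measure E2) → Integrable (fun x => G x * φ x) μ := fun G hG =>
    (hG.restrict K).integrable_mul hφ'
  have hFn : ∀ n, MemLp (Fn n) 2 (volume : Measure E2) := fun n =>
    ⟨hFm n, lt_of_le_of_lt (hb n) hM.lt_top⟩
  refine tendsto_integral_of_L1' _ (hgInt F hF).aestronglyMeasurable (Eventually.of_forall fun n => hgInt _ (hFn n)) ?_
  refine tendsto_Lp_finite_of_tendsto_ae (le_refl 1) (by norm_num)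
    (fun n => (hgInt _ (hFn n)).aestronglyMeasurable) ?_ ?_ ?_
  · exact memLp_one_iff_integrable.2 (hgInt F hF)
  · intro ε hε
    have hMr : 0 < M.toReal + 1 := by positivity
    obtain ⟨δ, hδ, h⟩ := hφ'.eLpNorm_indicator_le (by norm_num) (by norm_num)
      (ε := ε / (M.toReal + 1)) (by positivity)
    refine ⟨δ, hδ, fun n s hs hμ => ?_⟩
    have : s.indicator (fun x => Fn n x * φ x) = (Fn n) • (s.indicator φ) := by
      ext x; by_cases hx : x ∈ s <;> simp [hx]
    rw [this]
    calc _ ≤ eLpNorm (Fn n) 2 μ * eLpNorm (s.indicator φ) 2 μ :=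
          eLpNorm_smul_le_mul_eLpNorm (hφ'.1.indicator hs) ((hFm n).restrict)
      _ ≤ ENNReal.ofReal (M.toReal + 1) * ENNReal.ofReal (ε / (M.toReal + 1)) := by
          gcongr
          · calc _ ≤ M := (eLpNorm_mono_measure _ Measure.restrict_le_self).trans (hb n)
              _ = ENNReal.ofReal M.toReal := (ENNReal.ofReal_toReal hM).symm
              _ ≤ _ := ENNReal.ofReal_le_ofReal (by linarith)
          · exact h s hs hμ
      _ = ENNReal.ofReal ε := by
          rw [← ENNReal.ofReal_mul hMr.le]; congr 1; field_simp
  · exact ae_of_all _ fun x => (hlim x).mul_const _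

lemma memLp_cc {f : E2 → ℝ} (hf : Continuous f) (hc : HasCompactSupport f) :
    MemLp f 2 (volume : Measure E2) := hf.memLp_of_hasCompactSupport hc

lemma cross_id {f g : E2 → ℝ} (hf : Differentiable ℝ f) (hg : Differentiable ℝ g)
    (hfc : HasCompactSupport f) (hgc : HasCompactSupport g) (a b : E2)
    (hfa : MemLp (fun x => fderiv ℝ f x a) 2 volume) (hfb : MemLp (fun x => fderiv ℝ f x b) 2 volume)
    (hga : MemLp (fun x => fderiv ℝ g x a) 2 volume) (hgb : MemLp (fun x => fderiv ℝ g x b) 2 volume) :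
    ∫ x, fderiv ℝ f x a * fderiv ℝ g x b = ∫ x, fderiv ℝ g x a * fderiv ℝ f x b := by
  set h : ℕ → ℝ := fun n => 1 / ((n:ℝ) + 1) with hh
  have hpos : ∀ n, 0 < h n := fun n => by simp only [hh]; positivity
  have h0 : Tendsto h atTop (𝓝[≠] 0) :=
    tendsto_nhdsWithin_iff.2 ⟨tendsto_one_div_add_atTop_nhds_zero_nat,
      Eventually.of_forall fun n => (hpos n).ne'⟩
  have key : ∀ (u : E2 → ℝ) (s : ℝ) (hs : s = 1 ∨ s = -1) (hu : Differentiable ℝ u)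
      (hua : MemLp (fun x => fderiv ℝ u x a) 2 volume)
      (φ : E2 → ℝ) (hφ : MemLp φ 2 volume) (hφc : HasCompactSupport φ),
      Tendsto (fun n => ∫ x, (s * h n)⁻¹ * (u (x + (s * h n) • a) - u x) * φ x) atTop
        (𝓝 (∫ x, fderiv ℝ u x a * φ x)) := by
    intro u s hs hu hua φ hφ hφc
    have hs0 : s ≠ 0 := by rcases hs with rfl | rfl <;> norm_num
    refine weak_conv (M := (∫⁻ x, ENNReal.ofReal ((fderiv ℝ u x a)^2)) ^ (1/2:ℝ)) hφc
      (fun x hx => image_eq_zero_of_notMem_tsupport hx) hφ ?_ ?_ ?_ hua ?_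
    · intro n
      have := hu.continuous
      exact (by fun_prop : Continuous fun x => (s * h n)⁻¹ * (u (x + (s * h n) • a) - u x)).aestronglyMeasurable
    · have := (memLp_two_iff_integrable_sq hua.1).1 hua
      have := this.2
      rw [hasFiniteIntegral_iff_ofReal (ae_of_all _ fun t => sq_nonneg _)] at this
      exact (ENNReal.rpow_lt_top_of_nonneg (by norm_num) this.ne).ne
    · intro n
      apply eLpNorm_two_le
      have hb := dq_bound hu ((s * h n) • a)
      have hne : s * h n ≠ 0 := mul_ne_zero hs0 (hpos n).ne'
      have e1 : ∀ y : ℝ, ENNReal.ofReal (((s * h n)⁻¹ * y)^2) =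
          ENNReal.ofReal (((s * h n)⁻¹)^2) * ENNReal.ofReal (y^2) := fun y => by
        rw [mul_pow, ENNReal.ofReal_mul (sq_nonneg _)]
      simp_rw [e1]
      rw [lintegral_const_mul' _ _ ENNReal.ofReal_ne_top]
      refine (mul_le_mul_right hb _).trans ?_
      rw [← lintegral_const_mul' _ _ ENNReal.ofReal_ne_top]
      apply le_of_eq
      congr 1; ext x
      rw [← e1, map_smul, smul_eq_mul, inv_mul_cancel_left₀ hne]
    · intro x
      have h2 : HasDerivAt (fun t : ℝ => u (x + t • a)) (fderiv ℝ u x a) 0 := by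
        have h3 : HasDerivAt (fun t : ℝ => x + t • a) a 0 := by
          simpa using ((hasDerivAt_id (0:ℝ)).smul_const a).const_add x
        have h4 : HasFDerivAt u (fderiv ℝ u x) (x + (0:ℝ) • a) := by
          simpa using (hu x).hasFDerivAt
        exact h4.comp_hasDerivAt 0 h3
      have h5 := h2.tendsto_slope_zero
      have h6 : Tendsto (fun n => s * h n) atTop (𝓝[≠] 0) := by
        refine tendsto_nhdsWithin_iff.2 ⟨?_, Eventually.of_forall fun n => mul_ne_zero hs0 (hpos n).ne'⟩
        simpa [hh] using (tendsto_one_div_add_atTop_nhds_zero_nat (𝕜 := ℝ)).const_mul s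
      have h7 := h5.comp h6
      refine h7.congr fun n => ?_
      simp only [Function.comp, zero_add, zero_smul, add_zero, smul_eq_mul]
  have hgbc : HasCompactSupport (fun x => fderiv ℝ g x b) := hgc.fderiv_apply ℝ b
  have hfbc : HasCompactSupport (fun x => fderiv ℝ f x b) := hfc.fderiv_apply ℝ b
  have k1 := key f 1 (Or.inl rfl) hf hfa _ hgb hgbc
  have k2 := key g (-1) (Or.inr rfl) hg hga _ hfb hfbc
  refine tendsto_nhds_unique k1 (k2.congr fun n => ?_)
  have hfL := memLp_cc hf.continuous hfc
  have hgL := memLp_cc hg.continuous hgc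
  have shift : ∀ (u : E2 → ℝ) (w : E2), MemLp u 2 volume → MemLp (fun x => u (x + w)) 2 volume :=
    fun u w hu => hu.comp_measurePreserving (measurePreserving_add_right volume w)
  have ibp : ∀ w : E2, ∫ x, f (x + w) * fderiv ℝ g x b = - ∫ x, fderiv ℝ f (x + w) b * g x := by
    intro w
    have hfd : ∀ x, fderiv ℝ (fun x => f (x + w)) x b = fderiv ℝ f (x + w) b := fun x => by
      rw [fderiv_comp_add_right]
    have := integral_mul_fderiv_eq_neg_fderiv_mul_of_integrable (μ := (volume : Measure E2))
      (f := fun x => f (x + w)) (g := g) (v := b) (𝕜 := ℝ)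
      (by simp_rw [hfd]; exact (shift _ w hfb).integrable_mul hgL)
      ((shift _ w hfL).integrable_mul hgb) ((shift _ w hfL).integrable_mul hgL)
      (fun x _ => (hf.comp (by fun_prop : Differentiable ℝ fun x : E2 => x + w)) x) (fun x _ => hg x)
    simp_rw [hfd] at this
    exact this
  set c := h n with hc
  have hc0 : c ≠ 0 := (hpos n).ne'
  have i1 : ∀ w, Integrable (fun x => f (x + w) * fderiv ℝ g x b) :=
    fun w => (shift _ w hfL).integrable_mul hgb
  have i2 : ∀ w, Integrable (fun x => g (x + w) * fderiv ℝ f x b) :=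
    fun w => (shift _ w hgL).integrable_mul hfb
  have tr : ∫ x, fderiv ℝ f (x + c • a) b * g x = ∫ x, g (x + (-c) • a) * fderiv ℝ f x b := by
    rw [← integral_add_right_eq_self (fun x => g (x + (-c) • a) * fderiv ℝ f x b) (c • a)]
    congr 1; ext x
    rw [add_assoc, neg_smul, add_neg_cancel, add_zero, mul_comm]
  have L : ∫ x, (1 * c)⁻¹ * (f (x + (1 * c) • a) - f x) * fderiv ℝ g x b =
      c⁻¹ * (∫ x, f (x + c • a) * fderiv ℝ g x b) - c⁻¹ * ∫ x, f (x + 0) * fderiv ℝ g x b := by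
    rw [← mul_sub, ← integral_sub (i1 _) (i1 _), ← integral_const_mul]
    congr 1; ext x; simp; ring
  have R : ∫ x, (-1 * c)⁻¹ * (g (x + (-1 * c) • a) - g x) * fderiv ℝ f x b =
      - c⁻¹ * (∫ x, g (x + (-c) • a) * fderiv ℝ f x b) + c⁻¹ * ∫ x, g (x + 0) * fderiv ℝ f x b := by
    have e0 : ∀ p q : ℝ, -c⁻¹ * p + c⁻¹ * q = c⁻¹ * (q - p) := fun p q => by ring
    rw [e0, ← integral_sub (i2 _) (i2 _), ← integral_const_mul]
    congr 1; ext x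
    have : (-1 * c)⁻¹ = - c⁻¹ := by rw [neg_one_mul, inv_neg]
    rw [this]; simp; ring
  rw [L, R, ibp, ibp, tr]
  have : ∫ x, fderiv ℝ f (x + 0) b * g x = ∫ x, g (x + 0) * fderiv ℝ f x b := by
    congr 1; ext x; simp [mul_comm]
  rw [this]; ring

lemma inner2 (v w : E2) : ⟪v, w⟫ = v 0 * w 0 + v 1 * w 1 := by
  simp [PiLp.inner_apply, Fin.sum_univ_two]; ring

lemma normsq2 (v : E2) : ‖v‖^2 = (v 0)^2 + (v 1)^2 := by
  simp [EuclideanSpace.norm_sq_eq, Fin.sum_univ_two]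

@[simp] lemma e00 : e 0 0 = 1 := by simp [e]
@[simp] lemma e01 : e 0 1 = 0 := by simp [e]
@[simp] lemma e10 : e 1 0 = 0 := by simp [e]
@[simp] lemma e11 : e 1 1 = 1 := by simp [e]

lemma inner_e (v : E2) (i : Fin 2) : ⟪v, e i⟫ = v i := by
  rw [inner2]; fin_cases i <;> simp

@[simp] lemma rot0 (v : E2) : rot v 0 = - v 1 := by simp [rot, inner_e]
@[simp] lemma rot1 (v : E2) : rot v 1 = v 0 := by simp [rot, inner_e]

lemma e_decomp (v : E2) : v = v 0 • e 0 + v 1 • e 1 := by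
  ext i; fin_cases i <;> simp

@[simp] lemma norm_e (i : Fin 2) : ‖e i‖ = 1 := by simp [e]

lemma abs_coord_le (v : E2) (i : Fin 2) : |v i| ≤ ‖v‖ := by
  have := normsq2 v
  apply abs_le_of_sq_le_sq _ (norm_nonneg _)
  fin_cases i <;> simp <;> nlinarith [sq_nonneg (v 0), sq_nonneg (v 1)]

lemma grad_inner (X : E2 → E2) (x v : E2) :
    ⟪fderiv ℝ X x v, v⟫ = gradEntry X x 0 0 * (v 0)^2 + (gradEntry X x 0 1 + gradEntry X x 1 0) * (v 0 * v 1)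
      + gradEntry X x 1 1 * (v 1)^2 := by
  have h : fderiv ℝ X x v = v 0 • fderiv ℝ X x (e 0) + v 1 • fderiv ℝ X x (e 1) := by
    conv_lhs => rw [e_decomp v]
    simp
  rw [h]
  simp only [gradEntry, inner_e]
  rw [inner2]; simp; ring

lemma symsq_eq (X : E2 → E2) (x : E2) : symGradNormSq X x =
    (gradEntry X x 0 0)^2 + (gradEntry X x 1 1)^2 + (gradEntry X x 0 1 + gradEntry X x 1 0)^2 / 2 := by
  simp [symGradNormSq, symGradEntry, Fin.sum_univ_two]; ring

lemma symsq_nonneg (X : E2 → E2) (x : E2) : 0 ≤ symGradNormSq X x := by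
  rw [symsq_eq]; positivity

lemma gradsq_eq (X : E2 → E2) (x : E2) : gradNormSq X x =
    symGradNormSq X x + (gradEntry X x 1 0 - gradEntry X x 0 1)^2 / 2 := by
  rw [symsq_eq]; simp [gradNormSq, Fin.sum_univ_two]; ring

lemma grad_inner_sq (X : E2 → E2) (x v : E2) :
    ⟪fderiv ℝ X x v, v⟫^2 ≤ ‖v‖^4 * symGradNormSq X x := by
  rw [grad_inner, symsq_eq, show ‖v‖^4 = (‖v‖^2)^2 by ring, normsq2]
  set a := gradEntry X x 0 0
  set b := gradEntry X x 0 1 + gradEntry X x 1 0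
  set c := gradEntry X x 1 1
  set p := v 0
  set q := v 1
  nlinarith [sq_nonneg (a*q^2 - c*p^2), sq_nonneg (a*(p*q)-b*p^2/2), sq_nonneg (a*(p*q)*2-b*p^2),
    sq_nonneg (c*(p*q)*2-b*q^2), sq_nonneg (a*q^2-c*p^2)]

lemma meas_gradEntry (X : E2 → E2) (i j : Fin 2) : Measurable fun x => gradEntry X x i j := by
  unfold gradEntry
  exact (meas_fd X (e j)).inner_const

lemma meas_symsq (X : E2 → E2) : Measurable fun x => symGradNormSq X x := by
  simp_rw [symsq_eq]
  have := meas_gradEntry X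
  fun_prop

/-- segment estimate -/
lemma seg_est {X : E2 → E2} {V : Set E2} (hV : Convex ℝ V) (hVo : IsOpen V)
    (hX : DifferentiableOn ℝ X V) {x y : E2} (hx : x ∈ V) (hy : y ∈ V) :
    ENNReal.ofReal (⟪X x - X y, x - y⟫^2) ≤ ENNReal.ofReal (‖x - y‖^4) *
      ∫⁻ t in Ioc (0:ℝ) 1, V.indicator (fun w => ENNReal.ofReal (symGradNormSq X w)) (y + t • (x - y)) := by
  set v := x - y with hv
  have hmem : ∀ t ∈ Icc (0:ℝ) 1, y + t • v ∈ V := fun t ht => hV.add_smul_sub_mem hy hx ht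
  have := ftc_sq (u := fun t => ⟪X (y + t • v), v⟫) (u' := fun t => ⟪fderiv ℝ X (y + t • v) v, v⟫)
    (fun t ht => by
      have h2 : HasDerivAt (fun t : ℝ => y + t • v) v t := by
        simpa using ((hasDerivAt_id t).smul_const v).const_add y
      have h3 := ((hX.differentiableAt (hVo.mem_nhds (hmem t ht))).hasFDerivAt.comp_hasDerivAt t h2)
      have h4 := h3.inner ℝ (hasDerivAt_const t v)
      simpa using h4)
    (((meas_fd X v).comp (by fun_prop : Measurable fun t : ℝ => y + t • v)).inner_const)
  simp only [one_smul, zero_smul, add_zero] at this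
  rw [show y + v = x by simp [hv]] at this
  rw [inner_sub_left]
  refine this.trans ?_
  rw [← lintegral_const_mul' _ _ ENNReal.ofReal_ne_top]
  refine setLIntegral_mono' measurableSet_Ioc fun t ht => ?_
  rw [indicator_of_mem (hmem t (Ioc_subset_Icc_self ht)), ← ENNReal.ofReal_mul (by positivity)]
  exact ENNReal.ofReal_le_ofReal (grad_inner_sq _ _ _)

lemma lint_scale (s : E2 → ℝ≥0∞) (hs : Measurable s) {a : ℝ} (ha : 1/2 ≤ a) (w : E2) :
    ∫⁻ y, s (a • y + w) ≤ 4 * ∫⁻ y, s y := by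
  have ha0 : a ≠ 0 := by linarith
  have h1 : ∫⁻ y, s (a • y + w) = ∫⁻ y, s (y + w) ∂(Measure.map (a • ·) volume) := by
    rw [lintegral_map (by fun_prop) (by fun_prop)]
  rw [h1, Measure.map_addHaar_smul volume ha0, lintegral_smul_measure,
    lintegral_add_right_eq_self]
  simp only [finrank_euclideanSpace, Fintype.card_fin, smul_eq_mul]
  gcongr
  rw [show (4:ℝ≥0∞) = ENNReal.ofReal 4 by simp]
  apply ENNReal.ofReal_le_ofReal
  rw [abs_of_pos (by positivity), inv_le_comm₀ (by positivity) (by norm_num)]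
  nlinarith

def segI (s : E2 → ℝ≥0∞) (x y : E2) : ℝ≥0∞ := ∫⁻ t in Ioc (0:ℝ) 1, s (y + t • (x - y))

lemma segI_meas {s : E2 → ℝ≥0∞} (hs : Measurable s) : Measurable fun p : E2 × E2 => segI s p.1 p.2 := by
  unfold segI
  refine Measurable.lintegral_prod_right' (f := fun q : (E2 × E2) × ℝ => s (q.1.2 + q.2 • (q.1.1 - q.1.2))) ?_
  exact hs.comp (by fun_prop)

lemma segI_int {s : E2 → ℝ≥0∞} (hs : Measurable s) (B : Set E2) :
    ∫⁻ y in B, ∫⁻ x in B, segI s x y ≤ 4 * volume B * ∫⁻ w, s w := by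
  have hm : ∀ μ ν : Measure E2, ∀ [SFinite μ], ∀ [SFinite ν], ∫⁻ y, ∫⁻ x, segI s x y ∂μ ∂ν =
      ∫⁻ t in Ioc (0:ℝ) 1, ∫⁻ y, ∫⁻ x, s (y + t • (x - y)) ∂μ ∂ν := by
    intro μ ν _ _
    unfold segI
    have : ∀ y, ∫⁻ x, (∫⁻ t in Ioc (0:ℝ) 1, s (y + t • (x - y))) ∂μ =
        ∫⁻ t in Ioc (0:ℝ) 1, ∫⁻ x, s (y + t • (x - y)) ∂μ := fun y =>
      lintegral_lintegral_swap (f := fun x t => s (y + t • (x - y))) (hs.comp (by fun_prop : Measurable fun q : E2 × ℝ => y + q.2 • (q.1 - y))).aemeasurable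
    simp_rw [this]
    apply lintegral_lintegral_swap (f := fun y t => ∫⁻ x, s (y + t • (x - y)) ∂μ)
    apply Measurable.aemeasurable
    exact Measurable.lintegral_prod_right' (f := fun q : (E2 × ℝ) × E2 => s (q.1.1 + q.1.2 • (q.2 - q.1.1)))
      (hs.comp (by fun_prop))
  rw [hm]
  calc _ ≤ ∫⁻ t in Ioc (0:ℝ) 1, 4 * volume B * ∫⁻ w, s w := by
        refine setLIntegral_mono' measurableSet_Ioc fun t ht => ?_
        rcases le_total t (1/2) with h | h
        · rw [lintegral_lintegral_swap (f := fun y x => s (y + t • (x - y))) (hs.comp (by fun_prop : Measurable fun q : E2 × E2 => q.1 + t • (q.2 - q.1))).aemeasurable]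
          calc _ ≤ ∫⁻ y in B, 4 * ∫⁻ w, s w := by
                refine lintegral_mono fun x => ?_
                refine (setLIntegral_le_lintegral _ _).trans ?_
                refine le_trans (le_of_eq ?_) (lint_scale s hs (a := 1 - t) (by linarith) (t • x))
                congr 1; ext y; congr 1; module
            _ = _ := by simp; ring
        · calc _ ≤ ∫⁻ y in B, 4 * ∫⁻ w, s w := by
                refine lintegral_mono fun y => ?_
                refine (setLIntegral_le_lintegral _ _).trans ?_
                refine le_trans (le_of_eq ?_) (lint_scale s hs (a := t) (by linarith) ((1 - t) • y))
                congr 1; ext x; congr 1; module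
            _ = _ := by simp; ring
    _ = _ := by simp

lemma cramer {a b c d z w p q K : ℝ} (h1 : a * z + b * w = p) (h2 : c * z + d * w = q)
    (hD : 1 ≤ (a*d-b*c)^2) (hab : a^2+b^2 ≤ K) (hcd : c^2 + d^2 ≤ K) :
    z^2 + w^2 ≤ 2*K*(p^2+q^2) := by
  have e1 : (a*d-b*c) * z = d*p - b*q := by rw [← h1, ← h2]; ring
  have e2 : (a*d-b*c) * w = a*q - c*p := by rw [← h1, ← h2]; ring
  have k1 : z^2 + w^2 ≤ (a*d-b*c)^2 * (z^2 + w^2) := le_mul_of_one_le_left (by positivity) hD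
  have k2 : (a*d-b*c)^2 * (z^2 + w^2) = (d*p-b*q)^2 + (a*q-c*p)^2 := by rw [← e1, ← e2]; ring
  have k3 : (d*p-b*q)^2 + (a*q-c*p)^2 ≤ (a^2+b^2+c^2+d^2)*(p^2+q^2) := by
    nlinarith [sq_nonneg (d*q+b*p), sq_nonneg (a*p+c*q)]
  have k4 : (a^2+b^2+c^2+d^2)*(p^2+q^2) ≤ (2*K)*(p^2+q^2) := by gcongr; linarith
  linarith

lemma pick_pt {f : E2 → ℝ≥0∞} (hf : Measurable f) {A : Set E2} (h0 : volume A ≠ 0) (h1 : volume A ≠ ⊤)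
    {L : ℝ≥0∞} (h : ∫⁻ x in A, f x ≤ L) : ∃ x ∈ A, f x ≤ L / volume A := by
  obtain ⟨x, hx, h2⟩ := exists_le_setLAverage h0 h1 hf.aemeasurable.restrict
  refine ⟨x, hx, h2.trans ?_⟩
  rw [setLAverage_eq]
  gcongr

lemma inner_sq_le {z w : E2} {N K : ℝ} (hN : ‖z‖^2 ≤ N) (hK : ‖w‖^2 ≤ K) : ⟪z, w⟫^2 ≤ N * K := by
  have h := abs_real_inner_le_norm z w
  calc ⟪z, w⟫^2 = |⟪z, w⟫|^2 := (sq_abs _).symm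
    _ ≤ (‖z‖ * ‖w‖)^2 := by gcongr
    _ = ‖z‖^2 * ‖w‖^2 := by ring
    _ ≤ N * K := by gcongr; exact (sq_nonneg _).trans hN

lemma cramerE {a b z : E2} {p q : ℝ} (h1 : ⟪z, a⟫ = p) (h2 : ⟪z, b⟫ = q)
    (hD : 1 ≤ (a 0 * b 1 - a 1 * b 0)^2) (ha : ‖a‖^2 ≤ 16) (hb : ‖b‖^2 ≤ 16) :
    ‖z‖^2 ≤ 32 * (p^2+q^2) := by
  rw [normsq2] at ha hb ⊢
  rw [inner2] at h1 h2
  have := cramer (a := a 0) (b := a 1) (c := b 0) (d := b 1) (z := z 0) (w := z 1) (p := p) (q := q) (K := 16)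
    (by linarith) (by linarith) (by linarith) ha hb
  linarith

lemma rigid_alg {Z : E2 → E2} {y₁ y₂ y₃ x : E2} {N : ℝ}
    (hd : (y₂ - y₁) 0 ∈ Icc (9/5:ℝ) (11/5)) (hd1 : |(y₂ - y₁) 1| ≤ 1/5)
    (hf : (y₃ - y₁) 0 ∈ Icc (4/5:ℝ) (6/5)) (hf1 : (y₃ - y₁) 1 ∈ Icc (4/5:ℝ) (6/5))
    (n21 : ‖y₂ - y₁‖^2 ≤ 16) (n31 : ‖y₃ - y₁‖^2 ≤ 16) (n32 : ‖y₃ - y₂‖^2 ≤ 16)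
    (nx2 : ‖x - y₂‖^2 ≤ 16) (nx3 : ‖x - y₃‖^2 ≤ 16)
    (z1 : Z y₁ = 0) (z2 : ⟪Z y₂, rot (y₂ - y₁)⟫ = 0)
    (h21 : ⟪Z y₂ - Z y₁, y₂ - y₁⟫^2 ≤ N) (h31 : ⟪Z y₃ - Z y₁, y₃ - y₁⟫^2 ≤ N)
    (h32 : ⟪Z y₃ - Z y₂, y₃ - y₂⟫^2 ≤ N) (hx1 : ⟪Z x - Z y₁, x - y₁⟫^2 ≤ N)
    (hx2 : ⟪Z x - Z y₂, x - y₂⟫^2 ≤ N) (hx3 : ⟪Z x - Z y₃, x - y₃⟫^2 ≤ N) :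
    ‖Z x‖^2 ≤ 10^8 * N := by
  have hN : 0 ≤ N := (sq_nonneg _).trans h21
  rw [z1, sub_zero] at h21 h31 hx1
  obtain ⟨hd1l, hd1u⟩ := abs_le.1 hd1
  obtain ⟨hdl, hdu⟩ := hd
  obtain ⟨hfl, hfu⟩ := hf
  obtain ⟨hfl1, hfu1⟩ := hf1
  have hdet : 1 ≤ (y₂ - y₁) 0 * (y₃ - y₁) 1 - (y₂ - y₁) 1 * (y₃ - y₁) 0 := by nlinarith
  have hdet2 : 1 ≤ ((y₂ - y₁) 0 * (y₃ - y₁) 1 - (y₂ - y₁) 1 * (y₃ - y₁) 0)^2 := one_le_pow₀ hdet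
  have b2 : ‖Z y₂‖^2 ≤ 32 * N := by
    have := cramerE (a := y₂ - y₁) (b := rot (y₂ - y₁)) rfl z2
      (by
        simp only [rot0, rot1]
        have hq : 1 ≤ (y₂ - y₁) 0 * (y₂ - y₁) 0 - (y₂ - y₁) 1 * -(y₂ - y₁) 1 := by
          nlinarith [sq_nonneg ((y₂ - y₁) 1)]
        exact one_le_pow₀ hq) n21
      (by rw [normsq2] at n21 ⊢; simp only [rot0, rot1]; linarith)
    linarith
  have b3 : ‖Z y₃‖^2 ≤ 40000 * N := by
    have k := inner_sq_le b2 n32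
    have e1 : ⟪Z y₃, y₃ - y₂⟫ = ⟪Z y₃ - Z y₂, y₃ - y₂⟫ + ⟪Z y₂, y₃ - y₂⟫ := by
      rw [inner_sub_left]; ring
    have := cramerE (a := y₃ - y₁) (b := y₃ - y₂) rfl e1
      (by
        have : (y₃ - y₁) 0 * (y₃ - y₂) 1 - (y₃ - y₁) 1 * (y₃ - y₂) 0 =
          (y₂ - y₁) 0 * (y₃ - y₁) 1 - (y₂ - y₁) 1 * (y₃ - y₁) 0 := by simp; ring
        rw [this]; exact hdet2) n31 n32
    have hs := sq_nonneg (⟪Z y₃ - Z y₂, y₃ - y₂⟫ - ⟪Z y₂, y₃ - y₂⟫)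
    have hs2 : (⟪Z y₃ - Z y₂, y₃ - y₂⟫ + ⟪Z y₂, y₃ - y₂⟫)^2 ≤
      2 * ⟪Z y₃ - Z y₂, y₃ - y₂⟫^2 + 2 * ⟪Z y₂, y₃ - y₂⟫^2 := by linarith only [hs]
    linarith only [this, hs2, k, h31, h32, hN]
  have k2 := inner_sq_le b2 nx2
  have k3 := inner_sq_le b3 nx3
  have e1 : ⟪Z x, y₂ - y₁⟫ = ⟪Z x, x - y₁⟫ - (⟪Z x - Z y₂, x - y₂⟫ + ⟪Z y₂, x - y₂⟫) := by
    simp only [inner_sub_left, inner_sub_right]; ring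
  have e2 : ⟪Z x, y₃ - y₁⟫ = ⟪Z x, x - y₁⟫ - (⟪Z x - Z y₃, x - y₃⟫ + ⟪Z y₃, x - y₃⟫) := by
    simp only [inner_sub_left, inner_sub_right]; ring
  have := cramerE (a := y₂ - y₁) (b := y₃ - y₁) e1 e2 hdet2 n21 n31
  have sq3 : ∀ a b c : ℝ, (a - (b + c))^2 ≤ 3 * a^2 + 3 * b^2 + 3 * c^2 := fun a b c => by
    nlinarith [sq_nonneg (a+b), sq_nonneg (a+c), sq_nonneg (b-c)]
  have s1 := sq3 ⟪Z x, x - y₁⟫ ⟪Z x - Z y₂, x - y₂⟫ ⟪Z y₂, x - y₂⟫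
  have s2 := sq3 ⟪Z x, x - y₁⟫ ⟪Z x - Z y₃, x - y₃⟫ ⟪Z y₃, x - y₃⟫
  linarith only [this, s1, s2, k2, k3, hx1, hx2, hx3, hN]

lemma rot_inner_self (v : E2) : ⟪rot v, v⟫ = 0 := by rw [inner2]; simp; ring

lemma rot_sub (v w : E2) : rot (v - w) = rot v - rot w := by
  ext i; fin_cases i <;> simp; ring

set_option maxHeartbeats 400000 in
lemma rigid : ∃ C : ℝ, 0 ≤ C ∧ ∀ X : E2 → E2, DifferentiableOn ℝ X (ball (0:E2) 2) →
    (∫⁻ x in ball (0:E2) 2, ENNReal.ofReal (symGradNormSq X x)) ≠ ⊤ →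
    ∃ (b : E2) (k : ℝ), ∫⁻ x in ball (0:E2) 2, ENNReal.ofReal (‖X x - b - k • rot x‖^2) ≤
      ENNReal.ofReal C * ∫⁻ x in ball (0:E2) 2, ENNReal.ofReal (symGradNormSq X x) := by
  obtain ⟨B, hB⟩ : ∃ B : Set E2, B = ball 0 2 := ⟨_, rfl⟩
  have hBm : MeasurableSet B := hB ▸ measurableSet_ball
  rw [← hB]
  obtain ⟨V, hV⟩ : ∃ V, V = volume B := ⟨_, rfl⟩
  obtain ⟨v, hv⟩ : ∃ v, v = volume (ball (0:E2) (1/10)) := ⟨_, rfl⟩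
  have hVt : V ≠ ⊤ := by rw [hV, hB]; exact measure_ball_lt_top.ne
  have hvt : v ≠ ⊤ := hv ▸ measure_ball_lt_top.ne
  have hv0 : v ≠ 0 := hv ▸ (measure_ball_pos volume (0:E2) (by norm_num)).ne'
  obtain ⟨K1, hK1⟩ : ∃ K1, K1 = 4 * V / v := ⟨_, rfl⟩
  obtain ⟨K2, hK2⟩ : ∃ K2, K2 = (4 * V + K1) / v := ⟨_, rfl⟩
  obtain ⟨K3, hK3⟩ : ∃ K3, K3 = (4 * V + K1 + K2) / v := ⟨_, rfl⟩
  have h4V : 4 * V ≠ ⊤ := ENNReal.mul_ne_top (by norm_num) hVt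
  have hK1t : K1 ≠ ⊤ := hK1 ▸ ENNReal.div_ne_top h4V hv0
  have hK2t : K2 ≠ ⊤ := hK2 ▸ ENNReal.div_ne_top (ENNReal.add_ne_top.2 ⟨h4V, hK1t⟩) hv0
  have hK3t : K3 ≠ ⊤ := hK3 ▸ ENNReal.div_ne_top (ENNReal.add_ne_top.2 ⟨ENNReal.add_ne_top.2 ⟨h4V, hK1t⟩, hK2t⟩) hv0
  obtain ⟨K, hK⟩ : ∃ K, K = K1 + K2 + K3 := ⟨_, rfl⟩
  have hKt : K ≠ ⊤ := by simp [hK, hK1t, hK2t, hK3t]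
  obtain ⟨Q, hQ, hQ0⟩ : ∃ Q : ℝ, Q = 10^8 * 256 ∧ 0 < Q := ⟨10^8 * 256, rfl, by norm_num⟩
  refine ⟨(ENNReal.ofReal Q * (K * V + 3 * K)).toReal, ENNReal.toReal_nonneg, fun X hX hfin => ?_⟩
  have hCt : (ENNReal.ofReal Q * (K * V + 3 * K) : ℝ≥0∞) ≠ ⊤ := by
    exact ENNReal.mul_ne_top ENNReal.ofReal_ne_top (ENNReal.add_ne_top.2
      ⟨ENNReal.mul_ne_top hKt hVt, ENNReal.mul_ne_top (by norm_num) hKt⟩)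
  rw [ENNReal.ofReal_toReal hCt]
  obtain ⟨s, hs⟩ : ∃ s : E2 → ℝ≥0∞, s = B.indicator (fun w => ENNReal.ofReal (symGradNormSq X w)) := ⟨_, rfl⟩
  have hsm : Measurable s := hs ▸ ((meas_symsq X).ennreal_ofReal).indicator hBm
  obtain ⟨m, hm⟩ : ∃ m, m = ∫⁻ x in B, ENNReal.ofReal (symGradNormSq X x) := ⟨_, rfl⟩
  rw [← hm] at hfin ⊢
  have hsint : ∫⁻ w, s w = m := by rw [hs, lintegral_indicator hBm, hm]
  have hI := segI_meas hsm
  obtain ⟨F, hF⟩ : ∃ F : E2 → ℝ≥0∞, F = fun y => ∫⁻ x in B, segI s x y := ⟨_, rfl⟩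
  have hFm : Measurable F := hF ▸ Measurable.lintegral_prod_right' (f := fun q : E2 × E2 => segI s q.2 q.1)
    (hI.comp measurable_swap)
  have hFint : ∫⁻ y in B, F y ≤ 4 * V * m := by
    rw [← hsint, hF, hV]; exact segI_int hsm B
  have hvol : ∀ c : E2, volume (ball c (1/10)) = v := fun c => hv ▸ Measure.addHaar_ball_center volume c _
  have hsub : ∀ c : E2, ‖c‖ ≤ 1 → ball c (1/10) ⊆ B := fun c hc =>
    hB ▸ ball_subset_ball' (by rw [dist_zero_right]; linarith)
  have hIl : ∀ y, Measurable fun x => segI s x y := fun y => hI.comp (by fun_prop : Measurable fun x : E2 => (x, y))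
  -- pick points
  have norm1 : ‖-e 0‖ ≤ 1 := by simp
  obtain ⟨y₁, hy₁, F1⟩ := pick_pt hFm (A := ball (-e 0) (1/10)) (by rw [hvol]; exact hv0) (by rw [hvol]; exact hvt)
    ((lintegral_mono_set (hsub _ norm1)).trans hFint)
  rw [hvol] at F1
  have F1' : F y₁ ≤ K1 * m := F1.trans (le_of_eq (by rw [hK1]; simp only [div_eq_mul_inv]; ring))
  obtain ⟨y₂, hy₂, F2⟩ := pick_pt (hFm.add (hIl y₁)) (A := ball (e 0) (1/10)) (L := (4 * V + K1) * m)
    (by rw [hvol]; exact hv0) (by rw [hvol]; exact hvt) (by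
      simp only [Pi.add_apply]
      rw [lintegral_add_left hFm, add_mul]
      exact add_le_add ((lintegral_mono_set (hsub _ (by simp))).trans hFint)
        ((lintegral_mono_set (hsub _ (by simp))).trans ((congrFun hF y₁).symm.le.trans F1')))
  rw [hvol] at F2
  have F2' : F y₂ + segI s y₂ y₁ ≤ K2 * m := F2.trans (le_of_eq (by rw [hK2]; simp only [div_eq_mul_inv]; ring))
  obtain ⟨y₃, hy₃, F3⟩ := pick_pt ((hFm.add (hIl y₁)).add (hIl y₂)) (A := ball (e 1) (1/10)) (L := (4 * V + K1 + K2) * m)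
    (by rw [hvol]; exact hv0) (by rw [hvol]; exact hvt) (by
      simp only [Pi.add_apply]
      rw [lintegral_add_right _ (hIl y₂), lintegral_add_left hFm, add_mul, add_mul]
      exact add_le_add (add_le_add ((lintegral_mono_set (hsub _ (by simp))).trans hFint)
        ((lintegral_mono_set (hsub _ (by simp))).trans ((congrFun hF y₁).symm.le.trans F1')))
        ((lintegral_mono_set (hsub _ (by simp))).trans ((congrFun hF y₂).symm.le.trans (le_self_add.trans F2'))))
  rw [hvol] at F3
  have F3' : F y₃ + segI s y₃ y₁ + segI s y₃ y₂ ≤ K3 * m :=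
    F3.trans (le_of_eq (by rw [hK3]; simp only [div_eq_mul_inv]; ring))
  have b1 : F y₁ ≤ K * m := F1'.trans (by gcongr; rw [hK, add_assoc]; exact le_self_add)
  have k2 : K2 * m ≤ K * m := by gcongr; rw [hK, add_assoc]; exact le_add_left le_self_add
  have k3 : K3 * m ≤ K * m := by gcongr; rw [hK]; exact le_add_self
  have b2 : F y₂ ≤ K * m := (le_self_add.trans F2').trans k2
  have b21 : segI s y₂ y₁ ≤ K * m := (le_add_self.trans F2').trans k2
  have b3 : F y₃ ≤ K * m := ((le_self_add.trans le_self_add).trans F3').trans k3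
  have b31 : segI s y₃ y₁ ≤ K * m := ((le_add_self.trans le_self_add).trans F3').trans k3
  have b32 : segI s y₃ y₂ ≤ K * m := (le_add_self.trans F3').trans k3
  have hKm : K * m ≠ ⊤ := ENNReal.mul_ne_top hKt hfin
  -- geometry
  have c1 : ∀ i, |(y₁ - -e 0) i| ≤ 1/10 := fun i => (abs_coord_le _ i).trans (mem_ball_iff_norm.1 hy₁).le
  have c2 : ∀ i, |(y₂ - e 0) i| ≤ 1/10 := fun i => (abs_coord_le _ i).trans (mem_ball_iff_norm.1 hy₂).le
  have c3 : ∀ i, |(y₃ - e 1) i| ≤ 1/10 := fun i => (abs_coord_le _ i).trans (mem_ball_iff_norm.1 hy₃).le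
  have hyB1 := hsub _ norm1 hy₁
  have hyB2 : y₂ ∈ B := hsub _ (by simp) hy₂
  have hyB3 : y₃ ∈ B := hsub _ (by simp) hy₃
  have hn : ∀ x ∈ B, ∀ y ∈ B, ‖x - y‖ ≤ 4 := fun x hx y hy => by
    have := norm_sub_le x y
    have h1 := mem_ball_zero_iff.1 (hB ▸ hx : x ∈ ball (0:E2) 2)
    have h2 := mem_ball_zero_iff.1 (hB ▸ hy : y ∈ ball (0:E2) 2)
    linarith
  have hn2 : ∀ x ∈ B, ∀ y ∈ B, ‖x - y‖^2 ≤ 16 := fun x hx y hy => by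
    nlinarith [hn x hx y hy, norm_nonneg (x - y)]
  have a10 := abs_le.1 (c1 0); have a11 := abs_le.1 (c1 1)
  have a20 := abs_le.1 (c2 0); have a21 := abs_le.1 (c2 1)
  have a30 := abs_le.1 (c3 0); have a31 := abs_le.1 (c3 1)
  simp at a10 a11 a20 a21 a30 a31
  obtain ⟨d, hd⟩ : ∃ d, d = y₂ - y₁ := ⟨_, rfl⟩
  obtain ⟨k, hk⟩ : ∃ k : ℝ, k = ⟪X y₂ - X y₁, rot d⟫ / ‖d‖^2 := ⟨_, rfl⟩
  obtain ⟨b, hb⟩ : ∃ b : E2, b = X y₁ - k • rot y₁ := ⟨_, rfl⟩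
  refine ⟨b, k, ?_⟩
  obtain ⟨Z, hZ⟩ : ∃ Z : E2 → E2, Z = fun x => X x - b - k • rot x := ⟨_, rfl⟩
  have hdpos : 0 < ‖d‖^2 := by
    rw [normsq2]; simp [hd]; nlinarith [sq_nonneg (y₂ 1 - y₁ 1)]
  have hZd : ∀ x y, ⟪Z x - Z y, x - y⟫ = ⟪X x - X y, x - y⟫ := fun x y => by
    have : Z x - Z y = X x - X y - k • rot (x - y) := by rw [rot_sub]; simp only [hZ]; module
    rw [this, inner_sub_left, inner_smul_left, rot_inner_self]; simp
  have z1 : Z y₁ = 0 := by simp [hZ, hb]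
  have z2 : ⟪Z y₂, rot (y₂ - y₁)⟫ = 0 := by
    have : Z y₂ = X y₂ - X y₁ - k • rot d := by rw [hd, rot_sub]; simp only [hZ, hb]; module
    rw [this, inner_sub_left, inner_smul_left, ← hd]
    have h3 : ⟪rot d, rot d⟫ = ‖d‖^2 := by rw [inner2, normsq2]; simp; ring
    rw [h3, hk]
    simp only [conj_trivial]
    rw [div_mul_cancel₀ _ hdpos.ne', sub_self]
  have hseg : ∀ x ∈ B, ∀ y ∈ B, ENNReal.ofReal (⟪Z x - Z y, x - y⟫^2) ≤ 256 * segI s x y := by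
    intro x hx y hy
    rw [hZd]
    refine (seg_est (hB ▸ convex_ball _ _) (hB ▸ isOpen_ball) hX hx hy).trans ?_
    rw [← hs]
    unfold segI
    gcongr
    rw [show (256 : ℝ≥0∞) = ENNReal.ofReal 256 by simp]
    apply ENNReal.ofReal_le_ofReal
    have := hn2 x hx y hy
    nlinarith [sq_nonneg ‖x - y‖]
  have main : ∀ x ∈ B, ENNReal.ofReal (‖Z x‖^2) ≤
      ENNReal.ofReal Q * (K * m + segI s x y₁ + segI s x y₂ + segI s x y₃) := by
    intro x hx
    obtain ⟨T, hT⟩ : ∃ T, T = K * m + segI s x y₁ + segI s x y₂ + segI s x y₃ := ⟨_, rfl⟩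
    rw [← hT]
    by_cases hTt : T = ⊤
    · rw [hTt, ENNReal.mul_top (by simpa using hQ0)]; exact le_top
    have conv : ∀ (p : E2) (hp : p ∈ B) (q : E2) (hq : q ∈ B), segI s p q ≤ T →
        ⟪Z p - Z q, p - q⟫^2 ≤ 256 * T.toReal := by
      intro p hp q hq hle
      have h := (hseg p hp q hq).trans (mul_le_mul_right hle 256)
      have h2 := (ENNReal.ofReal_le_iff_le_toReal (ENNReal.mul_ne_top (by norm_num) hTt)).1 h
      simpa using h2
    have t0 : K * m ≤ T := by rw [hT, add_assoc, add_assoc]; exact le_self_add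
    have := rigid_alg (Z := Z) (y₁ := y₁) (y₂ := y₂) (y₃ := y₃) (x := x) (N := 256 * T.toReal)
      (by simp; constructor <;> linarith) (by simp; rw [abs_le]; constructor <;> linarith)
      (by simp; constructor <;> linarith)
      (by simp; constructor <;> linarith)
      (hn2 _ hyB2 _ hyB1) (hn2 _ hyB3 _ hyB1) (hn2 _ hyB3 _ hyB2) (hn2 _ hx _ hyB2) (hn2 _ hx _ hyB3)
      z1 z2 (conv _ hyB2 _ hyB1 (b21.trans t0)) (conv _ hyB3 _ hyB1 (b31.trans t0)) (conv _ hyB3 _ hyB2 (b32.trans t0))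
      (conv _ hx _ hyB1 (by rw [hT, add_assoc, add_assoc]; exact le_add_left le_self_add))
      (conv _ hx _ hyB2 (by rw [hT, add_assoc]; exact le_add_left le_self_add))
      (conv _ hx _ hyB3 (by rw [hT]; exact le_add_self))
    rw [ENNReal.ofReal_le_iff_le_toReal (ENNReal.mul_ne_top ENNReal.ofReal_ne_top hTt)]
    refine this.trans (le_of_eq ?_)
    rw [ENNReal.toReal_mul, ENNReal.toReal_ofReal hQ0.le, hQ, mul_assoc]
  calc ∫⁻ x in B, ENNReal.ofReal (‖X x - b - k • rot x‖^2)
      ≤ ∫⁻ x in B, ENNReal.ofReal Q * (K * m + segI s x y₁ + segI s x y₂ + segI s x y₃) :=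
        setLIntegral_mono' hBm (fun x hx => by simpa only [hZ] using main x hx)
    _ = ENNReal.ofReal Q * (K * m * V + F y₁ + F y₂ + F y₃) := by
        rw [lintegral_const_mul' _ _ ENNReal.ofReal_ne_top, lintegral_add_right _ (hIl _), lintegral_add_right _ (hIl _),
          lintegral_add_right _ (hIl _), setLIntegral_const, hF, hV]
    _ ≤ ENNReal.ofReal Q * (K * m * V + K * m + K * m + K * m) := by gcongr
    _ = _ := by ring

def om (X : E2 → E2) (x : E2) : ℝ := (gradEntry X x 1 0 - gradEntry X x 0 1) / 2

lemma meas_om (X : E2 → E2) : Measurable (om X) := by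
  have := meas_gradEntry X
  unfold om
  fun_prop

lemma gradEntry_comp {Y : E2 → E2} {x : E2} (h : DifferentiableAt ℝ Y x) (i j : Fin 2) :
    fderiv ℝ (fun x => Y x i) x (e j) = gradEntry Y x i j := by
  have h1 := (EuclideanSpace.proj i : E2 →L[ℝ] ℝ).hasFDerivAt.comp x h.hasFDerivAt
  have h2 : fderiv ℝ (fun x => Y x i) x = (EuclideanSpace.proj i : E2 →L[ℝ] ℝ).comp (fderiv ℝ Y x) := h1.fderiv
  rw [h2, gradEntry, inner_e]; rfl

lemma gradEntry_sq_le (Y : E2 → E2) (x : E2) (i j : Fin 2) : (gradEntry Y x i j)^2 ≤ gradNormSq Y x := by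
  simp only [gradNormSq, Fin.sum_univ_two]
  fin_cases i <;> fin_cases j <;> simp <;>
  nlinarith [sq_nonneg (gradEntry Y x 0 0), sq_nonneg (gradEntry Y x 1 0), sq_nonneg (gradEntry Y x 0 1), sq_nonneg (gradEntry Y x 1 1)]

lemma korn1 {Y : E2 → E2} (hY : Differentiable ℝ Y) (hc : HasCompactSupport Y)
    (hfin : ∫⁻ x, ENNReal.ofReal (gradNormSq Y x) ≠ ⊤) :
    ∫⁻ x, ENNReal.ofReal ((om Y x)^2) ≤ ∫⁻ x, ENNReal.ofReal (symGradNormSq Y x) := by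
  have hL : ∀ i j, MemLp (fun x => gradEntry Y x i j) 2 volume := by
    intro i j
    rw [memLp_two_iff_integrable_sq (meas_gradEntry Y i j).aestronglyMeasurable]
    refine ⟨((meas_gradEntry Y i j).pow_const 2).aestronglyMeasurable, ?_⟩
    rw [hasFiniteIntegral_iff_ofReal (ae_of_all _ fun t => sq_nonneg _)]
    refine lt_of_le_of_lt (lintegral_mono fun x => ?_) hfin.lt_top
    exact ENNReal.ofReal_le_ofReal (gradEntry_sq_le Y x i j)
  have hc' : ∀ i : Fin 2, HasCompactSupport (fun x => Y x i) := fun i =>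
    hc.comp_left (g := fun v : E2 => v i) rfl
  have hd : ∀ i : Fin 2, Differentiable ℝ (fun x => Y x i) := fun i =>
    (EuclideanSpace.proj i : E2 →L[ℝ] ℝ).differentiable.comp hY
  have hge : ∀ i j x, fderiv ℝ (fun x => Y x i) x (e j) = gradEntry Y x i j := fun i j x =>
    gradEntry_comp (hY x) i j
  have hx := cross_id (hd 0) (hd 1) (hc' 0) (hc' 1) (e 0) (e 1)
    (by simp_rw [hge]; exact hL _ _) (by simp_rw [hge]; exact hL _ _)
    (by simp_rw [hge]; exact hL _ _) (by simp_rw [hge]; exact hL _ _)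
  simp_rw [hge] at hx
  have i1 : Integrable (fun x => gradEntry Y x 0 0 * gradEntry Y x 1 1) := (hL _ _).integrable_mul (hL _ _)
  have i2 : Integrable (fun x => gradEntry Y x 1 0 * gradEntry Y x 0 1) := (hL _ _).integrable_mul (hL _ _)
  have isq : ∀ i j, Integrable (fun x => (gradEntry Y x i j)^2) := fun i j => (hL i j).integrable_sq
  have i3 : Integrable (fun x => (om Y x)^2) := by
    have h := (((isq 1 0).add (isq 0 1)).div_const 4).sub (i2.div_const 2)
    refine h.congr (ae_of_all _ fun x => ?_)
    simp only [om, Pi.sub_apply, Pi.add_apply]; ring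
  have i4 : Integrable (fun x => symGradNormSq Y x) := by
    have h := (((isq 1 0).add (isq 0 1)).div_const 2).add (i2.add ((isq 0 0).add (isq 1 1)))
    refine h.congr (ae_of_all _ fun x => ?_)
    simp only [Pi.add_apply, symsq_eq]; ring
  rw [← ofReal_integral_eq_lintegral_ofReal i3 (ae_of_all _ fun t => sq_nonneg _),
    ← ofReal_integral_eq_lintegral_ofReal i4 (ae_of_all _ fun t => symsq_nonneg _ _)]
  apply ENNReal.ofReal_le_ofReal
  have h0 : ∫ x, (om Y x)^2 = ∫ x, ((om Y x)^2 + (gradEntry Y x 1 0 * gradEntry Y x 0 1 - gradEntry Y x 0 0 * gradEntry Y x 1 1)) := by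
    have i5 : Integrable (fun x => gradEntry Y x 1 0 * gradEntry Y x 0 1 - gradEntry Y x 0 0 * gradEntry Y x 1 1) := i2.sub i1
    rw [integral_add i3 i5, integral_sub i2 i1, hx]; ring
  rw [h0]
  refine integral_mono (i3.add (i2.sub i1)) i4 fun x => ?_
  simp only
  rw [symsq_eq, om]
  nlinarith [sq_nonneg (gradEntry Y x 0 0 + gradEntry Y x 1 1), sq_nonneg (gradEntry Y x 0 0), sq_nonneg (gradEntry Y x 1 1), sq_nonneg (gradEntry Y x 0 1 + gradEntry Y x 1 0)]

lemma rot_hasFDerivAt (x : E2) : ∃ L : E2 →L[ℝ] E2, (∀ v, L v = rot v) ∧ HasFDerivAt rot L x := by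
  let L : E2 →ₗ[ℝ] E2 :=
    { toFun := rot
      map_add' := fun v w => by ext i; fin_cases i <;> simp; ring
      map_smul' := fun c v => by ext i; fin_cases i <;> simp }
  exact ⟨L.toContinuousLinearMap, fun v => rfl, L.toContinuousLinearMap.hasFDerivAt⟩

lemma grad_Z {X : E2 → E2} {x : E2} (hX : DifferentiableAt ℝ X x) (b : E2) (k : ℝ) :
    DifferentiableAt ℝ (fun x => X x - b - k • rot x) x ∧
    ∀ i j, gradEntry (fun x => X x - b - k • rot x) x i j = gradEntry X x i j - k * (rot (e j)) i := by
  obtain ⟨L, hL, hd⟩ := rot_hasFDerivAt x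
  have h := (hX.hasFDerivAt.sub_const b).sub (hd.const_smul k)
  refine ⟨h.differentiableAt, fun i j => ?_⟩
  have h2 : fderiv ℝ (fun x => X x - b - k • rot x) x = fderiv ℝ X x - k • L := h.fderiv
  simp only [gradEntry, h2, inner_e]
  simp [hL]

lemma grad_smul {η : E2 → ℝ} {Z : E2 → E2} {x : E2} (hη : DifferentiableAt ℝ η x) (hZ : DifferentiableAt ℝ Z x) :
    DifferentiableAt ℝ (fun x => η x • Z x) x ∧
    ∀ i j, gradEntry (fun x => η x • Z x) x i j = η x * gradEntry Z x i j + fderiv ℝ η x (e j) * Z x i := by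
  have h := hη.hasFDerivAt.smul hZ.hasFDerivAt
  refine ⟨h.differentiableAt, fun i j => ?_⟩
  have h2 : fderiv ℝ (fun x => η x • Z x) x = _ := h.fderiv
  simp only [gradEntry, h2, inner_e]
  simp

lemma K0unit : ∃ C : ℝ, 0 ≤ C ∧ ∀ X : E2 → E2, DifferentiableOn ℝ X (ball (0:E2) 2) →
    (∫⁻ x in ball (0:E2) 2, ENNReal.ofReal (gradNormSq X x)) ≠ ⊤ →
    ∃ k : ℝ, ∫⁻ x in ball (0:E2) 1, ENNReal.ofReal ((om X x - k)^2) ≤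
      ENNReal.ofReal C * ∫⁻ x in ball (0:E2) 2, ENNReal.ofReal (symGradNormSq X x) := by
  obtain ⟨C, hC, hR⟩ := rigid
  let η : ContDiffBump (0:E2) := ⟨1, 3/2, by norm_num, by norm_num⟩
  have hηd : ContDiff ℝ 1 η := η.contDiff
  have hηdiff : Differentiable ℝ η := hηd.differentiable (by norm_num)
  obtain ⟨L, hL⟩ : ∃ L, ∀ x, ‖fderiv ℝ η x‖ ≤ L :=
    (hηd.continuous_fderiv (by norm_num)).bounded_above_of_compact_support (η.hasCompactSupport.fderiv ℝ)
  have hL0 : 0 ≤ L := (norm_nonneg _).trans (hL 0)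
  have hLj : ∀ x j, (fderiv ℝ η x (e j))^2 ≤ L^2 := fun x j => by
    have h1 : |fderiv ℝ η x (e j)| ≤ L := by
      have := (fderiv ℝ η x).le_opNorm (e j)
      rw [norm_e, mul_one] at this
      exact this.trans (hL x)
    rw [← sq_abs]; gcongr
  refine ⟨2 + 8 * L^2 * C, by positivity, fun X hX hfin => ?_⟩
  obtain ⟨B, hB⟩ : ∃ B : Set E2, B = ball 0 2 := ⟨_, rfl⟩
  have hBo : IsOpen B := hB ▸ isOpen_ball
  have hBm : MeasurableSet B := hBo.measurableSet
  have hsfin : ∫⁻ x in B, ENNReal.ofReal (symGradNormSq X x) ≠ ⊤ := by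
    rw [← hB] at hfin
    refine (lt_of_le_of_lt (lintegral_mono fun x => ENNReal.ofReal_le_ofReal ?_) hfin.lt_top).ne
    rw [gradsq_eq]; nlinarith [sq_nonneg (gradEntry X x 1 0 - gradEntry X x 0 1)]
  obtain ⟨b, k, hbk⟩ := hR X hX (hB ▸ hsfin)
  refine ⟨k, ?_⟩
  rw [← hB] at hbk hX hfin ⊢
  obtain ⟨Z, hZ⟩ : ∃ Z : E2 → E2, Z = fun x => X x - b - k • rot x := ⟨_, rfl⟩
  have hZg : ∀ x ∈ B, DifferentiableAt ℝ Z x ∧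
      ∀ i j, gradEntry Z x i j = gradEntry X x i j - k * (rot (e j)) i := fun x hx =>
    hZ ▸ grad_Z (hX.differentiableAt (hBo.mem_nhds hx)) b k
  obtain ⟨Y, hY⟩ : ∃ Y : E2 → E2, Y = fun x => η x • Z x := ⟨_, rfl⟩
  have hYg : ∀ x ∈ B, DifferentiableAt ℝ Y x ∧
      ∀ i j, gradEntry Y x i j = η x * gradEntry Z x i j + fderiv ℝ η x (e j) * Z x i := fun x hx =>
    hY ▸ grad_smul (hηdiff x) (hZg x hx).1
  have hYout : ∀ x ∉ B, Y =ᶠ[𝓝 x] fun _ => 0 := by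
    intro x hx
    have hx2 : x ∈ (closedBall (0:E2) (3/2))ᶜ := by
      rw [hB] at hx
      simp at hx ⊢; linarith
    filter_upwards [isClosed_closedBall.isOpen_compl.mem_nhds hx2] with y hy
    have : η y = 0 := η.zero_of_le_dist (by
      simp at hy; simp [η]; linarith)
    simp [hY, this]
  have hYd : Differentiable ℝ Y := by
    intro x
    by_cases hx : x ∈ B
    · exact (hYg x hx).1
    · exact (differentiableAt_const (0:E2)).congr_of_eventuallyEq (hYout x hx)
  have hYc : HasCompactSupport Y := by rw [hY]; exact η.hasCompactSupport.smul_right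
  have hYo : ∀ x ∉ B, ∀ i j, gradEntry Y x i j = 0 := by
    intro x hx i j
    simp [gradEntry, (hYout x hx).fderiv_eq]
  have hη1 : ∀ x, (η x)^2 ≤ 1 := fun x => by
    have h1 := η.nonneg (x := x); have h2 := η.le_one (x := x); nlinarith
  have hZn : ∀ x, (Z x 0)^2 + (Z x 1)^2 = ‖Z x‖^2 := fun x => (normsq2 _).symm
  have hZsq : ∀ x i, (Z x i)^2 ≤ ‖Z x‖^2 := fun x i => by
    rw [← hZn]; fin_cases i <;> simp <;> nlinarith [sq_nonneg (Z x 0), sq_nonneg (Z x 1)]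
  have hentry : ∀ x ∈ B, ∀ i j, (gradEntry Y x i j)^2 ≤ 2 * (gradEntry Z x i j)^2 + 2 * L^2 * ‖Z x‖^2 := by
    intro x hx i j
    rw [(hYg x hx).2]
    have h1 := mul_le_mul (hLj x j) (hZsq x i) (sq_nonneg _) (sq_nonneg _)
    have h2 := mul_le_mul_of_nonneg_right (hη1 x) (sq_nonneg (gradEntry Z x i j))
    nlinarith [sq_nonneg (η x * gradEntry Z x i j - fderiv ℝ η x (e j) * Z x i)]
  have hsym : ∀ x ∈ B, symGradNormSq Y x ≤ 2 * symGradNormSq X x + 8 * L^2 * ‖Z x‖^2 := by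
    intro x hx
    rw [symsq_eq, symsq_eq]
    simp only [(hYg x hx).2, (hZg x hx).2]
    simp only [rot0, rot1, e00, e01, e10, e11]
    have q : ∀ a b : ℝ, (η x * a + b)^2 ≤ 2 * a^2 + 2 * b^2 := fun a b => by
      have h2 := mul_le_mul_of_nonneg_right (hη1 x) (sq_nonneg a)
      nlinarith [sq_nonneg (η x * a - b)]
    have h00 := mul_le_mul (hLj x 0) (hZsq x 0) (sq_nonneg _) (sq_nonneg _)
    have h11 := mul_le_mul (hLj x 1) (hZsq x 1) (sq_nonneg _) (sq_nonneg _)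
    have h01 := mul_le_mul (hLj x 0) (hZsq x 1) (sq_nonneg _) (sq_nonneg _)
    have h10 := mul_le_mul (hLj x 1) (hZsq x 0) (sq_nonneg _) (sq_nonneg _)
    have q0 := q (gradEntry X x 0 0) (fderiv ℝ η x (e 0) * Z x 0)
    have q1 := q (gradEntry X x 1 1) (fderiv ℝ η x (e 1) * Z x 1)
    have q2 := q (gradEntry X x 0 1 + gradEntry X x 1 0) (fderiv ℝ η x (e 1) * Z x 0 + fderiv ℝ η x (e 0) * Z x 1)
    have q3 : (fderiv ℝ η x (e 1) * Z x 0 + fderiv ℝ η x (e 0) * Z x 1)^2 ≤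
      2 * (fderiv ℝ η x (e 1) * Z x 0)^2 + 2 * (fderiv ℝ η x (e 0) * Z x 1)^2 := by
      nlinarith [sq_nonneg (fderiv ℝ η x (e 1) * Z x 0 - fderiv ℝ η x (e 0) * Z x 1)]
    rw [← mul_pow] at h00 h11 h01 h10
    have r0 : η x * (gradEntry X x 0 0 - k * -0) + fderiv ℝ η x (e 0) * Z x 0 = η x * gradEntry X x 0 0 + fderiv ℝ η x (e 0) * Z x 0 := by ring
    have r1 : η x * (gradEntry X x 1 1 - k * 0) + fderiv ℝ η x (e 1) * Z x 1 = η x * gradEntry X x 1 1 + fderiv ℝ η x (e 1) * Z x 1 := by ring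
    have r2 : η x * (gradEntry X x 0 1 - k * -1) + fderiv ℝ η x (e 1) * Z x 0 + (η x * (gradEntry X x 1 0 - k * 1) + fderiv ℝ η x (e 0) * Z x 1) =
      η x * (gradEntry X x 0 1 + gradEntry X x 1 0) + (fderiv ℝ η x (e 1) * Z x 0 + fderiv ℝ η x (e 0) * Z x 1) := by ring
    rw [r0, r1, r2]
    linarith
  have hsplit : ∀ (g : E2 → ℝ) (a c : ℝ), 0 ≤ a → 0 ≤ c → Measurable g → (∀ x, 0 ≤ g x) →
      ∫⁻ x in B, ENNReal.ofReal (a * g x + c * ‖Z x‖^2) ≤ ENNReal.ofReal a * (∫⁻ x in B, ENNReal.ofReal (g x)) +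
        ENNReal.ofReal c * (ENNReal.ofReal C * ∫⁻ x in B, ENNReal.ofReal (symGradNormSq X x)) := by
    intro g a c ha hc hg hg0
    calc _ = ∫⁻ x in B, (ENNReal.ofReal a * ENNReal.ofReal (g x) + ENNReal.ofReal c * ENNReal.ofReal (‖Z x‖^2)) := by
          congr 1; ext x
          rw [ENNReal.ofReal_add (mul_nonneg ha (hg0 x)) (by positivity), ENNReal.ofReal_mul ha, ENNReal.ofReal_mul hc]
      _ = ENNReal.ofReal a * (∫⁻ x in B, ENNReal.ofReal (g x)) + ENNReal.ofReal c * ∫⁻ x in B, ENNReal.ofReal (‖Z x‖^2) := by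
          rw [lintegral_add_left (by fun_prop), lintegral_const_mul' _ _ ENNReal.ofReal_ne_top, lintegral_const_mul' _ _ ENNReal.ofReal_ne_top]
      _ ≤ _ := by
          gcongr
          rw [hZ]; exact hbk
  have hout0 : ∀ x ∉ B, gradNormSq Y x = 0 := fun x hx => by simp [gradNormSq, hYo x hx]
  have hout1 : ∀ x ∉ B, symGradNormSq Y x = 0 := fun x hx => by simp [symsq_eq, hYo x hx]
  have hYfin : ∫⁻ x, ENNReal.ofReal (gradNormSq Y x) ≠ ⊤ := by
    have h1 : ∫⁻ x, ENNReal.ofReal (gradNormSq Y x) = ∫⁻ x in B, ENNReal.ofReal (gradNormSq Y x) := by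
      rw [← lintegral_indicator hBm]
      congr 1; ext x
      by_cases hx : x ∈ B
      · simp [hx]
      · simp [hx, hout0 x hx]
    rw [h1]
    have h2 : ∀ x ∈ B, gradNormSq Y x ≤ 1 * (4 * gradNormSq X x + 16 * k^2) + (8 * L^2) * ‖Z x‖^2 := by
      intro x hx
      have hh : ∀ i j, (gradEntry Z x i j)^2 ≤ 2 * (gradEntry X x i j)^2 + 2 * k^2 := by
        intro i j
        rw [(hZg x hx).2]
        have : (k * rot (e j) i)^2 ≤ k^2 := by
          fin_cases i <;> fin_cases j <;> simp <;> positivity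
        nlinarith [sq_nonneg (gradEntry X x i j + k * rot (e j) i)]
      simp only [gradNormSq, Fin.sum_univ_two]
      linarith [hentry x hx 0 0, hentry x hx 0 1, hentry x hx 1 0, hentry x hx 1 1, hh 0 0, hh 0 1, hh 1 0, hh 1 1]
    have hgm : Measurable fun x => gradNormSq X x := by
      have := meas_gradEntry X
      simp only [gradNormSq, Fin.sum_univ_two]; fun_prop
    have hg0 : ∀ x, 0 ≤ gradNormSq X x := fun x => by simp only [gradNormSq, Fin.sum_univ_two]; positivity
    refine (lt_of_le_of_lt ((setLIntegral_mono' hBm fun x hx => ENNReal.ofReal_le_ofReal (h2 x hx)).trans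
      (hsplit (fun x => 4 * gradNormSq X x + 16 * k^2) 1 _ zero_le_one (by positivity) (by fun_prop)
        (fun x => by have := hg0 x; positivity))) ?_).ne
    refine ENNReal.add_lt_top.2 ⟨ENNReal.mul_lt_top ENNReal.ofReal_lt_top ?_,
      ENNReal.mul_lt_top ENNReal.ofReal_lt_top (ENNReal.mul_lt_top ENNReal.ofReal_lt_top hsfin.lt_top)⟩
    have : ∀ x, ENNReal.ofReal (4 * gradNormSq X x + 16 * k^2) = ENNReal.ofReal 4 * ENNReal.ofReal (gradNormSq X x) + ENNReal.ofReal (16 * k^2) :=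
      fun x => by rw [ENNReal.ofReal_add (by have := hg0 x; positivity) (by positivity), ENNReal.ofReal_mul (by norm_num)]
    simp_rw [this]
    rw [lintegral_add_right _ measurable_const, lintegral_const_mul' _ _ ENNReal.ofReal_ne_top, setLIntegral_const]
    exact ENNReal.add_lt_top.2 ⟨ENNReal.mul_lt_top ENNReal.ofReal_lt_top hfin.lt_top,
      ENNReal.mul_lt_top ENNReal.ofReal_lt_top (hB ▸ measure_ball_lt_top)⟩
  have hkorn := korn1 hYd hYc hYfin
  have hsubB : ball (0:E2) 1 ⊆ B := hB ▸ ball_subset_ball (by norm_num)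
  calc ∫⁻ x in ball (0:E2) 1, ENNReal.ofReal ((om X x - k)^2)
      = ∫⁻ x in ball (0:E2) 1, ENNReal.ofReal ((om Y x)^2) := by
        refine setLIntegral_congr_fun measurableSet_ball fun x hx => ?_
        have h1 : η =ᶠ[𝓝 x] fun _ => 1 := by
          filter_upwards [isOpen_ball.mem_nhds hx] with y hy
          exact η.one_of_mem_closedBall (ball_subset_closedBall hy)
        have h2 : fderiv ℝ η x = 0 := by rw [h1.fderiv_eq]; simp
        have h3 : η x = 1 := h1.self_of_nhds
        have hxB := hsubB hx
        simp only [om, (hYg x hxB).2, (hZg x hxB).2, h2, h3]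
        simp
        congr 2; ring
    _ ≤ ∫⁻ x, ENNReal.ofReal ((om Y x)^2) := setLIntegral_le_lintegral _ _
    _ ≤ ∫⁻ x, ENNReal.ofReal (symGradNormSq Y x) := hkorn
    _ = ∫⁻ x in B, ENNReal.ofReal (symGradNormSq Y x) := by
        rw [← lintegral_indicator hBm]
        congr 1; ext x
        by_cases hx : x ∈ B
        · simp [hx]
        · simp [hx, hout1 x hx]
    _ ≤ _ := setLIntegral_mono' hBm fun x hx => ENNReal.ofReal_le_ofReal (hsym x hx)
    _ ≤ _ := hsplit _ 2 _ (by norm_num) (by positivity) (meas_symsq X) (symsq_nonneg X)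
    _ = _ := by
        rw [ENNReal.ofReal_add (by norm_num) (by positivity), ENNReal.ofReal_mul (p := 8 * L^2) (by positivity)]
        ring

lemma vol_ball (x : E2) {r : ℝ} (hr : 0 ≤ r) : volume (ball x r) = ENNReal.ofReal (Real.pi * r^2) := by
  rw [EuclideanSpace.volume_ball_fin_two, ENNReal.ofReal_mul Real.pi_pos.le, ENNReal.ofReal_pow hr, mul_comm]

lemma vol_ball_ge (x : E2) {r : ℝ} (hr : 0 ≤ r) : ENNReal.ofReal (r^2) ≤ volume (ball x r) := by
  rw [vol_ball x hr]
  apply ENNReal.ofReal_le_ofReal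
  nlinarith [Real.pi_gt_three, sq_nonneg r]

lemma vol_ball_le (x : E2) {r : ℝ} (hr : 0 ≤ r) : volume (ball x r) ≤ ENNReal.ofReal (4 * r^2) := by
  rw [vol_ball x hr]
  apply ENNReal.ofReal_le_ofReal
  nlinarith [Real.pi_lt_four, sq_nonneg r]

lemma lint_affine (g : E2 → ℝ≥0∞) (hg : Measurable g) (z : E2) {ρ : ℝ} (hρ : 0 < ρ) :
    ∫⁻ y, g (z + ρ • y) = ENNReal.ofReal ((ρ^2)⁻¹) * ∫⁻ y, g y := by
  have h1 : ∫⁻ y, g (z + ρ • y) = ∫⁻ y, g (z + y) ∂(Measure.map (ρ • ·) volume) := by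
    rw [lintegral_map (by fun_prop) (by fun_prop)]
  rw [h1, Measure.map_addHaar_smul volume hρ.ne', lintegral_smul_measure,
    lintegral_add_left_eq_self]
  simp only [finrank_euclideanSpace, Fintype.card_fin, smul_eq_mul]
  rw [abs_of_pos (by positivity)]

lemma lint_affine_ball (g : E2 → ℝ≥0∞) (hg : Measurable g) (z : E2) {ρ R : ℝ} (hρ : 0 < ρ) :
    ∫⁻ y in ball (0:E2) R, g (z + ρ • y) = ENNReal.ofReal ((ρ^2)⁻¹) * ∫⁻ y in ball z (ρ * R), g y := by
  rw [← lintegral_indicator measurableSet_ball, ← lintegral_indicator measurableSet_ball,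
    ← lint_affine _ (hg.indicator measurableSet_ball) z hρ]
  congr 1; ext y
  by_cases hy : y ∈ ball (0:E2) R
  · have : z + ρ • y ∈ ball z (ρ * R) := by
      rw [mem_ball_iff_norm] at hy ⊢
      simp [norm_smul, abs_of_pos hρ] at hy ⊢; exact mul_lt_mul_of_pos_left hy hρ
    rw [indicator_of_mem hy, indicator_of_mem this]
  · have : z + ρ • y ∉ ball z (ρ * R) := by
      rw [mem_ball_iff_norm] at hy ⊢
      simp [norm_smul, abs_of_pos hρ] at hy ⊢; exact mul_le_mul_of_nonneg_left hy hρ.le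
    rw [indicator_of_notMem hy, indicator_of_notMem this]

lemma grad_scale {X : E2 → E2} {z x : E2} {ρ : ℝ} (h : DifferentiableAt ℝ X (z + ρ • x)) :
    DifferentiableAt ℝ (fun x => X (z + ρ • x)) x ∧
    ∀ i j, gradEntry (fun x => X (z + ρ • x)) x i j = ρ * gradEntry X (z + ρ • x) i j := by
  have h1 : HasFDerivAt (fun x : E2 => z + ρ • x) (ρ • ContinuousLinearMap.id ℝ E2) x :=
    ((hasFDerivAt_id x).const_smul ρ).const_add z
  have h2 := h.hasFDerivAt.comp x h1
  refine ⟨h2.differentiableAt, fun i j => ?_⟩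
  have h3 : fderiv ℝ (fun x => X (z + ρ • x)) x = _ := h2.fderiv
  simp only [gradEntry, h3, inner_e]
  simp

lemma K0 : ∃ C : ℝ, 0 < C ∧ ∀ (z : E2) (ρ : ℝ), 0 < ρ → ∀ X : E2 → E2, DifferentiableOn ℝ X (ball z (2*ρ)) →
    (∫⁻ x in ball z (2*ρ), ENNReal.ofReal (gradNormSq X x)) ≠ ⊤ →
    ∃ k : ℝ, ∫⁻ x in ball z ρ, ENNReal.ofReal ((om X x - k)^2) ≤
      ENNReal.ofReal C * ∫⁻ x in ball z (2*ρ), ENNReal.ofReal (symGradNormSq X x) := by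
  obtain ⟨C, hC, h⟩ := K0unit
  refine ⟨C + 1, by positivity, fun z ρ hρ X hX hfin => ?_⟩
  have hmem : ∀ x ∈ ball (0:E2) 2, z + ρ • x ∈ ball z (2*ρ) := by
    intro x hx
    rw [mem_ball_iff_norm] at hx ⊢
    simp [norm_smul, abs_of_pos hρ] at hx ⊢; nlinarith
  have hd : ∀ x ∈ ball (0:E2) 2, DifferentiableAt ℝ X (z + ρ • x) := fun x hx =>
    hX.differentiableAt (isOpen_ball.mem_nhds (hmem x hx))
  obtain ⟨X', hX'⟩ : ∃ X' : E2 → E2, X' = fun x => X (z + ρ • x) := ⟨_, rfl⟩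
  have hg : ∀ x ∈ ball (0:E2) 2, ∀ i j, gradEntry X' x i j = ρ * gradEntry X (z + ρ • x) i j := fun x hx =>
    hX' ▸ (grad_scale (hd x hx)).2
  have hgm : Measurable fun x => gradNormSq X x := by
    have := meas_gradEntry X
    simp only [gradNormSq, Fin.sum_univ_two]; fun_prop
  have hρ2 : ENNReal.ofReal (ρ^2) * ENNReal.ofReal ((ρ^2)⁻¹) = 1 := by
    rw [← ENNReal.ofReal_mul (by positivity), mul_inv_cancel₀ (by positivity), ENNReal.ofReal_one]
  have key : ∀ (g : E2 → ℝ) (g' : E2 → ℝ) (R : ℝ), Measurable g → (∀ x ∈ ball (0:E2) R, g' x = ρ^2 * g (z + ρ • x)) →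
      ∫⁻ x in ball (0:E2) R, ENNReal.ofReal (g' x) = ∫⁻ x in ball z (ρ * R), ENNReal.ofReal (g x) := by
    intro g g' R hgm hgg
    calc _ = ∫⁻ x in ball (0:E2) R, ENNReal.ofReal (ρ^2) * ENNReal.ofReal (g (z + ρ • x)) :=
          setLIntegral_congr_fun measurableSet_ball fun x hx => by
            show ENNReal.ofReal (g' x) = _
            rw [hgg x hx, ENNReal.ofReal_mul (by positivity)]
      _ = _ := by
          rw [lintegral_const_mul' _ _ ENNReal.ofReal_ne_top, lint_affine_ball (fun x => ENNReal.ofReal (g x)) hgm.ennreal_ofReal z hρ,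
            ← mul_assoc, hρ2, one_mul]
  have k1 := key (gradNormSq X) (gradNormSq X') 2 hgm (fun x hx => by
    simp only [gradNormSq, hg x hx, Fin.sum_univ_two]; ring)
  have k2 := key (symGradNormSq X) (symGradNormSq X') 2 (meas_symsq X) (fun x hx => by
    simp only [symsq_eq, hg x hx]; ring)
  rw [mul_comm ρ 2] at k1 k2
  obtain ⟨k, hk⟩ := h X' (fun x hx => (hX' ▸ (grad_scale (hd x hx)).1).differentiableWithinAt) (by rw [k1]; exact hfin)
  refine ⟨k / ρ, ?_⟩
  have k3 := key (fun x => (om X x - k/ρ)^2) (fun x => (om X' x - k)^2) 1 (by have := meas_om X; fun_prop)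
    (fun x hx => by
      have hx2 : x ∈ ball (0:E2) 2 := ball_subset_ball (by norm_num) hx
      simp only [om, hg x hx2]; field_simp; try ring)
  rw [k2, k3, mul_one] at hk
  refine hk.trans ?_
  gcongr
  linarith

/-- Abstract local oscillation property. -/
structure KC (Ω : Set E2) (w : E2 → ℝ) (m : Measure E2) (C0 : ℝ) (k : E2 → ℝ → ℝ) : Prop where
  pos : 0 < C0
  meas : Measurable w
  fin : IsFiniteMeasure m
  loc : ∀ z ρ, 0 < ρ → ball z (2*ρ) ⊆ Ω →
    ∫⁻ x in ball z ρ, ENNReal.ofReal ((w x - k z ρ)^2) ≤ ENNReal.ofReal C0 * m (ball z (2*ρ))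

lemma sq_sub_le (a b c : ℝ) : (a - b)^2 ≤ 2 * (c - a)^2 + 2 * (c - b)^2 := by
  nlinarith [sq_nonneg ((c - a) + (c - b))]

lemma KC.cmp {Ω w m C0 k} (h : KC Ω w m C0 k) {y y' q : E2} {ρ ρ' τ : ℝ} (hρ : 0 < ρ) (hρ' : 0 < ρ') (hτ : 0 < τ)
    (hy : ball y (2*ρ) ⊆ Ω) (hy' : ball y' (2*ρ') ⊆ Ω) (h1 : ball q τ ⊆ ball y ρ) (h2 : ball q τ ⊆ ball y' ρ') :
    ENNReal.ofReal ((k y ρ - k y' ρ')^2) ≤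
      ENNReal.ofReal (2 * C0 / τ^2) * (m (ball y (2*ρ)) + m (ball y' (2*ρ'))) := by
  have hm := h.meas
  have key : ENNReal.ofReal ((k y ρ - k y' ρ')^2) * ENNReal.ofReal (τ^2) ≤
      2 * (ENNReal.ofReal C0 * m (ball y (2*ρ)) + ENNReal.ofReal C0 * m (ball y' (2*ρ'))) := by
    calc _ ≤ ENNReal.ofReal ((k y ρ - k y' ρ')^2) * volume (ball q τ) := by gcongr; exact vol_ball_ge q hτ.le
      _ = ∫⁻ x in ball q τ, ENNReal.ofReal ((k y ρ - k y' ρ')^2) := by rw [setLIntegral_const]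
      _ ≤ ∫⁻ x in ball q τ, (2 * ENNReal.ofReal ((w x - k y ρ)^2) + 2 * ENNReal.ofReal ((w x - k y' ρ')^2)) := by
          refine lintegral_mono fun x => ?_
          refine (ENNReal.ofReal_le_ofReal (sq_sub_le _ _ (w x))).trans (le_of_eq ?_)
          rw [ENNReal.ofReal_add (by positivity) (by positivity), ENNReal.ofReal_mul (by norm_num), ENNReal.ofReal_mul (by norm_num)]
          simp
      _ = 2 * (∫⁻ x in ball q τ, ENNReal.ofReal ((w x - k y ρ)^2)) + 2 * ∫⁻ x in ball q τ, ENNReal.ofReal ((w x - k y' ρ')^2) := by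
          rw [lintegral_add_left (by fun_prop), lintegral_const_mul' _ _ (by norm_num), lintegral_const_mul' _ _ (by norm_num)]
      _ ≤ 2 * (∫⁻ x in ball y ρ, ENNReal.ofReal ((w x - k y ρ)^2)) + 2 * ∫⁻ x in ball y' ρ', ENNReal.ofReal ((w x - k y' ρ')^2) := by
          gcongr
      _ ≤ 2 * (ENNReal.ofReal C0 * m (ball y (2*ρ))) + 2 * (ENNReal.ofReal C0 * m (ball y' (2*ρ'))) := by
          gcongr
          · exact h.loc _ _ hρ hy
          · exact h.loc _ _ hρ' hy'
      _ = _ := by ring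
  have hτ2 : ENNReal.ofReal (τ^2) ≠ 0 := by simp; positivity
  rw [← ENNReal.le_div_iff_mul_le (Or.inl hτ2) (Or.inl ENNReal.ofReal_ne_top)] at key
  refine key.trans (le_of_eq ?_)
  rw [ENNReal.ofReal_div_of_pos (by positivity), ENNReal.ofReal_mul (by norm_num), div_eq_mul_inv, div_eq_mul_inv]
  simp
  ring

lemma KC.pair {Ω w m C0 k} (h : KC Ω w m C0 k) {z : E2} {ρ : ℝ} (hρ : 0 < ρ) (hz : ball z (2*ρ) ⊆ Ω) :
    ∫⁻ x in ball z ρ, ∫⁻ y in ball z ρ, ENNReal.ofReal ((w x - w y)^2) ≤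
      4 * ENNReal.ofReal C0 * volume (ball z ρ) * m (ball z (2*ρ)) := by
  have hm := h.meas
  have hl := h.loc z ρ hρ hz
  set A := ∫⁻ x in ball z ρ, ENNReal.ofReal ((w x - k z ρ)^2) with hA
  set v := volume (ball z ρ) with hv
  have hpt : ∀ x y, ENNReal.ofReal ((w x - w y)^2) ≤ 2 * ENNReal.ofReal ((w x - k z ρ)^2) + 2 * ENNReal.ofReal ((w y - k z ρ)^2) := by
    intro x y
    refine (ENNReal.ofReal_le_ofReal (sq_sub_le _ _ (k z ρ))).trans (le_of_eq ?_)
    rw [ENNReal.ofReal_add (by positivity) (by positivity), ENNReal.ofReal_mul (by norm_num), ENNReal.ofReal_mul (by norm_num),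
      ← neg_sub (w x), ← neg_sub (w y), neg_sq, neg_sq]
    simp
  calc _ ≤ ∫⁻ x in ball z ρ, ∫⁻ y in ball z ρ, (2 * ENNReal.ofReal ((w x - k z ρ)^2) + 2 * ENNReal.ofReal ((w y - k z ρ)^2)) :=
        lintegral_mono fun x => lintegral_mono fun y => hpt x y
    _ = ∫⁻ x in ball z ρ, (2 * v * ENNReal.ofReal ((w x - k z ρ)^2) + 2 * A) := by
        congr 1; ext x
        rw [lintegral_add_left (by fun_prop), setLIntegral_const, lintegral_const_mul' _ _ (by norm_num)]
        ring
    _ = 2 * v * A + 2 * A * v := by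
        rw [lintegral_add_right _ measurable_const, setLIntegral_const,
          lintegral_const_mul' _ _ (ENNReal.mul_ne_top (by norm_num) measure_ball_lt_top.ne)]
    _ = 4 * v * A := by ring
    _ ≤ 4 * v * (ENNReal.ofReal C0 * m (ball z (2*ρ))) := by gcongr
    _ = _ := by ring

lemma meas_ballset (s : ℝ) : MeasurableSet {p : E2 × E2 | dist p.1 p.2 < s} :=
  measurableSet_lt (by fun_prop) measurable_const

lemma ball_tonelli (m : Measure E2) [SFinite m] (L : Set E2) (s : ℝ) :
    ∫⁻ x in L, m (ball x s) = ∫⁻ y, volume (ball y s ∩ L) ∂m := by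
  have h1 := Measure.prod_apply (μ := volume.restrict L) (ν := m) (meas_ballset s)
  have h2 := Measure.prod_apply_symm (μ := volume.restrict L) (ν := m) (meas_ballset s)
  rw [h1] at h2
  have e1 : ∀ x : E2, (Prod.mk x ⁻¹' {p : E2 × E2 | dist p.1 p.2 < s}) = ball x s := fun x => by
    ext y; simp [dist_comm]
  have e2 : ∀ y : E2, ((fun x => (x, y)) ⁻¹' {p : E2 × E2 | dist p.1 p.2 < s}) = ball y s := fun y => by
    ext x; simp
  simp_rw [e1, e2, Measure.restrict_apply measurableSet_ball] at h2
  exact h2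

lemma meas_ball_fun (m : Measure E2) [SFinite m] (s : ℝ) : Measurable fun x => m (ball x s) := by
  have := measurable_measure_prodMk_left (ν := m) (meas_ballset s)
  have e1 : ∀ x : E2, (Prod.mk x ⁻¹' {p : E2 × E2 | dist p.1 p.2 < s}) = ball x s := fun x => by
    ext y; simp [dist_comm]
  simpa only [e1] using this

/-- Grid point. -/
def gridPt (ρ : ℝ) (a : ℤ × ℤ) : E2 := (ρ * a.1) • e 0 + (ρ * a.2) • e 1

lemma gridPt0 (ρ : ℝ) (a : ℤ × ℤ) : gridPt ρ a 0 = ρ * a.1 := by simp [gridPt]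
lemma gridPt1 (ρ : ℝ) (a : ℤ × ℤ) : gridPt ρ a 1 = ρ * a.2 := by simp [gridPt]

lemma grid_cover {ρ : ℝ} (hρ : 0 < ρ) (x : E2) : ∃ a, x ∈ ball (gridPt ρ a) ρ := by
  refine ⟨(round (x 0 / ρ), round (x 1 / ρ)), ?_⟩
  have h0 := abs_sub_round (x 0 / ρ)
  have h1 := abs_sub_round (x 1 / ρ)
  rw [mem_ball_iff_norm]
  apply lt_of_pow_lt_pow_left₀ 2 hρ.le
  rw [normsq2]
  have k : ∀ t : ℝ, |t / ρ - round (t / ρ)| ≤ 1/2 → (t - ρ * round (t/ρ))^2 ≤ ρ^2/4 := by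
    intro t ht
    have : t - ρ * round (t/ρ) = ρ * (t/ρ - round (t/ρ)) := by field_simp
    rw [this, mul_pow]
    have h2 : (t/ρ - round (t/ρ))^2 ≤ 1/4 := by
      rw [abs_le] at ht; nlinarith
    nlinarith [sq_nonneg ρ]
  have := k _ h0
  have := k _ h1
  simp only [PiLp.sub_apply, gridPt0, gridPt1]
  nlinarith [pow_pos hρ 2]

lemma grid_overlap {ρ : ℝ} (hρ : 0 < ρ) (m : Measure E2) (R : Set E2) (hR : MeasurableSet R) :
    ∑' a : ℤ × ℤ, m (ball (gridPt ρ a) (4*ρ) ∩ R) ≤ 81 * m R := by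
  have h1 : ∀ a, m (ball (gridPt ρ a) (4*ρ) ∩ R) = ∫⁻ x in R, (ball (gridPt ρ a) (4*ρ)).indicator 1 x ∂m := by
    intro a
    rw [lintegral_indicator_one measurableSet_ball, Measure.restrict_apply measurableSet_ball]
  simp_rw [h1]
  rw [← lintegral_tsum (fun a => (measurable_one.indicator measurableSet_ball).aemeasurable)]
  have h2 : ∀ x : E2, ∑' a : ℤ × ℤ, (ball (gridPt ρ a) (4*ρ)).indicator (1 : E2 → ℝ≥0∞) x ≤ 81 := by
    intro x
    let S : Finset (ℤ × ℤ) := Finset.Icc (⌊x 0 / ρ⌋ - 4) (⌊x 0 / ρ⌋ + 4) ×ˢ Finset.Icc (⌊x 1 / ρ⌋ - 4) (⌊x 1 / ρ⌋ + 4)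
    have hS : ∀ a ∉ S, (ball (gridPt ρ a) (4*ρ)).indicator (1 : E2 → ℝ≥0∞) x = 0 := by
      intro a ha
      rw [indicator_of_notMem]
      intro hx
      apply ha
      rw [mem_ball_iff_norm] at hx
      have k : ∀ i : Fin 2, ∀ n : ℤ, gridPt ρ a i = ρ * n → n ∈ Finset.Icc (⌊x i / ρ⌋ - 4) (⌊x i / ρ⌋ + 4) := by
        intro i n hn
        have h3 := (abs_coord_le (x - gridPt ρ a) i).trans_lt hx
        rw [PiLp.sub_apply, hn, abs_lt] at h3
        have h4 : x i / ρ - n < 4 := by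
          rw [sub_lt_iff_lt_add, div_lt_iff₀ hρ]; nlinarith
        have h5 : -4 < x i / ρ - n := by
          rw [lt_sub_iff_add_lt, lt_div_iff₀ hρ]; nlinarith
        have h6 := Int.floor_le (x i / ρ)
        have h7 := Int.lt_floor_add_one (x i / ρ)
        rw [Finset.mem_Icc]
        constructor
        · have : ((⌊x i / ρ⌋ - 4 : ℤ) : ℝ) < n + 1 := by push_cast; linarith
          have : ⌊x i / ρ⌋ - 4 < n + 1 := by exact_mod_cast this
          omega
        · have : (n : ℝ) < ((⌊x i / ρ⌋ + 1 + 4 : ℤ) : ℝ) := by push_cast; linarith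
          have : n < ⌊x i / ρ⌋ + 1 + 4 := by exact_mod_cast this
          omega
      exact Finset.mem_product.2 ⟨k 0 _ (gridPt0 ρ a), k 1 _ (gridPt1 ρ a)⟩
    rw [tsum_eq_sum hS]
    calc _ ≤ ∑ a ∈ S, (1 : ℝ≥0∞) := Finset.sum_le_sum fun a _ => indicator_le_self' (fun _ _ => zero_le) x
      _ = 81 := by
        simp only [Finset.sum_const, nsmul_eq_mul, mul_one, S, Finset.card_product, Int.card_Icc]
        have : ∀ z : ℤ, (z + 4 + 1 - (z - 4)).toNat = 9 := fun z => by
          rw [show z + 4 + 1 - (z - 4) = 9 by ring]; rfl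
        rw [this, this]; norm_num
  calc _ ≤ ∫⁻ x in R, 81 ∂m := lintegral_mono h2
    _ = _ := by rw [setLIntegral_const]

lemma ofReal_sq_split (a b c : ℝ) : ENNReal.ofReal ((a - b)^2) ≤ 2 * ENNReal.ofReal ((a - c)^2) + 2 * ENNReal.ofReal ((b - c)^2) := by
  refine (ENNReal.ofReal_le_ofReal (show (a-b)^2 ≤ 2 * (a-c)^2 + 2 * (b-c)^2 by nlinarith [sq_nonneg ((a - c) + (b - c))])).trans (le_of_eq ?_)
  rw [ENNReal.ofReal_add (by positivity) (by positivity), ENNReal.ofReal_mul (by norm_num), ENNReal.ofReal_mul (by norm_num)]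
  simp

lemma KC.whit {Ω w m C0 k} (h : KC Ω w m C0 k) {L R : Set E2} (hL : MeasurableSet L) (hR : MeasurableSet R) {ρ : ℝ} (hρ : 0 < ρ)
    (hsub : ∀ x ∈ L, ball x (5*ρ) ⊆ Ω ∧ ball x (5*ρ) ⊆ R) :
    ∫⁻ x in L, ENNReal.ofReal ((w x - k x ρ)^2) ≤ ENNReal.ofReal (2754 * C0) * m R := by
  have hm := h.meas
  have hC := h.pos
  have h1 : ∀ a, ∫⁻ x in L ∩ ball (gridPt ρ a) ρ, ENNReal.ofReal ((w x - k x ρ)^2) ≤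
      ENNReal.ofReal (34 * C0) * m (ball (gridPt ρ a) (4*ρ) ∩ R) := by
    intro a
    by_cases hne : (L ∩ ball (gridPt ρ a) ρ).Nonempty
    swap
    · rw [not_nonempty_iff_eq_empty.1 hne]; simp
    obtain ⟨z, hz⟩ : ∃ z, z = gridPt ρ a := ⟨_, rfl⟩
    rw [← hz] at hne ⊢
    obtain ⟨x0, hx0, hx0z⟩ := hne
    have hz4 : ball z (4*ρ) ⊆ ball x0 (5*ρ) := ball_subset_ball' (by rw [dist_comm]; rw [mem_ball] at hx0z; linarith)
    have hzΩ : ball z (2*(2*ρ)) ⊆ Ω := by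
      rw [← mul_assoc]; norm_num; exact hz4.trans (hsub x0 hx0).1
    have hzR : ball z (4*ρ) ∩ R = ball z (4*ρ) := inter_eq_left.2 (hz4.trans (hsub x0 hx0).2)
    rw [hzR]
    have hk : ∀ x ∈ L ∩ ball z ρ, ENNReal.ofReal ((k x ρ - k z (2*ρ))^2) ≤ ENNReal.ofReal (4 * C0 / ρ^2) * m (ball z (4*ρ)) := by
      rintro x ⟨hx, hxz⟩
      rw [mem_ball] at hxz
      have := h.cmp (y := x) (y' := z) (q := x) hρ (by positivity : 0 < 2*ρ) hρ
        ((ball_subset_ball (by linarith)).trans (hsub x hx).1) hzΩ subset_rfl (ball_subset_ball' (by linarith))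
      refine this.trans ?_
      rw [show 2 * (2*ρ) = 4*ρ by ring]
      calc _ ≤ ENNReal.ofReal (2 * C0 / ρ^2) * (m (ball z (4*ρ)) + m (ball z (4*ρ))) := by
            gcongr
            exact ball_subset_ball' (by linarith)
        _ = _ := by
            rw [← two_mul, ← mul_assoc]
            congr 1
            rw [show (2:ℝ≥0∞) = ENNReal.ofReal 2 by simp, ← ENNReal.ofReal_mul (by positivity)]
            congr 1; ring
    have hloc := h.loc z (2*ρ) (by positivity) hzΩ
    rw [show 2 * (2*ρ) = 4*ρ by ring] at hloc
    obtain ⟨M, hM⟩ : ∃ M, M = m (ball z (4*ρ)) := ⟨_, rfl⟩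
    rw [← hM] at hloc hk ⊢
    calc _ ≤ ∫⁻ x in L ∩ ball z ρ, (2 * ENNReal.ofReal ((w x - k z (2*ρ))^2) + 2 * (ENNReal.ofReal (4 * C0 / ρ^2) * M)) := by
          refine setLIntegral_mono' (hL.inter measurableSet_ball) fun x hx => ?_
          refine (ofReal_sq_split _ _ (k z (2*ρ))).trans ?_
          gcongr
          exact hk x hx
      _ ≤ ∫⁻ x in ball z ρ, (2 * ENNReal.ofReal ((w x - k z (2*ρ))^2) + 2 * (ENNReal.ofReal (4 * C0 / ρ^2) * M)) :=
          lintegral_mono_set inter_subset_right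
      _ = 2 * (∫⁻ x in ball z ρ, ENNReal.ofReal ((w x - k z (2*ρ))^2)) + 2 * (ENNReal.ofReal (4 * C0 / ρ^2) * M) * volume (ball z ρ) := by
          rw [lintegral_add_right _ measurable_const, setLIntegral_const, lintegral_const_mul' _ _ (by norm_num)]
      _ ≤ 2 * (ENNReal.ofReal C0 * M) + 2 * (ENNReal.ofReal (4 * C0 / ρ^2) * M) * ENNReal.ofReal (4 * ρ^2) := by
          gcongr
          · exact (lintegral_mono_set (ball_subset_ball (by linarith))).trans hloc
          · exact vol_ball_le z hρ.le
      _ = (2 * ENNReal.ofReal C0 + 2 * (ENNReal.ofReal (4 * C0 / ρ^2) * ENNReal.ofReal (4 * ρ^2))) * M := by ring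
      _ = _ := by
          congr 1
          rw [show (2:ℝ≥0∞) = ENNReal.ofReal 2 by simp, ← ENNReal.ofReal_mul (by positivity), ← ENNReal.ofReal_mul (by positivity),
            ← ENNReal.ofReal_mul (by positivity), ← ENNReal.ofReal_add (by positivity) (by positivity)]
          congr 1
          field_simp; norm_num
  have hcov : L ⊆ ⋃ a, L ∩ ball (gridPt ρ a) ρ := by
    intro x hx
    obtain ⟨a, ha⟩ := grid_cover hρ x
    exact mem_iUnion.2 ⟨a, hx, ha⟩
  calc _ ≤ ∫⁻ x in ⋃ a, L ∩ ball (gridPt ρ a) ρ, ENNReal.ofReal ((w x - k x ρ)^2) := lintegral_mono_set hcov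
    _ ≤ ∑' a, ∫⁻ x in L ∩ ball (gridPt ρ a) ρ, ENNReal.ofReal ((w x - k x ρ)^2) := lintegral_iUnion_le _ _
    _ ≤ ∑' a, ENNReal.ofReal (34 * C0) * m (ball (gridPt ρ a) (4*ρ) ∩ R) := ENNReal.tsum_le_tsum h1
    _ = ENNReal.ofReal (34 * C0) * ∑' a, m (ball (gridPt ρ a) (4*ρ) ∩ R) := ENNReal.tsum_mul_left
    _ ≤ ENNReal.ofReal (34 * C0) * (81 * m R) := by gcongr; exact grid_overlap hρ m R hR
    _ = _ := by
      rw [← mul_assoc, show (81:ℝ≥0∞) = ENNReal.ofReal 81 by simp, ← ENNReal.ofReal_mul (by positivity)]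
      congr 2; ring

lemma le_of_sq_le_sq' {a b : ℝ} (h : a^2 ≤ b^2) (hb : 0 ≤ b) : a ≤ b := by
  by_contra hc
  push Not at hc
  nlinarith

lemma meet_frontier {Ω S : Set E2} (hΩ : IsOpen Ω) (hS : IsPreconnected S) {p q : E2} (hp : p ∈ S) (hpΩ : p ∈ Ω)
    (hq : q ∈ S) (hqΩ : q ∉ Ω) : ∃ z ∈ S, z ∈ frontier Ω := by
  by_contra hcon
  push Not at hcon
  apply hqΩ
  refine hS.subset_left_of_subset_union hΩ (isClosed_closure (s := Ω)).isOpen_compl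
    (disjoint_compl_right.mono_left subset_closure |>.mono_right le_rfl) ?_ ⟨p, hp, hpΩ⟩ hq
  intro x hx
  by_cases h : x ∈ Ω
  · exact Or.inl h
  · refine Or.inr fun hc => hcon x hx ?_
    rw [frontier, hΩ.interior_eq]; exact ⟨hc, h⟩

/-- Normal field package. -/
structure NF (Ω : Set E2) (r : ℝ) (ν : E2 → E2) : Prop where
  op : IsOpen Ω
  conn : IsConnected Ω
  bdd : Bornology.IsBounded Ω
  rpos : 0 < r
  unit : ∀ z ∈ frontier Ω, ‖ν z‖ = 1
  inn : ∀ z ∈ frontier Ω, ball (z - r • ν z) r ⊆ Ω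
  out : ∀ z ∈ frontier Ω, ball (z + r • ν z) r ⊆ Ωᶜ

lemma exists_NF {Ω : Set E2} {r : ℝ} (h1 : IsOpen Ω) (h2 : IsConnected Ω) (h3 : Bornology.IsBounded Ω)
    (h : IsUBCWith Ω r) : ∃ ν, NF Ω r ν := by
  obtain ⟨hr, h⟩ := h
  have : ∀ z, ∃ n : E2, z ∈ frontier Ω → ‖n‖ = 1 ∧ ball (z - r • n) r ⊆ Ω ∧ ball (z + r • n) r ⊆ Ωᶜ := by
    intro z
    by_cases hz : z ∈ frontier Ω
    swap
    · exact ⟨0, fun h => absurd h hz⟩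
    obtain ⟨a, b, ha, hb, hab⟩ := h z hz
    have hzz : z ∈ sphere a r ∩ sphere b r := by rw [hab]; rfl
    have h1 : ‖z - a‖ = r := by simpa [dist_eq_norm] using hzz.1
    have h2 : ‖z - b‖ = r := by simpa [dist_eq_norm] using hzz.2
    have hd : Disjoint (ball a r) (ball b r) := disjoint_of_subset ha hb disjoint_compl_right
    rw [disjoint_ball_ball_iff hr hr, dist_eq_norm] at hd
    have h3 : ‖(z - a) + (z - b)‖^2 ≤ 0 := by
      have e1 : ‖(z - a) - (z - b)‖^2 = ‖a - b‖^2 := by rw [← norm_neg]; congr 2; abel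
      have p := parallelogram_law_with_norm ℝ (z - a) (z - b)
      have : (2*r)^2 ≤ ‖a-b‖^2 := pow_le_pow_left₀ (by positivity) (by linarith) 2
      rw [h1, h2] at p
      nlinarith
    have h4 : (z - a) + (z - b) = 0 := by
      have : ‖(z - a) + (z - b)‖ = 0 := by nlinarith [norm_nonneg ((z - a) + (z - b))]
      exact norm_eq_zero.1 this
    refine ⟨r⁻¹ • (z - a), fun _ => ⟨?_, ?_, ?_⟩⟩
    · rw [norm_smul, h1, Real.norm_of_nonneg (by positivity)]; field_simp
    · rw [smul_smul, mul_inv_cancel₀ hr.ne', one_smul, sub_sub_cancel]; exact ha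
    · rw [smul_smul, mul_inv_cancel₀ hr.ne', one_smul]
      have : z + (z - a) = b := by
        rw [← sub_eq_zero, ← h4]; abel
      rw [this]; exact hb
  choose ν hν using this
  exact ⟨ν, h1, h2, h3, hr, fun z hz => (hν z hz).1, fun z hz => (hν z hz).2.1, fun z hz => (hν z hz).2.2⟩

section
variable {Ω : Set E2} {r : ℝ} {ν : E2 → E2}

lemma NF.not_mem (h : NF Ω r ν) {z : E2} (hz : z ∈ frontier Ω) : z ∉ Ω := by
  rw [frontier, h.op.interior_eq] at hz; exact hz.2

lemma NF.n1 (h : NF Ω r ν) {z w : E2} (hz : z ∈ frontier Ω) (hw : w ∈ frontier Ω) :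
    r * ‖ν z - ν w‖ ≤ ‖z - w‖ := by
  have hr := h.rpos
  have key : ∀ z ∈ frontier Ω, ∀ w ∈ frontier Ω, 2 * r ≤ ‖(z - w) + r • (ν z + ν w)‖ := by
    intro z hz w hw
    have hd : Disjoint (ball (w - r • ν w) r) (ball (z + r • ν z) r) :=
      disjoint_of_subset (h.inn w hw) (h.out z hz) disjoint_compl_right
    rw [disjoint_ball_ball_iff hr hr, dist_comm, dist_eq_norm] at hd
    have : z + r • ν z - (w - r • ν w) = (z - w) + r • (ν z + ν w) := by rw [smul_add]; abel
    rw [this] at hd; linarith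
  have k1 := key z hz w hw
  have k2 := key w hw z hz
  rw [show w - z + r • (ν w + ν z) = - ((z - w) - r • (ν z + ν w)) by rw [add_comm (ν w)]; abel, norm_neg] at k2
  have p := parallelogram_law_with_norm ℝ (z - w) (r • (ν z + ν w))
  have p2 := parallelogram_law_with_norm ℝ (ν z) (ν w)
  rw [h.unit z hz, h.unit w hw] at p2
  rw [norm_smul, Real.norm_of_nonneg hr.le] at p
  have q1 := pow_le_pow_left₀ (by positivity) k1 2
  have q2 := pow_le_pow_left₀ (by positivity) k2 2
  refine le_of_sq_le_sq' ?_ (norm_nonneg _)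
  have : r^2 * (‖ν z + ν w‖^2 + ‖ν z - ν w‖^2) = r^2 * 4 := by rw [p2]; norm_num
  nlinarith

lemma NF.n1b (h : NF Ω r ν) {z w : E2} (hz : z ∈ frontier Ω) (hw : w ∈ frontier Ω) :
    2 * r * |⟪w - z, ν z⟫| ≤ ‖w - z‖^2 := by
  have hr := h.rpos
  have h1 : w ∉ ball (z - r • ν z) r := fun hh => h.not_mem hw (h.inn z hz hh)
  have h2 : w ∉ ball (z + r • ν z) r := by
    intro hh
    have : w ∈ closure Ω := frontier_subset_closure hw
    obtain ⟨p, hp, hpΩ⟩ := mem_closure_iff.1 this _ isOpen_ball hh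
    exact h.out z hz hp hpΩ
  rw [mem_ball_iff_norm, not_lt] at h1 h2
  rw [show w - (z - r • ν z) = (w - z) + r • ν z by abel] at h1
  rw [show w - (z + r • ν z) = (w - z) - r • ν z by abel] at h2
  have q1 := pow_le_pow_left₀ (by positivity) h1 2
  have q2 := pow_le_pow_left₀ (by positivity) h2 2
  rw [norm_add_sq_real, inner_smul_right, norm_smul, h.unit z hz, Real.norm_of_nonneg hr.le] at q1
  rw [norm_sub_sq_real, inner_smul_right, norm_smul, h.unit z hz, Real.norm_of_nonneg hr.le] at q2
  rcases abs_cases ⟪w - z, ν z⟫ with ⟨hh, _⟩ | ⟨hh, _⟩ <;> rw [hh] <;> nlinarith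

lemma NF.n2 (h : NF Ω r ν) {x z : E2} {d : ℝ} (hz : z ∈ frontier Ω) (hd : 0 < d) (hx : ball x d ⊆ Ω) (hxz : dist x z = d) :
    x = z - d • ν z := by
  have hr := h.rpos
  have hdj : Disjoint (ball x d) (ball (z + r • ν z) r) :=
      disjoint_of_subset hx (h.out z hz) disjoint_compl_right
  rw [disjoint_ball_ball_iff hd hr, dist_eq_norm] at hdj
  rw [show x - (z + r • ν z) = (x - z) - r • ν z by abel] at hdj
  rw [dist_eq_norm] at hxz
  have q1 := pow_le_pow_left₀ (by positivity) hdj 2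
  rw [norm_sub_sq_real, inner_smul_right, norm_smul, h.unit z hz, Real.norm_of_nonneg hr.le, hxz] at q1
  have h1 : ⟪x - z, ν z⟫ ≤ - d := by nlinarith
  have h2 : ‖(x - z) + d • ν z‖^2 ≤ 0 := by
    rw [norm_add_sq_real, inner_smul_right, norm_smul, h.unit z hz, Real.norm_of_nonneg hd.le, hxz]; nlinarith
  have h3 : ‖(x - z) + d • ν z‖ = 0 := by nlinarith [norm_nonneg ((x - z) + d • ν z)]
  have h4 := norm_eq_zero.1 h3
  rw [← sub_eq_zero, ← h4]; abel

/-- distance to the complement -/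
def D (Ω : Set E2) (x : E2) : ℝ := infDist x Ωᶜ

lemma D_nonneg (x : E2) : 0 ≤ D Ω x := infDist_nonneg
lemma D_lip (x y : E2) : D Ω x ≤ D Ω y + dist x y := infDist_le_infDist_add_dist
lemma D_cont : Continuous (D Ω) := continuous_infDist_pt _
lemma D_ball (x : E2) : ball x (D Ω x) ⊆ Ω := fun y hy => by
  by_contra hc
  rw [mem_ball, dist_comm] at hy
  exact absurd (infDist_le_dist_of_mem (x := x) (s := Ωᶜ) hc) (not_le.2 hy)

lemma D_ball_le {x : E2} {s : ℝ} (hs : s ≤ D Ω x) : ball x s ⊆ Ω := (ball_subset_ball hs).trans (D_ball x)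

lemma NF.compl_ne (h : NF Ω r ν) : (Ωᶜ).Nonempty := by
  rw [nonempty_compl]; rintro rfl
  exact NormedSpace.unbounded_univ ℝ E2 h.bdd

lemma NF.le_D (h : NF Ω r ν) {x : E2} {s : ℝ} (hs : ball x s ⊆ Ω) : s ≤ D Ω x := by
  refine (le_infDist h.compl_ne).2 fun y hy => ?_
  by_contra hc
  rw [not_le, dist_comm] at hc
  exact hy (hs hc)

lemma NF.D_pos (h : NF Ω r ν) {x : E2} (hx : x ∈ Ω) : 0 < D Ω x :=
  (h.op.isClosed_compl.notMem_iff_infDist_pos h.compl_ne).1 (by simpa using hx)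

lemma mem_of_D_pos {x : E2} (hx : 0 < D Ω x) : x ∈ Ω := by
  by_contra hc
  have : D Ω x = 0 := infDist_zero_of_mem hc
  linarith

lemma NF.near (h : NF Ω r ν) {x : E2} (hx : x ∈ Ω) : ∃ z ∈ frontier Ω, x = z - D Ω x • ν z ∧ dist x z = D Ω x := by
  obtain ⟨z, hz, hd⟩ := h.op.isClosed_compl.exists_infDist_eq_dist h.compl_ne x
  have hd' : dist x z = D Ω x := hd.symm
  have hp := h.D_pos hx
  have hzf : z ∈ frontier Ω := by
    rw [frontier, h.op.interior_eq]
    refine ⟨?_, hz⟩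
    apply closure_mono (D_ball (Ω := Ω) x)
    rw [closure_ball _ hp.ne', mem_closedBall, dist_comm, hd']
  exact ⟨z, hzf, h.n2 hzf hp (D_ball x) hd', hd'⟩

lemma NF.frontier_ne (h : NF Ω r ν) : (frontier Ω).Nonempty := by
  obtain ⟨x, hx⟩ := h.conn.1
  obtain ⟨z, hz, _⟩ := h.near hx
  exact ⟨z, hz⟩

lemma NF.inball (h : NF Ω r ν) {z : E2} (hz : z ∈ frontier Ω) {t : ℝ} (h0 : 0 ≤ t) (h1 : t ≤ r) :
    ball (z - t • ν z) t ⊆ Ω := by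
  refine (ball_subset_ball' ?_).trans (h.inn z hz)
  rw [dist_eq_norm, show z - t • ν z - (z - r • ν z) = (r - t) • ν z by rw [sub_smul]; abel, norm_smul, h.unit z hz,
    Real.norm_of_nonneg (by linarith)]
  linarith

/-- Deep centers. -/
lemma NF.centers (h : NF Ω r ν) : ∃ c : E2 → E2, ∀ x ∈ Ω, ball (c x) (r/2) ⊆ Ω ∧ dist x (c x) ≤ r / 2 ∧
    (∀ s ∈ Icc (0:ℝ) 1, D Ω x ≤ D Ω (x + s • (c x - x))) ∧ ∀ y ∈ Ω, dist (c x) (c y) ≤ 4 * dist x y := by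
  have hr := h.rpos
  have : ∀ x, ∃ z, x ∈ Ω → z ∈ frontier Ω ∧ x = z - D Ω x • ν z ∧ dist x z = D Ω x := by
    intro x
    by_cases hx : x ∈ Ω
    · obtain ⟨z, hz⟩ := h.near hx
      exact ⟨z, fun _ => hz⟩
    · exact ⟨x, fun hh => absurd hh hx⟩
  choose π hπ using this
  have hsm : ∀ x, 0 ≤ max 0 (r/2 - D Ω x) ∧ max 0 (r/2 - D Ω x) ≤ r/2 := fun x => 
    ⟨le_max_left _ _, max_le (by positivity) (by linarith [D_nonneg (Ω := Ω) x])⟩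
  refine ⟨fun x => x - max 0 (r/2 - D Ω x) • ν (π x), fun x hx => ⟨?_, ?_, ?_, ?_⟩⟩
  · obtain ⟨hz, hxz, _⟩ := hπ x hx
    by_cases hd : r/2 ≤ D Ω x
    · simp only [max_eq_left (by linarith : r/2 - D Ω x ≤ 0), zero_smul, sub_zero]
      exact D_ball_le hd
    · simp only [max_eq_right (by linarith : 0 ≤ r/2 - D Ω x)]
      have : x - (r/2 - D Ω x) • ν (π x) = π x - (r/2) • ν (π x) := by
        conv_lhs => enter [1]; rw [hxz]
        rw [sub_smul]; abel
      rw [this]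
      exact h.inball hz (by positivity) (by linarith)
  · obtain ⟨hz, hxz, _⟩ := hπ x hx
    rw [dist_eq_norm, sub_sub_cancel, norm_smul, h.unit _ hz, mul_one, Real.norm_of_nonneg (hsm x).1]
    exact (hsm x).2
  · obtain ⟨hz, hxz, _⟩ := hπ x hx
    rintro s ⟨hs0, hs1⟩
    by_cases hd : r/2 ≤ D Ω x
    · simp [max_eq_left (by linarith : r/2 - D Ω x ≤ 0)]
    · simp only [max_eq_right (by linarith : 0 ≤ r/2 - D Ω x)]
      have e1 : x + s • (x - (r/2 - D Ω x) • ν (π x) - x) = π x - (D Ω x + s * (r/2 - D Ω x)) • ν (π x) := by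
        conv_lhs => enter [1]; rw [hxz]
        rw [sub_sub_cancel_left, smul_neg, smul_smul, add_smul]; abel
      rw [e1]
      have h0 := D_nonneg (Ω := Ω) x
      have h1 : 0 ≤ s * (r/2 - D Ω x) := mul_nonneg hs0 (by linarith)
      have h2 : s * (r/2 - D Ω x) ≤ r/2 - D Ω x := mul_le_of_le_one_left (by linarith) hs1
      have := h.le_D (h.inball hz (t := D Ω x + s * (r/2 - D Ω x)) (by positivity) (by linarith))
      linarith
  · have main : ∀ x ∈ Ω, ∀ y ∈ Ω, D Ω x ≤ r/2 → dist (x - max 0 (r/2 - D Ω x) • ν (π x)) (y - max 0 (r/2 - D Ω y) • ν (π y)) ≤ 4 * dist x y := by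
      intro x hx y hy hd
      obtain ⟨hz, hxz, _⟩ := hπ x hx
      obtain ⟨hw, hyw, _⟩ := hπ y hy
      have hn := h.n1 hz hw
      obtain ⟨z, ez⟩ : ∃ z, z = π x := ⟨_, rfl⟩
      obtain ⟨w, ew⟩ : ∃ w, w = π y := ⟨_, rfl⟩
      rw [← ez] at hz hxz hn ⊢
      rw [← ew] at hw hyw hn ⊢
      have hl1 := D_lip (Ω := Ω) x y
      have hl2 := D_lip (Ω := Ω) y x
      rw [dist_comm y x] at hl2
      have hD : |D Ω x - D Ω y| ≤ dist x y := abs_le.2 ⟨by linarith, by linarith⟩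
      have hM : |max 0 (r/2 - D Ω x) - max 0 (r/2 - D Ω y)| ≤ dist x y := by
        rw [max_comm 0, max_comm 0]
        refine ((abs_max_sub_max_le_abs _ _ _).trans ?_).trans hD
        rw [abs_sub_comm]; apply le_of_eq; congr 1; ring
      obtain ⟨sx, hsx⟩ : ∃ s, s = max 0 (r/2 - D Ω x) := ⟨_, rfl⟩
      obtain ⟨sy, hsy⟩ : ∃ s, s = max 0 (r/2 - D Ω y) := ⟨_, rfl⟩
      have b1 := hsm x
      rw [← hsx] at b1 hM ⊢
      rw [← hsy] at hM ⊢
      have e1 : z - w = (x - y) + (D Ω x - D Ω y) • ν w + D Ω x • (ν z - ν w) := by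
        have : z = x + D Ω x • ν z := eq_add_of_sub_eq hxz.symm
        nth_rw 1 [this]
        have : w = y + D Ω y • ν w := eq_add_of_sub_eq hyw.symm
        nth_rw 1 [this]
        rw [sub_smul, smul_sub]; abel
      have e2 : (x - sx • ν z) - (y - sy • ν w) = (x - y) - (sx - sy) • ν w - sx • (ν z - ν w) := by
        rw [sub_smul, smul_sub]; abel
      rw [dist_eq_norm] at hD hM
      rw [dist_eq_norm, dist_eq_norm, e2]
      have n1 : ‖z - w‖ ≤ ‖x - y‖ + ‖x - y‖ + D Ω x * ‖ν z - ν w‖ := by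
        rw [e1]
        refine (norm_add_le _ _).trans ?_
        refine add_le_add ((norm_add_le _ _).trans ?_) ?_
        · rw [norm_smul, h.unit w hw, mul_one, Real.norm_eq_abs]; linarith
        · rw [norm_smul, Real.norm_of_nonneg (D_nonneg x)]
      have n2 : ‖(x - y) - (sx - sy) • ν w - sx • (ν z - ν w)‖ ≤ ‖x - y‖ + ‖x - y‖ + sx * ‖ν z - ν w‖ := by
        refine (norm_sub_le _ _).trans ?_
        refine add_le_add ((norm_sub_le _ _).trans ?_) ?_
        · rw [norm_smul, h.unit w hw, mul_one, Real.norm_eq_abs]; linarith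
        · rw [norm_smul, Real.norm_of_nonneg b1.1]
      have hpos := norm_nonneg (ν z - ν w)
      have : D Ω x * ‖ν z - ν w‖ ≤ r/2 * ‖ν z - ν w‖ := by gcongr
      have : sx * ‖ν z - ν w‖ ≤ r/2 * ‖ν z - ν w‖ := by gcongr; exact b1.2
      linarith
    intro y hy
    by_cases hdx : D Ω x ≤ r/2
    · exact main x hx y hy hdx
    by_cases hdy : D Ω y ≤ r/2
    · rw [dist_comm, dist_comm x]; exact main y hy x hx hdy
    simp only [max_eq_left (by linarith : r/2 - D Ω x ≤ 0), max_eq_left (by linarith : r/2 - D Ω y ≤ 0), zero_smul, sub_zero]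
    linarith [dist_nonneg (x := x) (y := y)]

end

section
variable {Ω : Set E2} {r : ℝ} {ν : E2 → E2}

lemma NF.cone (h : NF Ω r ν) {x : E2} (hx : x ∈ Ω) (hd : D Ω x ≤ r/10) :
    ∃ u ∈ ({e 0, - e 0, e 1, - e 1} : Set E2), ∀ t ∈ Icc (0:ℝ) (r/10), D Ω x + t/4 ≤ D Ω (x - t • u) := by
  have hr := h.rpos
  obtain ⟨z, hz, hxz, -⟩ := h.near hx
  have hu : ∃ u ∈ ({e 0, - e 0, e 1, - e 1} : Set E2), ‖u‖ = 1 ∧ 7/10 ≤ ⟪ν z, u⟫ := by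
    have h1 := h.unit z hz
    have h2 := normsq2 (ν z)
    rw [h1] at h2
    by_cases c0 : 7/10 ≤ ν z 0
    · exact ⟨e 0, by simp, by simp, by rw [inner_e]; exact c0⟩
    by_cases c1 : 7/10 ≤ - ν z 0
    · exact ⟨- e 0, by simp, by simp, by rw [inner_neg_right, inner_e]; exact c1⟩
    by_cases c2 : 7/10 ≤ ν z 1
    · exact ⟨e 1, by simp, by simp, by rw [inner_e]; exact c2⟩
    by_cases c3 : 7/10 ≤ - ν z 1
    · exact ⟨- e 1, by simp, by simp, by rw [inner_neg_right, inner_e]; exact c3⟩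
    exfalso; push Not at c0 c1 c2 c3
    nlinarith
  obtain ⟨u, hu, hu1, hu2⟩ := hu
  refine ⟨u, hu, ?_⟩
  rintro t ⟨ht0, ht1⟩
  have hd0 := D_nonneg (Ω := Ω) x
  refine h.le_D ((ball_subset_ball' ?_).trans (h.inn z hz))
  rw [dist_eq_norm]
  obtain ⟨d, hdd⟩ : ∃ d, d = D Ω x := ⟨_, rfl⟩
  rw [← hdd] at hxz hd hd0 ⊢
  have e1 : x - t • u - (z - r • ν z) = (r - d) • ν z - t • u := by
    rw [hxz, sub_smul]; abel
  rw [e1]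
  have : ‖(r - d) • ν z - t • u‖ ≤ r - d - t/4 := by
    refine le_of_sq_le_sq' ?_ (by linarith)
    rw [norm_sub_sq_real, inner_smul_left, inner_smul_right, norm_smul, norm_smul, h.unit z hz, hu1,
      Real.norm_of_nonneg (by linarith), Real.norm_of_nonneg ht0]
    simp only [conj_trivial]
    have : (r - d) * (t * (7/10)) ≤ (r - d) * (t * ⟪ν z, u⟫) := by
      apply mul_le_mul_of_nonneg_left _ (by linarith)
      exact mul_le_mul_of_nonneg_left hu2 ht0
    nlinarith [mul_nonneg ht0 (by linarith : 0 ≤ r/10 - t), mul_nonneg ht0 (by linarith : 0 ≤ r/10 - d), mul_nonneg ht0 hr.le]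
  linarith

lemma haus_proj {S : Set E2} {f : E2 → ℝ} (hf : LipschitzWith 1 f) {a b : ℝ} (hS : Icc a b ⊆ f '' S) :
    ENNReal.ofReal (b - a) ≤ μH[1] S := by
  calc ENNReal.ofReal (b - a) = volume (Icc a b) := by rw [Real.volume_Icc]
    _ ≤ volume (f '' S) := measure_mono hS
    _ = μH[1] (f '' S) := by rw [hausdorffMeasure_real]
    _ ≤ _ := by
      have := hf.hausdorffMeasure_image_le (d := 1) (by norm_num) S
      simpa using this

lemma lip_inner {τ : E2} (hτ : ‖τ‖ = 1) (z : E2) : LipschitzWith 1 fun x : E2 => ⟪x - z, τ⟫ := by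
  refine LipschitzWith.of_dist_le_mul fun x y => ?_
  rw [Real.dist_eq, ← inner_sub_left, sub_sub_sub_cancel_right, dist_eq_norm]
  have := abs_real_inner_le_norm (x - y) τ
  rw [hτ] at this; simpa using this

lemma norm_rot (v : E2) : ‖rot v‖ = ‖v‖ := by
  have h1 := normsq2 (rot v)
  have h2 := normsq2 v
  simp at h1
  have : ‖rot v‖^2 = ‖v‖^2 := by rw [h1, h2]; ring
  exact (pow_left_inj₀ (norm_nonneg _) (norm_nonneg _) (by norm_num)).1 this

lemma inner_rot_self (v : E2) : ⟪v, rot v⟫ = 0 := by rw [inner2]; simp; ring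

lemma NF.patch (h : NF Ω r ν) {z : E2} (hz : z ∈ frontier Ω) {ρ : ℝ} (hρ : 0 < ρ) (hρr : ρ ≤ r) :
    ENNReal.ofReal ρ ≤ μH[1] (frontier Ω ∩ ball z ρ) := by
  have hr := h.rpos
  have hn := h.unit z hz
  have hτ : ‖rot (ν z)‖ = 1 := by rw [norm_rot, hn]
  have horth := inner_rot_self (ν z)
  have key : Icc (-(ρ/2)) (ρ/2) ⊆ (fun x : E2 => ⟪x - z, rot (ν z)⟫) '' (frontier Ω ∩ ball z ρ) := by
    rintro s ⟨hs1, hs2⟩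
    have hsq : ∀ t : ℝ, ‖s • rot (ν z) + t • ν z‖^2 = s^2 + t^2 := by
      intro t
      rw [norm_add_sq_real, inner_smul_left, inner_smul_right, real_inner_comm, horth, norm_smul, norm_smul, hτ, hn]
      simp
    let γ : ℝ → E2 := fun t => z + (s • rot (ν z) + t • ν z)
    have hγ : Continuous γ := by fun_prop
    have hs4 : s^2 ≤ ρ^2/4 := by nlinarith
    have hp : γ (-(ρ/2)) ∈ Ω := by
      apply h.inn z hz
      rw [mem_ball_iff_norm, show γ (-(ρ/2)) - (z - r • ν z) = s • rot (ν z) + (r - ρ/2) • ν z by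
        simp only [γ]; rw [sub_smul, neg_smul]; abel]
      refine lt_of_pow_lt_pow_left₀ 2 hr.le ?_
      rw [hsq]; nlinarith
    have hq : γ (ρ/2) ∉ Ω := by
      apply h.out z hz
      rw [mem_ball_iff_norm, show γ (ρ/2) - (z + r • ν z) = s • rot (ν z) + (ρ/2 - r) • ν z by
        simp only [γ]; rw [sub_smul]; abel]
      refine lt_of_pow_lt_pow_left₀ 2 hr.le ?_
      rw [hsq]; nlinarith
    obtain ⟨p, ⟨t, ⟨ht1, ht2⟩, rfl⟩, hpf⟩ := meet_frontier h.op
      ((isPreconnected_Icc (a := -(ρ/2)) (b := ρ/2)).image γ hγ.continuousOn)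
      ⟨_, ⟨le_rfl, by linarith⟩, rfl⟩ hp ⟨_, ⟨by linarith, le_rfl⟩, rfl⟩ hq
    refine ⟨γ t, ⟨hpf, ?_⟩, ?_⟩
    · rw [mem_ball_iff_norm, show γ t - z = s • rot (ν z) + t • ν z by simp only [γ]; abel]
      refine lt_of_pow_lt_pow_left₀ 2 hρ.le ?_
      rw [hsq]; nlinarith
    · show ⟪γ t - z, rot (ν z)⟫ = s
      rw [show γ t - z = s • rot (ν z) + t • ν z by simp only [γ]; abel, inner_add_left, inner_smul_left, inner_smul_left,
        horth, real_inner_self_eq_norm_sq, hτ]; simp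
  have := haus_proj (lip_inner hτ z) key
  rwa [show ρ/2 - -(ρ/2) = ρ by ring] at this

lemma NF.haus_fin (h : NF Ω r ν) : μH[1] (frontier Ω) < ⊤ := by
  have hr := h.rpos
  have hc : IsCompact (frontier Ω) := isCompact_of_isClosed_isBounded isClosed_frontier (h.bdd.closure.subset frontier_subset_closure)
  refine hc.measure_lt_top_of_nhdsWithin fun z hz => ?_
  refine ⟨frontier Ω ∩ ball z (r/4), inter_mem_nhdsWithin _ (ball_mem_nhds z (by positivity)), ?_⟩
  have hn := h.unit z hz
  have hτ : ‖rot (ν z)‖ = 1 := by rw [norm_rot, hn]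
  obtain ⟨S, hS⟩ : ∃ S, S = frontier Ω ∩ ball z (r/4) := ⟨_, rfl⟩
  rw [← hS]
  let f : E2 → ℝ := fun x => ⟪x - z, rot (ν z)⟫
  have anti : ∀ p ∈ S, ∀ q ∈ S, dist p q ≤ 2 * dist (f p) (f q) := by
    intro p hp q hq
    rw [hS] at hp hq
    have hpq : ‖q - p‖ ≤ r/2 := by
      have h1 := hp.2; have h2 := hq.2
      rw [mem_ball] at h1 h2
      rw [← dist_eq_norm]
      have := dist_triangle_right q p z
      linarith
    have h1 := h.n1b hp.1 hq.1
    have h2 := h.n1 hz hp.1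
    have h3 : ‖z - p‖ ≤ r/4 := by
      have := hp.2; rw [mem_ball, dist_comm, dist_eq_norm] at this; linarith
    have h4 : ‖ν z - ν p‖ ≤ 1/4 := by nlinarith
    have h5 : |⟪q - p, ν z - ν p⟫| ≤ ‖q - p‖ * (1/4) := (abs_real_inner_le_norm _ _).trans (by gcongr)
    have h6 : |⟪q - p, ν p⟫| ≤ ‖q - p‖ * (1/4) := by
      have : ‖q-p‖^2 ≤ ‖q-p‖ * (r/2) := by nlinarith [norm_nonneg (q-p)]
      have : r * |⟪q - p, ν p⟫| ≤ r * (‖q - p‖ * (1/4)) := by nlinarith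
      exact le_of_mul_le_mul_left this hr
    have h7 : |⟪q - p, ν z⟫| ≤ ‖q - p‖ * (1/2) := by
      have : ⟪q - p, ν z⟫ = ⟪q - p, ν z - ν p⟫ + ⟪q - p, ν p⟫ := by rw [inner_sub_right]; ring
      rw [this]
      refine (abs_add_le _ _).trans (by linarith)
    have h8 : ‖q - p‖^2 = ⟪q - p, ν z⟫^2 + ⟪q - p, rot (ν z)⟫^2 := by
      have hh := normsq2 (ν z)
      rw [hn] at hh
      rw [inner2, inner2, normsq2, rot0, rot1]
      have : ∀ a b c d : ℝ, 1^2 = c^2 + d^2 → a^2+b^2 = (a*c+b*d)^2 + (a * -d + b * c)^2 := by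
        intro a b c d hcd
        have : (a*c+b*d)^2 + (a * -d + b * c)^2 = (a^2+b^2) * (c^2+d^2) := by ring
        rw [this, ← hcd]; ring
      exact this _ _ _ _ hh
    have h9 : dist (f p) (f q) = |⟪q - p, rot (ν z)⟫| := by
      rw [Real.dist_eq, abs_sub_comm, ← inner_sub_left, sub_sub_sub_cancel_right]
    rw [h9, dist_comm, dist_eq_norm]
    refine le_of_sq_le_sq' ?_ (by positivity)
    rw [mul_pow, sq_abs]
    have := pow_le_pow_left₀ (abs_nonneg _) h7 2
    rw [sq_abs] at this
    nlinarith
  have hinj : InjOn f S := by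
    intro p hp q hq hpq
    have := anti p hp q hq
    rw [hpq, dist_self, mul_zero] at this
    exact dist_le_zero.1 this
  have hlip : LipschitzOnWith 2 (Function.invFunOn f S) (f '' S) := by
    refine LipschitzOnWith.of_dist_le_mul ?_
    rintro _ ⟨p, hp, rfl⟩ _ ⟨q, hq, rfl⟩
    rw [hinj.leftInvOn_invFunOn hp, hinj.leftInvOn_invFunOn hq]
    simpa using anti p hp q hq
  have h1 := hlip.hausdorffMeasure_image_le (d := 1) (by norm_num)
  rw [hinj.leftInvOn_invFunOn.image_image] at h1
  refine h1.trans_lt ?_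
  rw [hausdorffMeasure_real]
  refine ENNReal.mul_lt_top (by simp) ?_
  have : f '' S ⊆ ball 0 (r/4) := by
    rintro _ ⟨p, hp, rfl⟩
    rw [hS] at hp
    have := hp.2
    rw [mem_ball_iff_norm] at this
    rw [mem_ball_zero_iff]
    have h2 := abs_real_inner_le_norm (p - z) (rot (ν z))
    rw [hτ, mul_one] at h2
    exact h2.trans_lt this
  exact (measure_mono this).trans_lt measure_ball_lt_top

lemma NF.perim_eq (h : NF Ω r ν) : μH[1] (frontier Ω) = ENNReal.ofReal (perim Ω) := by
  rw [perim, ENNReal.ofReal_toReal h.haus_fin.ne]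

lemma NF.r_le_perim (h : NF Ω r ν) : r ≤ perim Ω := by
  obtain ⟨z, hz⟩ := h.frontier_ne
  have h1 := (h.patch hz h.rpos le_rfl).trans (measure_mono inter_subset_left)
  rw [h.perim_eq] at h1
  exact (ENNReal.ofReal_le_ofReal_iff ENNReal.toReal_nonneg).1 h1

lemma NF.vol_fin (h : NF Ω r ν) : volume Ω ≠ ⊤ := h.bdd.measure_lt_top.ne

lemma NF.r_sq_le_area (h : NF Ω r ν) : r^2 ≤ area Ω := by
  obtain ⟨z, hz⟩ := h.frontier_ne
  have h1 := (vol_ball_ge _ h.rpos.le).trans (measure_mono (h.inn z hz))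
  rw [area, ← ENNReal.ofReal_le_iff_le_toReal h.vol_fin]
  exact h1

/-- Separated boundary points. -/
lemma NF.sep (h : NF Ω r ν) {s : ℝ} (hs : 0 < s) (hsr : s ≤ r) {ι : Type*} (A : Finset ι) (f : ι → E2)
    (hf : ∀ i ∈ A, f i ∈ frontier Ω) (hsep : ∀ i ∈ A, ∀ j ∈ A, i ≠ j → 2 * s ≤ dist (f i) (f j)) :
    (A.card : ℝ) * s ≤ perim Ω := by
  have h1 : ∑ i ∈ A, μH[1] (frontier Ω ∩ ball (f i) s) ≤ μH[1] (frontier Ω) := by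
    rw [← measure_biUnion_finset]
    · exact measure_mono (iUnion₂_subset fun i _ => inter_subset_left)
    · intro i hi j hj hij
      refine (ball_disjoint_ball ?_).mono inter_subset_right inter_subset_right
      linarith [hsep i hi j hj hij]
    · exact fun i _ => isClosed_frontier.measurableSet.inter measurableSet_ball
  have h2 : (A.card : ℝ≥0∞) * ENNReal.ofReal s ≤ ∑ i ∈ A, μH[1] (frontier Ω ∩ ball (f i) s) := by
    rw [← nsmul_eq_mul, ← Finset.sum_const]
    exact Finset.sum_le_sum fun i hi => h.patch (hf i hi) hs hsr
  have h3 := h2.trans h1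
  rw [h.perim_eq, ← ENNReal.ofReal_natCast, ← ENNReal.ofReal_mul (by positivity)] at h3
  exact (ENNReal.ofReal_le_ofReal_iff ENNReal.toReal_nonneg).1 h3

lemma NF.dist_le_perim (h : NF Ω r ν) {x y : E2} (hx : x ∈ Ω) (hy : y ∈ Ω) : dist x y ≤ perim Ω := by
  by_cases hxy : x = y
  · rw [hxy, dist_self]; exact ENNReal.toReal_nonneg
  have hne : ‖y - x‖ ≠ 0 := by rw [norm_ne_zero_iff, sub_ne_zero]; exact fun h => hxy h.symm
  obtain ⟨u, hu⟩ : ∃ u, u = ‖y - x‖⁻¹ • (y - x) := ⟨_, rfl⟩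
  have hu1 : ‖u‖ = 1 := by rw [hu, norm_smul, norm_inv, norm_norm, inv_mul_cancel₀ hne]
  have hτ : ‖rot u‖ = 1 := by rw [norm_rot, hu1]
  have horth := inner_rot_self u
  have hfy : ⟪y - x, u⟫ = ‖y - x‖ := by
    rw [hu, inner_smul_right, real_inner_self_eq_norm_sq]; field_simp
  have key : Icc 0 ‖y - x‖ ⊆ (fun p : E2 => ⟪p - x, u⟫) '' frontier Ω := by
    rintro s hs
    have hpre : IsPreconnected ((fun p : E2 => ⟪p - x, u⟫) '' Ω) := h.conn.isPreconnected.image _ (by fun_prop)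
    have hmem : s ∈ (fun p : E2 => ⟪p - x, u⟫) '' Ω :=
      hpre.Icc_subset ⟨x, hx, by simp⟩ ⟨y, hy, hfy⟩ hs
    obtain ⟨p, hp, hps⟩ := hmem
    let γ : ℝ → E2 := fun t => p + t • rot u
    have hγ : Continuous γ := by fun_prop
    obtain ⟨M, hM⟩ := h.bdd.subset_closedBall p
    have hq : γ (|M| + 1) ∉ Ω := by
      intro hc
      have := hM hc
      rw [mem_closedBall_iff_norm] at this
      simp only [γ, add_sub_cancel_left, norm_smul, hτ, mul_one] at this
      rw [Real.norm_of_nonneg (by positivity)] at this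
      linarith [le_abs_self M]
    have hp0 : γ 0 ∈ Ω := by simpa [γ] using hp
    obtain ⟨q, ⟨t, _, rfl⟩, hpf⟩ := meet_frontier h.op
      ((isPreconnected_univ (α := ℝ)).image γ hγ.continuousOn)
      ⟨0, trivial, rfl⟩ hp0 ⟨_, trivial, rfl⟩ hq
    refine ⟨γ t, hpf, ?_⟩
    show ⟪γ t - x, u⟫ = s
    rw [show γ t - x = (p - x) + t • rot u by simp only [γ]; abel, inner_add_left, inner_smul_left, real_inner_comm u (rot u), horth, ← hps]
    simp
  have h1 := haus_proj (lip_inner hu1 x) key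
  rw [h.perim_eq, sub_zero] at h1
  rw [dist_comm, dist_eq_norm]
  exact (ENNReal.ofReal_le_ofReal_iff ENNReal.toReal_nonneg).1 h1

/-- choice of a good radius -/
lemma exists_good_radius (h : IsUBCDomain Ω) : ∃ r ν, NF Ω r ν ∧ 0 < ubcRadius Ω ∧ r ≤ ubcRadius Ω ∧ ubcRadius Ω ≤ 2 * r := by
  obtain ⟨h1, h2, h3, r0, hr0⟩ := h
  have hb : BddAbove {r : ℝ | IsUBCWith Ω r} := by
    refine ⟨area Ω + 1, fun s hs => ?_⟩
    obtain ⟨ν, hν⟩ := exists_NF h1 h2 h3 hs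
    nlinarith [hν.r_sq_le_area, hν.rpos, sq_nonneg (s - 1)]
  have h0 : r0 ≤ ubcRadius Ω := le_csSup hb hr0
  have hpos : 0 < ubcRadius Ω := hr0.1.trans_le h0
  obtain ⟨r, hr, hlt⟩ := exists_lt_of_lt_csSup (⟨r0, hr0⟩ : {r : ℝ | IsUBCWith Ω r}.Nonempty)
    (show ubcRadius Ω / 2 < sSup {r : ℝ | IsUBCWith Ω r} by show _ < ubcRadius Ω; linarith)
  obtain ⟨ν, hν⟩ := exists_NF h1 h2 h3 hr
  exact ⟨r, ν, hν, hpos, le_csSup hb hr, by linarith⟩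

end

/-- Points reachable by short steps. -/
def reach (Ω : Set E2) (σ : ℝ) (x0 : E2) : ℕ → Set E2
  | 0 => {x0}
  | n+1 => {y | y ∈ Ω ∧ ∃ x ∈ reach Ω σ x0 n, dist x y < σ}

lemma reach_sub {Ω : Set E2} {σ : ℝ} {x0 : E2} (h0 : x0 ∈ Ω) (n : ℕ) : reach Ω σ x0 n ⊆ Ω := by
  cases n with
  | zero => intro x hx; rw [show x = x0 from hx]; exact h0
  | succ n => exact fun x hx => hx.1

lemma exists_chain_fn {Ω : Set E2} {σ : ℝ} {x0 : E2} (hΩ : IsOpen Ω) (hc : IsConnected Ω) (hσ : 0 < σ) (h0 : x0 ∈ Ω) :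
    ∃ n : E2 → ℕ, n x0 = 0 ∧ (∀ x ∈ Ω, n x = 0 → x = x0) ∧ (∀ x ∈ Ω, ∀ y ∈ Ω, dist x y < σ → n y ≤ n x + 1) ∧
      (∀ x ∈ Ω, ∀ k, n x = k + 1 → ∃ p ∈ Ω, n p = k ∧ dist p x < σ) := by
  have hex : ∀ x ∈ Ω, ∃ n, x ∈ reach Ω σ x0 n := by
    have hop : IsOpen (⋃ n, reach Ω σ x0 n) := by
      rw [Metric.isOpen_iff]
      intro x hx
      obtain ⟨n, hn⟩ := mem_iUnion.1 hx
      obtain ⟨ε, hε, hεΩ⟩ := Metric.isOpen_iff.1 hΩ x (reach_sub h0 n hn)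
      refine ⟨min ε σ, lt_min hε hσ, fun y hy => mem_iUnion.2 ⟨n+1, hεΩ (ball_subset_ball (min_le_left _ _) hy), x, hn, ?_⟩⟩
      rw [dist_comm]; exact ball_subset_ball (min_le_right _ _) hy
    have := hc.isPreconnected.subset_of_closure_inter_subset hop ⟨x0, h0, mem_iUnion.2 ⟨0, rfl⟩⟩ (by
      rintro y ⟨hy, hyΩ⟩
      obtain ⟨x, hx, hxy⟩ := Metric.mem_closure_iff.1 hy σ hσ
      obtain ⟨n, hn⟩ := mem_iUnion.1 hx
      exact mem_iUnion.2 ⟨n+1, hyΩ, x, hn, by rwa [dist_comm]⟩)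
    exact fun x hx => mem_iUnion.1 (this hx)
  have hmem : ∀ x ∈ Ω, x ∈ reach Ω σ x0 (sInf {n | x ∈ reach Ω σ x0 n}) := fun x hx => Nat.sInf_mem (s := {n | x ∈ reach Ω σ x0 n}) (hex x hx)
  have hle : ∀ x n, x ∈ reach Ω σ x0 n → sInf {n | x ∈ reach Ω σ x0 n} ≤ n := fun x n hn => Nat.sInf_le (s := {n | x ∈ reach Ω σ x0 n}) hn
  have hstep : ∀ x ∈ Ω, ∀ y ∈ Ω, dist x y < σ → sInf {n | y ∈ reach Ω σ x0 n} ≤ sInf {n | x ∈ reach Ω σ x0 n} + 1 :=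
    fun x hx y hy hxy => hle y _ ⟨hy, x, hmem x hx, hxy⟩
  refine ⟨fun x => sInf {n | x ∈ reach Ω σ x0 n}, ?_, ?_, hstep, ?_⟩
  · exact Nat.le_zero.1 (hle x0 0 rfl)
  · intro x hx hx0
    have h1 := hmem x hx
    simp only at hx0
    rw [hx0] at h1
    exact h1
  · intro x hx k hk
    have h1 := hmem x hx
    simp only at hk
    rw [hk] at h1
    obtain ⟨_, p, hp, hpx⟩ := h1
    have hpΩ := reach_sub h0 k hp
    refine ⟨p, hpΩ, ?_, hpx⟩
    have h2 := hle p k hp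
    have h3 := hstep p hpΩ x hx hpx
    show sInf _ = k
    omega

lemma const_of_exp {S : Set E2} (hS : IsPreconnected S) {f : E2 → ℝ} (hf : ContinuousOn f S)
    (h1 : ∀ x ∈ S, Circle.exp (f x) = 1) {x y : E2} (hx : x ∈ S) (hy : y ∈ S) : f x = f y := by
  have main : ∀ x ∈ S, ∀ y ∈ S, ¬ f x < f y := by
    intro x hx y hy hlt
    have himg := hS.image f hf
    obtain ⟨d, hd⟩ : ∃ d, d = min Real.pi (f y - f x) := ⟨_, rfl⟩
    have hd0 : 0 < d := hd ▸ lt_min Real.pi_pos (by linarith)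
    have hd1 : d ≤ Real.pi := hd ▸ min_le_left _ _
    have hd2 : d ≤ f y - f x := hd ▸ min_le_right _ _
    obtain ⟨z, hz, hzd⟩ := himg.Icc_subset ⟨x, hx, rfl⟩ ⟨y, hy, rfl⟩ (show f x + d ∈ Icc (f x) (f y) from ⟨by linarith, by linarith⟩)
    have h2 := h1 z hz
    rw [hzd, Circle.exp_add, h1 x hx, one_mul, Circle.exp_eq_one] at h2
    obtain ⟨n, hn⟩ := h2
    have hpi := Real.pi_pos
    have hn0 : (0:ℝ) < n := by
      by_contra hc; push Not at hc; nlinarith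
    have hn1 : (1:ℝ) ≤ n := by exact_mod_cast (by exact_mod_cast hn0 : (0:ℤ) < n)
    nlinarith
  exact le_antisymm (not_lt.1 (main y hy x hx)) (not_lt.1 (main x hx y hy))

lemma exists_level {Ω : Set E2} {σ δ : ℝ} {x0 y : E2} (hΩ : IsOpen Ω) (hc : IsConnected Ω) (hσ : 0 < σ) (hδ : 0 < δ) (h0 : x0 ∈ Ω)
    (hy : y ∈ Ω) {n : E2 → ℕ} (hn0 : n x0 = 0) (hn1 : ∀ x ∈ Ω, ∀ y ∈ Ω, dist x y < σ → n y ≤ n x + 1)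
    {t : ℕ} (ht : t + 2 ≤ n y) :
    ∃ p ∈ Ω, n p = t + 1 ∧ ((∃ z ∈ frontier Ω, dist p z < δ) ∨ p ∈ segment ℝ x0 y) := by
  classical
  by_contra hcon
  push Not at hcon
  obtain ⟨A, hA⟩ : ∃ A : Set E2, A = {x | x ∈ Ω ∧ n x ≤ t} := ⟨_, rfl⟩
  have hAne : A.Nonempty := ⟨x0, by rw [hA]; exact ⟨h0, by omega⟩⟩
  obtain ⟨g, hg⟩ : ∃ g : E2 → ℝ, g = fun x => min 1 (infDist x A / σ) := ⟨_, rfl⟩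
  have hgc : Continuous g := by
    rw [hg]; exact continuous_const.min ((continuous_infDist_pt A).div_const σ)
  have g0 : ∀ x ∈ Ω, n x ≤ t → g x = 0 := by
    intro x hx hxt
    have : infDist x A = 0 := infDist_zero_of_mem (by rw [hA]; exact ⟨hx, hxt⟩)
    rw [hg]; simp [this]
  have g1 : ∀ x ∈ Ω, t + 2 ≤ n x → g x = 1 := by
    intro x hx hxt
    have : σ ≤ infDist x A := (le_infDist hAne).2 fun a ha => by
      by_contra hlt; push Not at hlt
      rw [hA] at ha
      have h1 := hn1 a ha.1 x hx (by rwa [dist_comm])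
      have h2 := ha.2
      omega
    rw [hg]
    exact min_eq_left ((one_le_div hσ).2 this)
  obtain ⟨φ, hφ⟩ : ∃ φ : E2 → Circle, φ = fun x => if x ∈ Ω then Circle.exp (2 * Real.pi * g x) else 1 := ⟨_, rfl⟩
  have φin : ∀ x ∈ Ω, φ x = Circle.exp (2 * Real.pi * g x) := fun x hx => by rw [hφ]; simp [hx]
  have φout : ∀ x ∉ Ω, φ x = 1 := fun x hx => by rw [hφ]; simp [hx]
  have φone : ∀ x ∈ Ω, n x ≠ t + 1 → φ x = 1 := by
    intro x hx hne
    rw [φin x hx]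
    rcases lt_or_gt_of_ne hne with hlt | hgt
    · rw [g0 x hx (by omega)]; simp
    · rw [g1 x hx (by omega)]; simp
  have φc : Continuous φ := by
    rw [continuous_iff_continuousAt]
    intro x
    by_cases hx : x ∈ Ω
    · have : (fun x => Circle.exp (2 * Real.pi * g x)) =ᶠ[𝓝 x] φ := by
        filter_upwards [hΩ.mem_nhds hx] with z hz using (φin z hz).symm
      exact ContinuousAt.congr (Circle.exp.continuous.comp (continuous_const.mul hgc)).continuousAt this
    · have : (fun _ => (1 : Circle)) =ᶠ[𝓝 x] φ := by
        filter_upwards [ball_mem_nhds x hδ] with z hz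
        by_cases hzΩ : z ∈ Ω
        swap
        · exact (φout z hzΩ).symm
        refine (φone z hzΩ fun hnz => ?_).symm
        obtain ⟨w, hw, hwf⟩ := meet_frontier hΩ (convex_segment (𝕜 := ℝ) z x).isPreconnected
          (left_mem_segment ℝ z x) hzΩ (right_mem_segment ℝ z x) hx
        have h1 := (hcon z hzΩ hnz).1 w hwf
        have h2 : dist z w ≤ dist z x := by
          have := mem_segment_iff_wbtw.1 hw
          have := this.dist_add_dist
          linarith [dist_nonneg (x := w) (y := x)]
        rw [mem_ball] at hz
        linarith
      exact ContinuousAt.congr continuousAt_const this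
  obtain ⟨θ, ⟨hθ0, hθ⟩, -⟩ := Circle.isCoveringMap_exp.existsUnique_continuousMap_lifts (⟨φ, φc⟩ : C(E2, Circle)) x0 0 (by
    show Circle.exp 0 = φ x0
    rw [φone x0 h0 (by omega)]; simp)
  have hθ' : ∀ x, Circle.exp (θ x) = φ x := fun x => congrFun hθ x
  have c1 : θ x0 - 2 * Real.pi * g x0 = θ y - 2 * Real.pi * g y :=
    const_of_exp (f := fun x => θ x - 2 * Real.pi * g x) hc.isPreconnected
      (θ.continuous.sub (continuous_const.mul hgc)).continuousOn (fun x hx => by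
        show Circle.exp (θ x - 2 * Real.pi * g x) = 1
        rw [Circle.exp_sub, hθ', φin x hx, div_self']) h0 hy
  have c2 : θ x0 = θ y := const_of_exp (f := fun x => θ x) (convex_segment (𝕜 := ℝ) x0 y).isPreconnected θ.continuous.continuousOn
    (fun x hx => by
      show Circle.exp (θ x) = 1
      rw [hθ']
      by_cases hxΩ : x ∈ Ω
      · exact φone x hxΩ fun hh => (hcon x hxΩ hh).2 hx
      · exact φout x hxΩ) (left_mem_segment ℝ x0 y) (right_mem_segment ℝ x0 y)
  rw [g0 x0 h0 (by omega), g1 y hy ht] at c1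
  have := Real.pi_pos
  linarith

lemma card_parity (A : Finset ℕ) (K : ℝ) (h : ∀ i, ((A.filter (fun t => t % 2 = i)).card : ℝ) ≤ K) : (A.card : ℝ) ≤ 2 * K := by
  have h1 : A = A.filter (fun t => t % 2 = 0) ∪ A.filter (fun t => t % 2 = 1) := by
    ext t; simp only [Finset.mem_union, Finset.mem_filter, ← and_or_left]
    have := Nat.mod_two_eq_zero_or_one t
    tauto
  have h2 : (A.card : ℝ) ≤ ((A.filter (fun t => t % 2 = 0)).card : ℝ) + ((A.filter (fun t => t % 2 = 1)).card : ℝ) := by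
    have := Finset.card_union_le (A.filter (fun t => t % 2 = 0)) (A.filter (fun t => t % 2 = 1))
    rw [← h1] at this
    exact_mod_cast this
  linarith [h 0, h 1]

lemma NF.count {Ω : Set E2} {r : ℝ} {ν : E2 → E2} (h : NF Ω r ν) {σ : ℝ} {x0 y : E2} (hσ : 0 < σ) (hσr : σ ≤ r) (h0 : x0 ∈ Ω)
    (hy : y ∈ Ω) {n : E2 → ℕ} (hn0 : n x0 = 0) (hn1 : ∀ x ∈ Ω, ∀ y ∈ Ω, dist x y < σ → n y ≤ n x + 1) :
    (n y : ℝ) * σ ≤ 13 * perim Ω := by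
  classical
  have hlev : ∀ t ∈ Finset.range (n y - 1), ∃ p ∈ Ω, n p = t + 1 ∧ ((∃ z ∈ frontier Ω, dist p z < σ/4) ∨ p ∈ segment ℝ x0 y) := 
    fun t ht => exists_level h.op h.conn hσ (by positivity) h0 hy hn0 hn1 (by rw [Finset.mem_range] at ht; omega)
  have hsep : ∀ p ∈ Ω, ∀ q ∈ Ω, ∀ t s i : ℕ, n p = t + 1 → n q = s + 1 → t % 2 = i → s % 2 = i → t ≠ s → σ ≤ dist p q := by
    intro p hp q hq t s i h1 h2 h3 h4 h5
    by_contra hlt; push Not at hlt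
    have a1 := hn1 p hp q hq hlt
    have a2 := hn1 q hq p hp (by rwa [dist_comm])
    omega
  let A := Finset.range (n y - 1)
  let A1 := A.filter fun t => ∃ p ∈ Ω, n p = t + 1 ∧ ∃ z ∈ frontier Ω, dist p z < σ/4
  let A2 := A.filter fun t => ∃ p ∈ Ω, n p = t + 1 ∧ p ∈ segment ℝ x0 y
  have hcov : A ⊆ A1 ∪ A2 := by
    intro t ht
    obtain ⟨p, hp, hpt, hor⟩ := hlev t ht
    rw [Finset.mem_union]
    rcases hor with hz | hs
    · exact Or.inl (Finset.mem_filter.2 ⟨ht, p, hp, hpt, hz⟩)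
    · exact Or.inr (Finset.mem_filter.2 ⟨ht, p, hp, hpt, hs⟩)
  have hA1 : (A1.card : ℝ) ≤ 2 * (4 * perim Ω / σ) := by
    refine card_parity A1 _ fun i => ?_
    have hch : ∀ t, ∃ z, t ∈ A1.filter (fun t => t % 2 = i) → ∃ p ∈ Ω, n p = t + 1 ∧ z ∈ frontier Ω ∧ dist p z < σ/4 := by
      intro t
      by_cases ht : t ∈ A1.filter (fun t => t % 2 = i)
      · obtain ⟨p, hp, hpt, z, hz, hpz⟩ := (Finset.mem_filter.1 (Finset.mem_filter.1 ht).1).2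
        exact ⟨z, fun _ => ⟨p, hp, hpt, hz, hpz⟩⟩
      · exact ⟨0, fun hh => absurd hh ht⟩
    choose z hz using hch
    have := h.sep (s := σ/4) (by positivity) (by linarith) (A1.filter (fun t => t % 2 = i)) z
      (fun t ht => by obtain ⟨p, _, _, h3, _⟩ := hz t ht; exact h3)
      (fun t ht s hs hts => by
        obtain ⟨p, hp, hpt, _, hpz⟩ := hz t ht
        obtain ⟨q, hq, hqs, _, hqz⟩ := hz s hs
        have h1 := hsep p hp q hq t s i hpt hqs (Finset.mem_filter.1 ht).2 (Finset.mem_filter.1 hs).2 hts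
        have h2 := dist_triangle4_left (z t) (z s) p q
        rw [dist_comm (z t) p, dist_comm (z s) q] at h2
        linarith)
    rw [le_div_iff₀ hσ]; linarith
  have hA2 : (A2.card : ℝ) ≤ 2 * (perim Ω / σ + 1) := by
    refine card_parity A2 _ fun i => ?_
    have hch : ∀ t, ∃ a : ℝ, t ∈ A2.filter (fun t => t % 2 = i) → ∃ p ∈ Ω, n p = t + 1 ∧ 0 ≤ a ∧ a ≤ 1 ∧ p = x0 + a • (y - x0) := by
      intro t
      by_cases ht : t ∈ A2.filter (fun t => t % 2 = i)
      · obtain ⟨p, hp, hpt, hs⟩ := (Finset.mem_filter.1 (Finset.mem_filter.1 ht).1).2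
        rw [segment_eq_image'] at hs
        obtain ⟨a, ⟨ha0, ha1⟩, hpa⟩ := hs
        exact ⟨a, fun _ => ⟨p, hp, hpt, ha0, ha1, hpa.symm⟩⟩
      · exact ⟨0, fun hh => absurd hh ht⟩
    choose a ha using hch
    have hℓ := h.dist_le_perim h0 hy
    rw [dist_comm, dist_eq_norm] at hℓ
    have hinj : (A2.filter (fun t => t % 2 = i)).card ≤ (Finset.range (⌊‖y - x0‖ / σ⌋₊ + 1)).card := by
      refine Finset.card_le_card_of_injOn (fun t => ⌊a t * ‖y - x0‖ / σ⌋₊) ?_ ?_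
      · intro t ht
        obtain ⟨p, hp, hpt, ha0, ha1, -⟩ := ha t ht
        rw [Finset.mem_coe, Finset.mem_range, Nat.lt_succ_iff]
        apply Nat.floor_le_floor
        gcongr
        exact mul_le_of_le_one_left (norm_nonneg _) ha1
      · intro t ht s hs hts
        by_contra hne
        obtain ⟨p, hp, hpt, ha0, ha1, hpa⟩ := ha t ht
        obtain ⟨q, hq, hqs, hb0, hb1, hqb⟩ := ha s hs
        have h1 := hsep p hp q hq t s i hpt hqs (Finset.mem_filter.1 ht).2 (Finset.mem_filter.1 hs).2 hne
        rw [hpa, hqb, dist_eq_norm, add_sub_add_left_eq_sub, ← sub_smul, norm_smul, Real.norm_eq_abs] at h1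
        simp only at hts
        have f1 := Nat.floor_le (show 0 ≤ a t * ‖y - x0‖ / σ by positivity)
        have f2 := Nat.lt_floor_add_one (a t * ‖y - x0‖ / σ)
        have f3 := Nat.floor_le (show 0 ≤ a s * ‖y - x0‖ / σ by positivity)
        have f4 := Nat.lt_floor_add_one (a s * ‖y - x0‖ / σ)
        rw [← hts] at f3 f4
        have : |a t * ‖y - x0‖ / σ - a s * ‖y - x0‖ / σ| < 1 := abs_lt.2 ⟨by linarith, by linarith⟩
        rw [← sub_div, ← sub_mul, abs_div, abs_mul, abs_of_pos hσ, abs_of_nonneg (norm_nonneg _), div_lt_one hσ] at this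
        linarith
    rw [Finset.card_range] at hinj
    have h2 : (((A2.filter (fun t => t % 2 = i)).card : ℕ) : ℝ) ≤ ((⌊‖y - x0‖ / σ⌋₊ + 1 : ℕ) : ℝ) := by exact_mod_cast hinj
    push_cast at h2
    have h3 := Nat.floor_le (show 0 ≤ ‖y - x0‖ / σ by positivity)
    have h4 : ‖y - x0‖ / σ ≤ perim Ω / σ := by gcongr
    linarith
  have hAc : (A.card : ℝ) ≤ A1.card + A2.card := by
    have := (Finset.card_le_card hcov).trans (Finset.card_union_le _ _)
    exact_mod_cast this
  have hAc2 : (n y : ℝ) ≤ A.card + 1 := by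
    have : n y ≤ A.card + 1 := by simp only [A, Finset.card_range]; omega
    exact_mod_cast this
  have hP := h.r_le_perim
  have hle : (n y : ℝ) ≤ 10 * (perim Ω / σ) + 3 := by
    have : 2 * (4 * perim Ω / σ) = 8 * (perim Ω / σ) := by ring
    linarith
  have : (n y : ℝ) * σ ≤ (10 * (perim Ω / σ) + 3) * σ := by gcongr
  have e : (10 * (perim Ω / σ) + 3) * σ = 10 * perim Ω + 3 * σ := by field_simp
  linarith

lemma sum_overlap (m : Measure E2) (B : ℕ → Set E2) (hB : ∀ i, MeasurableSet (B i)) (N K : ℕ)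
    (h : ∀ p i j, i < N → j < N → p ∈ B i → p ∈ B j → j ≤ i + K) :
    ∑ i ∈ Finset.range N, m (B i) ≤ ((K + 1 : ℕ) : ℝ≥0∞) * m univ := by
  classical
  have h1 : ∀ i, m (B i) = ∫⁻ x, (B i).indicator 1 x ∂m := fun i => by rw [lintegral_indicator_one (hB i)]
  simp_rw [h1]
  rw [← lintegral_finsetSum _ (fun i _ => measurable_one.indicator (hB i))]
  have h2 : ∀ x : E2, ∑ i ∈ Finset.range N, (B i).indicator (1 : E2 → ℝ≥0∞) x ≤ ((K + 1 : ℕ) : ℝ≥0∞) := by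
    intro x
    let S := (Finset.range N).filter (fun i => x ∈ B i)
    have e : ∑ i ∈ Finset.range N, (B i).indicator (1 : E2 → ℝ≥0∞) x = (S.card : ℝ≥0∞) := by
      rw [Finset.card_filter]
      push_cast
      refine Finset.sum_congr rfl fun i _ => ?_
      simp [indicator_apply]
    rw [e]
    norm_cast
    rcases S.eq_empty_or_nonempty with hS | hS
    · rw [hS]; simp
    have hsub : S ⊆ Finset.Icc (S.min' hS) (S.min' hS + K) := by
      intro j hj
      have hm := S.min'_mem hS
      rw [Finset.mem_Icc]
      refine ⟨S.min'_le j hj, ?_⟩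
      have a := Finset.mem_filter.1 hm
      have b := Finset.mem_filter.1 hj
      exact h x _ _ (Finset.mem_range.1 a.1) (Finset.mem_range.1 b.1) a.2 b.2
    refine (Finset.card_le_card hsub).trans ?_
    rw [Nat.card_Icc]; omega
  calc _ ≤ ∫⁻ x, ((K + 1 : ℕ) : ℝ≥0∞) ∂m := lintegral_mono h2
    _ = _ := by rw [lintegral_const]

lemma KC.step {Ω w m C0 k} (h : KC Ω w m C0 k) {p q : E2} {ρ : ℝ} (hρ : 0 < ρ)
    (hp : ball p (2*ρ) ⊆ Ω) (hq : ball q (2*ρ) ⊆ Ω) (hd : dist p q ≤ ρ/2) :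
    ENNReal.ofReal ((k p ρ - k q ρ)^2) ≤ ENNReal.ofReal (8 * C0 / ρ^2) * (m (ball p (2*ρ)) + m (ball q (2*ρ))) := by
  have := h.cmp (y := p) (y' := q) (q := p) hρ hρ (by positivity : 0 < ρ/2) hp hq (ball_subset_ball (by linarith))
    (ball_subset_ball' (by linarith))
  rwa [show 2 * C0 / (ρ/2)^2 = 8 * C0 / ρ^2 by field_simp; ring] at this

lemma KC.chain {Ω w m C0 k} (h : KC Ω w m C0 k) {p : ℕ → E2} {N : ℕ} {ρ : ℝ} (hρ : 0 < ρ)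
    (hp : ∀ i ≤ N, ball (p i) (2*ρ) ⊆ Ω) (hd : ∀ i < N, dist (p i) (p (i+1)) ≤ ρ/2) :
    ENNReal.ofReal ((k (p 0) ρ - k (p N) ρ)^2) ≤
      ENNReal.ofReal (N * (16 * C0 / ρ^2)) * ∑ i ∈ Finset.range (N+1), m (ball (p i) (2*ρ)) := by
  have hC := h.pos
  have h1 : (k (p 0) ρ - k (p N) ρ)^2 ≤ N * ∑ i ∈ Finset.range N, (k (p i) ρ - k (p (i+1)) ρ)^2 := by
    rw [← Finset.sum_range_sub' (fun i => k (p i) ρ) N]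
    have := sq_sum_le_card_mul_sum_sq (s := Finset.range N) (f := fun i => k (p i) ρ - k (p (i+1)) ρ)
    rwa [Finset.card_range] at this
  refine (ENNReal.ofReal_le_ofReal h1).trans ?_
  rw [ENNReal.ofReal_mul (by positivity), ENNReal.ofReal_mul (by positivity), mul_assoc,
    ENNReal.ofReal_sum_of_nonneg (fun i _ => sq_nonneg _)]
  gcongr
  calc ∑ i ∈ Finset.range N, ENNReal.ofReal ((k (p i) ρ - k (p (i+1)) ρ)^2)
      ≤ ∑ i ∈ Finset.range N, ENNReal.ofReal (8 * C0 / ρ^2) * (m (ball (p i) (2*ρ)) + m (ball (p (i+1)) (2*ρ))) :=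
        Finset.sum_le_sum fun i hi => by
          have := Finset.mem_range.1 hi
          exact h.step hρ (hp i (by omega)) (hp (i+1) (by omega)) (hd i this)
    _ = ENNReal.ofReal (8 * C0 / ρ^2) * (∑ i ∈ Finset.range N, m (ball (p i) (2*ρ)) + ∑ i ∈ Finset.range N, m (ball (p (i+1)) (2*ρ))) := by
        rw [← Finset.mul_sum, Finset.sum_add_distrib]
    _ ≤ ENNReal.ofReal (8 * C0 / ρ^2) * (∑ i ∈ Finset.range (N+1), m (ball (p i) (2*ρ)) + ∑ i ∈ Finset.range (N+1), m (ball (p i) (2*ρ))) := by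
        gcongr 2
        · exact Finset.sum_le_sum_of_subset (Finset.range_subset_range.2 (by omega))
        · rw [Finset.sum_range_succ' _ N]; exact le_self_add
    _ = _ := by
        rw [← two_mul, ← mul_assoc]
        congr 1
        rw [show (2:ℝ≥0∞) = ENNReal.ofReal 2 by simp, ← ENNReal.ofReal_mul (by positivity)]
        congr 1; ring

lemma leg {Ω : Set E2} {σ : ℝ} {n : E2 → ℕ} (hn1 : ∀ x ∈ Ω, ∀ y ∈ Ω, dist x y < σ → n y ≤ n x + 1)
    {a b : E2} (hseg : ∀ s ∈ Icc (0:ℝ) 1, a + s • (b - a) ∈ Ω) {K : ℕ} (hK : 0 < K) (hd : dist a b < K * σ) :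
    n b ≤ n a + K := by
  have hK' : (0:ℝ) < K := by exact_mod_cast hK
  have key : ∀ i : ℕ, i ≤ K → n (a + ((i:ℝ)/K) • (b - a)) ≤ n a + i := by
    intro i
    induction i with
    | zero => intro _; simp
    | succ i ih =>
      intro hi
      have hmem : ∀ j : ℕ, j ≤ K → a + ((j:ℝ)/K) • (b - a) ∈ Ω := fun j hj =>
        hseg _ ⟨by positivity, (div_le_one hK').2 (by exact_mod_cast hj)⟩
      have h1 := hn1 _ (hmem i (by omega)) _ (hmem (i+1) hi) (by
        rw [dist_add_left, dist_eq_norm, ← sub_smul, norm_smul]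
        rw [show (i:ℝ)/K - ((i+1:ℕ):ℝ)/K = -(1/K) by push_cast; ring, norm_neg, Real.norm_of_nonneg (by positivity)]
        rw [dist_comm, dist_eq_norm] at hd
        rw [one_div, inv_mul_lt_iff₀ hK']; exact hd)
      have := ih (by omega)
      omega
  have := key K le_rfl
  rwa [div_self hK'.ne', one_smul, add_sub_cancel] at this

lemma chain_seq {Ω : Set E2} {σ : ℝ} {n : E2 → ℕ} (hn2 : ∀ x ∈ Ω, ∀ k, n x = k + 1 → ∃ p ∈ Ω, n p = k ∧ dist p x < σ) :
    ∀ N, ∀ y ∈ Ω, n y = N → ∃ q : ℕ → E2, q N = y ∧ (∀ i ≤ N, q i ∈ Ω ∧ n (q i) = i) ∧ ∀ i < N, dist (q i) (q (i+1)) < σ := by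
  intro N
  induction N with
  | zero =>
    intro y hy hn
    refine ⟨fun _ => y, rfl, fun i hi => ⟨hy, ?_⟩, fun i hi => absurd hi (by omega)⟩
    rw [hn]; omega
  | succ N ih =>
    intro y hy hn
    obtain ⟨p, hp, hpn, hd⟩ := hn2 y hy N hn
    obtain ⟨q, hq, h1, h2⟩ := ih p hp hpn
    refine ⟨fun i => if i ≤ N then q i else y, by simp, fun i hi => ?_, fun i hi => ?_⟩
    · by_cases hiN : i ≤ N
      · simp only [hiN, if_true]; exact h1 i hiN
      · simp only [hiN, if_false]; exact ⟨hy, by omega⟩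
    · by_cases hiN : i + 1 ≤ N
      · simp only [hiN, if_true, show i ≤ N by omega]; exact h2 i (by omega)
      · have : i = N := by omega
        subst this
        simp [hq, hd]

lemma KC.deep {Ω w m C0 k} (h : KC Ω w m C0 k) {r : ℝ} {ν : E2 → E2} (hN : NF Ω r ν) {x c : E2} (hd : dist x c ≤ r/2)
    (hseg : ∀ s ∈ Icc (0:ℝ) 1, D Ω x ≤ D Ω (x + s • (c - x))) (hx : 2 * (r/160) ≤ D Ω x) :
    ENNReal.ofReal ((k x (r/160) - k c (r/160))^2) ≤ ENNReal.ofReal (160 * (16 * C0 / (r/160)^2) * 161) * m univ := by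
  have hr := hN.rpos
  have hC := h.pos
  have := h.chain (p := fun i => x + ((i:ℝ)/160) • (c - x)) (N := 160) (ρ := r/160) (by positivity)
    (fun i hi => D_ball_le (hx.trans (hseg _ ⟨by positivity, by rw [div_le_one (by norm_num)]; exact_mod_cast hi⟩)))
    (fun i hi => by
      rw [dist_add_left, dist_eq_norm, ← sub_smul, norm_smul]
      rw [show (i:ℝ)/160 - ((i+1:ℕ):ℝ)/160 = -(1/160) by push_cast; ring, norm_neg, Real.norm_of_nonneg (by positivity)]
      rw [dist_comm, dist_eq_norm] at hd
      linarith)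
  simp only [Nat.cast_zero, zero_div, zero_smul, add_zero, Nat.cast_ofNat] at this
  rw [div_self (by norm_num), one_smul, add_sub_cancel] at this
  refine this.trans ?_
  rw [ENNReal.ofReal_mul (q := 161) (by positivity), mul_assoc]
  gcongr
  calc _ ≤ ∑ i ∈ Finset.range (160+1), m univ := Finset.sum_le_sum fun i _ => measure_mono (subset_univ _)
    _ = _ := by rw [Finset.sum_const, Finset.card_range, nsmul_eq_mul]; norm_num

lemma long_chain (C0 : ℝ) (hC0 : 0 < C0) : ∃ C1 : ℝ, 0 < C1 ∧ ∀ (Ω : Set E2) (w : E2 → ℝ) (m : Measure E2) (k : E2 → ℝ → ℝ) (r : ℝ) (ν : E2 → E2),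
    KC Ω w m C0 k → NF Ω r ν → ∃ k0 : ℝ, ∀ y ∈ Ω, 2 * (r/160) ≤ D Ω y →
      ENNReal.ofReal ((k y (r/160) - k0)^2) ≤ ENNReal.ofReal (C1 * (perim Ω / r^3)) * m univ := by
  obtain ⟨QA, hQA⟩ : ∃ Q : ℝ, Q = 160 * (16 * 160^2) * 161 := ⟨_, rfl⟩
  obtain ⟨QB, hQB⟩ : ∃ Q : ℝ, Q = 13 * 1280 * (16 * 160^2) * 1315 := ⟨_, rfl⟩
  have hQA0 : 0 < QA := by rw [hQA]; norm_num
  have hQB0 : 0 < QB := by rw [hQB]; norm_num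
  refine ⟨2 * (QA * C0) + 2 * (QB * C0), by positivity, fun Ω w m k r ν h hN => ?_⟩
  have hr := hN.rpos
  obtain ⟨c, hc⟩ := hN.centers
  obtain ⟨x0, hx0⟩ := hN.conn.1
  obtain ⟨σ, hσ⟩ : ∃ σ, σ = r/1280 := ⟨_, rfl⟩
  have hσ0 : 0 < σ := by rw [hσ]; positivity
  obtain ⟨n, hn0, hnz, hn1, hn2⟩ := exists_chain_fn hN.op hN.conn hσ0 hx0
  refine ⟨k (c x0) (r/160), fun y hy hyd => ?_⟩
  have hPr := hN.r_le_perim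
  have hP0 : 0 < perim Ω := hr.trans_le hPr
  obtain ⟨q, hqN, hq1, hq2⟩ := chain_seq hn2 (n y) y hy rfl
  have hq0 : q 0 = x0 := hnz _ (hq1 0 (by omega)).1 (hq1 0 (by omega)).2
  have hdeep := h.deep hN (hc y hy).2.1 (hc y hy).2.2.1 hyd
  have hb : ∀ x ∈ Ω, ball (c x) (2 * (r/160)) ⊆ Ω := fun x hx => (ball_subset_ball (by linarith)).trans (hc x hx).1
  have hch := h.chain (p := fun i => c (q i)) (N := n y) (ρ := r/160) (by positivity)
    (fun i hi => hb _ (hq1 i hi).1) (fun i hi => by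
      refine ((hc _ (hq1 i (by omega)).1).2.2.2 _ (hq1 (i+1) (by omega)).1).trans ?_
      have := hq2 i hi
      rw [hσ] at this; linarith)
  simp only [hq0, hqN] at hch
  have hov := sum_overlap m (fun i => ball (c (q i)) (2 * (r/160))) (fun i => measurableSet_ball) (n y + 1) 1314 (by
    intro p i j hi hj hpi hpj
    have hqi := hq1 i (by omega)
    have hqj := hq1 j (by omega)
    have hpos : ∀ x ∈ Ω, ∀ s ∈ Icc (0:ℝ) 1, x + s • (c x - x) ∈ Ω := fun x hx s hs =>
      mem_of_D_pos ((hN.D_pos hx).trans_le ((hc x hx).2.2.1 s hs))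
    have hcv : ∀ x ∈ Ω, ∀ a ∈ ball (c x) (2 * (r/160)), ∀ b ∈ ball (c x) (2 * (r/160)), ∀ s ∈ Icc (0:ℝ) 1, a + s • (b - a) ∈ Ω :=
      fun x hx a ha b hb' s hs => hb x hx ((convex_ball (c x) (2 * (r/160))).add_smul_sub_mem ha hb' hs)
    have hself : ∀ x : E2, x ∈ ball x (2 * (r/160)) := fun x => mem_ball_self (by positivity)
    have l1 := leg hn1 (a := q i) (b := c (q i)) (hpos _ hqi.1) (K := 641) (by norm_num) (by
      have := (hc _ hqi.1).2.1
      rw [hσ]; push_cast; linarith)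
    have l2 := leg hn1 (a := c (q i)) (b := p) (hcv _ hqi.1 _ (hself _) _ hpi) (K := 16) (by norm_num) (by
      rw [dist_comm]; rw [mem_ball] at hpi; rw [hσ]; push_cast; linarith)
    have l3 := leg hn1 (a := p) (b := c (q j)) (hcv _ hqj.1 _ hpj _ (hself _)) (K := 16) (by norm_num) (by
      rw [mem_ball] at hpj; rw [hσ]; push_cast; linarith)
    have l4 := leg hn1 (a := c (q j)) (b := q j) (fun s hs => by
      have := hpos _ hqj.1 (1 - s) ⟨by linarith [hs.2], by linarith [hs.1]⟩
      convert this using 1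
      rw [sub_smul, one_smul, smul_sub, smul_sub]; abel) (K := 641) (by norm_num) (by
      have := (hc _ hqj.1).2.1
      rw [dist_comm, hσ]; push_cast; linarith)
    have e1 := hqi.2
    have e2 := hqj.2
    omega)
  have hcount := hN.count hσ0 (by rw [hσ]; linarith) hx0 hy hn0 hn1
  have hA : 160 * (16 * C0 / (r/160)^2) * 161 ≤ QA * C0 * (perim Ω / r^3) := by
    have e1 : 160 * (16 * C0 / (r/160)^2) * 161 = QA * C0 * (r / r^3) := by rw [hQA]; field_simp
    rw [e1]; gcongr
  have hB : (n y : ℝ) * (16 * C0 / (r/160)^2) * 1315 ≤ QB * C0 * (perim Ω / r^3) := by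
    have e1 : (n y : ℝ) * (16 * C0 / (r/160)^2) * 1315 = (n y * σ) * (1280 * (16 * 160^2) * 1315 * C0 / r^3) := by rw [hσ]; field_simp
    have e2 : QB * C0 * (perim Ω / r^3) = (13 * perim Ω) * (1280 * (16 * 160^2) * 1315 * C0 / r^3) := by rw [hQB]; ring
    rw [e1, e2]; gcongr
  have hch2 : ENNReal.ofReal ((k (c x0) (r/160) - k (c y) (r/160))^2) ≤ ENNReal.ofReal (QB * C0 * (perim Ω / r^3)) * m univ := by
    refine hch.trans ?_
    calc _ ≤ ENNReal.ofReal (n y * (16 * C0 / (r/160)^2)) * (((1314 + 1 : ℕ) : ℝ≥0∞) * m univ) := by gcongr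
      _ = ENNReal.ofReal (n y * (16 * C0 / (r/160)^2) * 1315) * m univ := by
        rw [ENNReal.ofReal_mul (q := 1315) (by positivity), mul_assoc]; norm_num
      _ ≤ _ := by gcongr
  calc _ ≤ 2 * ENNReal.ofReal ((k y (r/160) - k (c y) (r/160))^2) + 2 * ENNReal.ofReal ((k (c x0) (r/160) - k (c y) (r/160))^2) :=
        ofReal_sq_split _ _ _
    _ ≤ 2 * (ENNReal.ofReal (QA * C0 * (perim Ω / r^3)) * m univ) + 2 * (ENNReal.ofReal (QB * C0 * (perim Ω / r^3)) * m univ) := by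
        gcongr
        refine hdeep.trans ?_
        gcongr
    _ = (2 * ENNReal.ofReal (QA * C0 * (perim Ω / r^3)) + 2 * ENNReal.ofReal (QB * C0 * (perim Ω / r^3))) * m univ := by ring
    _ = _ := by
        congr 1
        rw [show (2:ℝ≥0∞) = ENNReal.ofReal 2 by simp, ← ENNReal.ofReal_mul (by positivity), ← ENNReal.ofReal_mul (by positivity),
          ← ENNReal.ofReal_add (by positivity) (by positivity)]
        congr 1; ring

/-- Dyadic-type scales. -/
def tt (r : ℝ) (j : ℕ) : ℝ := r/10 * (31/32)^j

lemma tt_pos {r : ℝ} (hr : 0 < r) (j : ℕ) : 0 < tt r j := by unfold tt; positivity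
lemma tt_succ (r : ℝ) (j : ℕ) : tt r (j+1) = 31/32 * tt r j := by unfold tt; ring
lemma tt_zero (r : ℝ) : tt r 0 = r/10 := by unfold tt; ring
lemma tt_anti {r : ℝ} (hr : 0 < r) : Antitone (tt r) := by
  refine antitone_nat_of_succ_le fun j => ?_
  rw [tt_succ]; have := tt_pos hr j; linarith
lemma tt_le {r : ℝ} (hr : 0 < r) (j : ℕ) : tt r j ≤ r/10 := by
  rw [← tt_zero]; exact tt_anti hr (Nat.zero_le j)

lemma rec_bound (a : ℕ → ℝ) (j : ℕ) :
    (a j - a 0)^2 ≤ ∑ k ∈ Finset.range j, 63 * (63/62:ℝ)^(j-1-k) * (a k - a (k+1))^2 := by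
  induction j with
  | zero => simp
  | succ j ih =>
    rw [Finset.sum_range_succ]
    have e1 : ∑ k ∈ Finset.range j, 63 * (63/62:ℝ)^(j+1-1-k) * (a k - a (k+1))^2
        = (63/62) * ∑ k ∈ Finset.range j, 63 * (63/62:ℝ)^(j-1-k) * (a k - a (k+1))^2 := by
      rw [Finset.mul_sum]
      refine Finset.sum_congr rfl fun k hk => ?_
      have := Finset.mem_range.1 hk
      rw [show j + 1 - 1 - k = (j - 1 - k) + 1 by omega, pow_succ]; ring
    rw [e1]
    simp only [Nat.add_sub_cancel, Nat.sub_self, pow_zero, mul_one]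
    have : (a (j+1) - a 0)^2 ≤ 63/62 * (a j - a 0)^2 + 63 * (a j - a (j+1))^2 := by
      nlinarith [sq_nonneg ((a j - a 0) + 62 * (a j - a (j+1)))]
    linarith

/-- Good points for direction `u`. -/
def GG (Ω : Set E2) (r : ℝ) (u : E2) : Set E2 := {x | ∀ t ∈ Icc (0:ℝ) (r/10), D Ω x + t/4 ≤ D Ω (x - t • u)}

def LL (Ω : Set E2) (r : ℝ) (u : E2) (j : ℕ) : Set E2 :=
  GG Ω r u ∩ {x | tt r (j+1) < D Ω x ∧ D Ω x ≤ tt r j}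

def RR (Ω : Set E2) (r : ℝ) (j : ℕ) : Set E2 := {x | tt r j / 16 ≤ D Ω x ∧ D Ω x ≤ 2 * tt r j}

lemma meas_GG (Ω r u) : MeasurableSet (GG Ω r u) := by
  have : GG Ω r u = ⋂ t ∈ Icc (0:ℝ) (r/10), {x | D Ω x + t/4 ≤ D Ω (x - t • u)} := by
    ext x; simp [GG]
  rw [this]
  refine IsClosed.measurableSet (isClosed_biInter fun t _ => ?_)
  have := D_cont (Ω := Ω)
  exact isClosed_le (this.add continuous_const) (this.comp (continuous_id.sub continuous_const))

lemma meas_LL (Ω r u j) : MeasurableSet (LL Ω r u j) := by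
  have := (D_cont (Ω := Ω)).measurable
  exact (meas_GG Ω r u).inter ((measurableSet_lt measurable_const this).inter (measurableSet_le this measurable_const))

lemma meas_RR (Ω r j) : MeasurableSet (RR Ω r j) := by
  have := (D_cont (Ω := Ω)).measurable
  exact (measurableSet_le measurable_const this).inter (measurableSet_le this measurable_const)

lemma ball_sub_RR {Ω : Set E2} {r : ℝ} {x : E2} {s : ℝ} {j : ℕ} (h1 : tt r j / 16 + s ≤ D Ω x) (h2 : D Ω x + s ≤ 2 * tt r j) :
    ball x s ⊆ RR Ω r j := by
  intro y hy
  rw [mem_ball] at hy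
  have a := D_lip (Ω := Ω) x y
  have b := D_lip (Ω := Ω) y x
  rw [dist_comm] at a
  constructor <;> linarith

lemma LL_center {Ω : Set E2} {r : ℝ} (hr : 0 < r) {u x : E2} (hu : ‖u‖ = 1) {j k : ℕ} (hk : k ≤ j) (hx : x ∈ LL Ω r u j) :
    tt r k / 4 ≤ D Ω (x - (tt r k - tt r j) • u) ∧ D Ω (x - (tt r k - tt r j) • u) ≤ tt r k := by
  have a := tt_anti hr hk
  have b := tt_le hr k
  have c := tt_pos hr j
  have h1 := hx.1 (tt r k - tt r j) ⟨by linarith, by linarith⟩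
  have h2 := hx.2.1
  have h3 := hx.2.2
  rw [tt_succ] at h2
  refine ⟨by linarith, ?_⟩
  have h4 := D_lip (Ω := Ω) (x - (tt r k - tt r j) • u) x
  have : dist (x - (tt r k - tt r j) • u) x = tt r k - tt r j := by
    rw [dist_eq_norm, sub_sub_cancel_left, norm_neg, norm_smul, hu, mul_one, Real.norm_of_nonneg (by linarith)]
  linarith

lemma KC.consec {Ω w m C0 k} (h : KC Ω w m C0 k) {r : ℝ} (hr : 0 < r) {u x : E2} (hu : ‖u‖ = 1) {j i : ℕ} (hi : i < j)
    (hx : x ∈ LL Ω r u j) :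
    ENNReal.ofReal ((k (x - (tt r i - tt r j) • u) (tt r i / 16) - k (x - (tt r (i+1) - tt r j) • u) (tt r (i+1) / 16))^2) ≤
      ENNReal.ofReal (4096 * C0 / (tt r i)^2) * (m.restrict (RR Ω r i)) (ball x (2 * tt r i)) := by
  obtain ⟨a1, a2⟩ := LL_center hr hu hi.le hx
  obtain ⟨b1, b2⟩ := LL_center hr hu (Nat.succ_le_of_lt hi) hx
  have hti := tt_pos hr i
  have hC := h.pos
  have htj := tt_pos hr j
  have hij := tt_anti hr (Nat.succ_le_of_lt hi)
  simp only [Nat.succ_eq_add_one] at *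
  obtain ⟨s, hs⟩ : ∃ s, s = tt r i := ⟨_, rfl⟩
  obtain ⟨s', hs'⟩ : ∃ s', s' = tt r j := ⟨_, rfl⟩
  have e1 : tt r (i+1) = 31/32 * s := by rw [tt_succ, hs]
  obtain ⟨y, hy⟩ : ∃ y, y = x - (tt r i - tt r j) • u := ⟨_, rfl⟩
  obtain ⟨y', hy'⟩ : ∃ y', y' = x - (tt r (i+1) - tt r j) • u := ⟨_, rfl⟩
  have d1 : dist y x = s - s' := by
    rw [hy, dist_eq_norm, sub_sub_cancel_left, norm_neg, norm_smul, hu, mul_one, Real.norm_of_nonneg (by linarith)]; linarith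
  have d2 : dist y' x = 31/32*s - s' := by
    rw [hy', dist_eq_norm, sub_sub_cancel_left, norm_neg, norm_smul, hu, mul_one, Real.norm_of_nonneg (by linarith)]; linarith
  have d3 : dist y' y = s/32 := by
    rw [hy, hy', e1, ← hs, dist_eq_norm, show x - (31/32*s - tt r j) • u - (x - (s - tt r j) • u) = (s/32) • u by module,
      norm_smul, hu, mul_one, Real.norm_of_nonneg (by linarith)]
  rw [← hy] at a1 a2
  rw [← hy', e1] at b1 b2
  rw [e1] at hij
  rw [← hs] at a1 a2 hti
  rw [← hy, ← hy', ← hs, e1]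
  have key := h.cmp (y := y) (y' := y') (q := y') (ρ := s/16) (ρ' := 31/32*s/16) (τ := s/32) (by linarith) (by linarith) (by linarith)
    (D_ball_le (by linarith)) (D_ball_le (by linarith)) (ball_subset_ball' (by linarith)) (ball_subset_ball (by linarith))
  refine key.trans ?_
  have m1 : m (ball y (2*(s/16))) ≤ (m.restrict (RR Ω r i)) (ball x (2*s)) := by
    rw [Measure.restrict_apply measurableSet_ball]
    exact measure_mono (subset_inter (ball_subset_ball' (by linarith)) (ball_sub_RR (by linarith) (by linarith)))
  have m2 : m (ball y' (2*(31/32*s/16))) ≤ (m.restrict (RR Ω r i)) (ball x (2*s)) := by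
    rw [Measure.restrict_apply measurableSet_ball]
    exact measure_mono (subset_inter (ball_subset_ball' (by linarith)) (ball_sub_RR (by linarith) (by linarith)))
  calc _ ≤ ENNReal.ofReal (2 * C0 / (s/32)^2) * ((m.restrict (RR Ω r i)) (ball x (2*s)) + (m.restrict (RR Ω r i)) (ball x (2*s))) := by gcongr
    _ = _ := by
      rw [← two_mul, ← mul_assoc]
      congr 1
      rw [show (2:ℝ≥0∞) = ENNReal.ofReal 2 by simp, ← ENNReal.ofReal_mul (by positivity)]
      congr 1
      field_simp; ring

lemma KC.pt {Ω w m C0 k} (h : KC Ω w m C0 k) {r : ℝ} (hr : 0 < r) {u x : E2} (hu : ‖u‖ = 1) {j : ℕ}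
    (hx : x ∈ LL Ω r u j) :
    ENNReal.ofReal ((k x (tt r j / 16) - k (x - (tt r 0 - tt r j) • u) (r/160))^2) ≤
      ∑ i ∈ Finset.range j, ENNReal.ofReal (63 * (63/62:ℝ)^(j-1-i) * (4096 * C0 / (tt r i)^2)) *
        (m.restrict (RR Ω r i)) (ball x (2 * tt r i)) := by
  have key := rec_bound (fun i => k (x - (tt r i - tt r j) • u) (tt r i / 16)) j
  simp only [sub_self, zero_smul, sub_zero] at key
  rw [show tt r 0 / 16 = r/160 by rw [tt_zero]; ring] at key
  refine (ENNReal.ofReal_le_ofReal key).trans ?_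
  rw [ENNReal.ofReal_sum_of_nonneg (fun i _ => by positivity)]
  refine Finset.sum_le_sum fun i hi => ?_
  rw [ENNReal.ofReal_mul (by positivity), ENNReal.ofReal_mul (by positivity) (p := 63 * (63/62:ℝ)^(j-1-i)), mul_assoc]
  gcongr
  exact h.consec hr hu (Finset.mem_range.1 hi) hx

lemma vol_strip {Ω : Set E2} {r : ℝ} (hr : 0 < r) {u : E2} (hu : ‖u‖ = 1) {i j : ℕ} (hi : i ≤ j) (y : E2) :
    volume (ball y (2 * tt r i) ∩ LL Ω r u j) ≤ ENNReal.ofReal (72 * tt r i * tt r j) := by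
  have h1 := tt_pos hr i
  have h2 := tt_pos hr j
  have h3 := tt_anti hr hi
  have h4 := tt_le hr i
  obtain ⟨A, hA⟩ : ∃ A, A = ball y (2 * tt r i) ∩ LL Ω r u j := ⟨_, rfl⟩
  have hAm : MeasurableSet A := by rw [hA]; exact measurableSet_ball.inter (meas_LL _ _ _ _)
  rw [← hA]
  obtain ⟨N, hN⟩ : ∃ N, N = ⌊tt r i / tt r j⌋₊ := ⟨_, rfl⟩
  have hN1 : 1 ≤ N := by rw [hN]; exact Nat.le_floor (by rw [Nat.cast_one, le_div_iff₀ h2]; linarith)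
  have hNle : N * tt r j ≤ tt r i := by
    rw [← le_div_iff₀ h2, hN]; exact Nat.floor_le (by positivity)
  have hNge : tt r i ≤ 2 * N * tt r j := by
    have := Nat.lt_floor_add_one (tt r i / tt r j)
    rw [← hN, div_lt_iff₀ h2] at this
    have : (1:ℝ) ≤ N := by exact_mod_cast hN1
    nlinarith
  have hdisj : ∀ a b : ℕ, a < b → b < N → Disjoint ((fun x => x + ((a:ℝ) * tt r j) • u) ⁻¹' A) ((fun x => x + ((b:ℝ) * tt r j) • u) ⁻¹' A) := by
    intro a b hab hb
    rw [Set.disjoint_left]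
    intro z hz1 hz2
    simp only [mem_preimage, hA] at hz1 hz2
    have g := hz2.2.1 (((b:ℝ) - a) * tt r j)
    have hab' : (1:ℝ) ≤ (b:ℝ) - a := by
      have : ((a+1:ℕ):ℝ) ≤ b := by exact_mod_cast hab
      push_cast at this; linarith
    have hb' : (b:ℝ) ≤ N := by exact_mod_cast hb.le
    have ha0 : (0:ℝ) ≤ a := by positivity
    rw [show z + ((b:ℝ) * tt r j) • u - (((b:ℝ) - a) * tt r j) • u = z + ((a:ℝ) * tt r j) • u by module] at g
    have g' := g ⟨by positivity, by nlinarith⟩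
    have q1 := hz1.2.2.2
    have q2 := hz2.2.2.1
    rw [tt_succ] at q2
    nlinarith
  have hvol : ∀ a : ℕ, volume ((fun x => x + ((a:ℝ) * tt r j) • u) ⁻¹' A) = volume A := fun a => measure_preimage_add_right _ _ _
  have hsum : (N : ℝ≥0∞) * volume A ≤ ENNReal.ofReal (4 * (3 * tt r i)^2) := by
    have : ∑ a ∈ Finset.range N, volume ((fun x => x + ((a:ℝ) * tt r j) • u) ⁻¹' A) = N * volume A := by
      simp_rw [hvol]; simp
    rw [← this, ← measure_biUnion_finset]
    · refine (measure_mono (t := ball y (3 * tt r i)) ?_).trans (vol_ball_le _ (by positivity))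
      refine iUnion₂_subset fun a ha z hz => ?_
      have ha' : (a:ℝ) ≤ N := by exact_mod_cast (Finset.mem_range.1 ha).le
      rw [mem_preimage, hA] at hz
      have := hz.1
      rw [mem_ball] at this ⊢
      have t := dist_triangle z (z + ((a:ℝ) * tt r j) • u) y
      rw [dist_self_add_right, norm_smul, hu, mul_one, Real.norm_of_nonneg (by positivity)] at t
      nlinarith
    · intro a ha b hb hab
      have ha := Finset.mem_range.1 (Finset.mem_coe.1 ha)
      have hb := Finset.mem_range.1 (Finset.mem_coe.1 hb)
      rcases lt_or_gt_of_ne hab with c | c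
      · exact hdisj a b c hb
      · exact (hdisj b a c ha).symm
    · intro a _
      exact (measurable_id.add_const _) hAm
  have hN0 : (0:ℝ) < N := by exact_mod_cast hN1
  have hNe : (N : ℝ≥0∞) = ENNReal.ofReal N := by simp
  have : ENNReal.ofReal N * volume A ≤ ENNReal.ofReal N * ENNReal.ofReal (72 * tt r i * tt r j) := by
    rw [← hNe]
    refine hsum.trans ?_
    rw [hNe, ← ENNReal.ofReal_mul hN0.le]
    apply ENNReal.ofReal_le_ofReal
    nlinarith
  rwa [ENNReal.mul_le_mul_iff_right (ENNReal.ofReal_pos.2 hN0).ne' ENNReal.ofReal_ne_top] at this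

lemma geom_conv (c : ℝ≥0∞) (hc : 1 + 64 * c = 64) (M : ℕ → ℝ≥0∞) (J : ℕ) :
    (∑ j ∈ Finset.range J, ∑ i ∈ Finset.range j, c^(j-1-i) * M i) + 64 * ∑ i ∈ Finset.range J, c^(J-1-i) * M i
      = 64 * ∑ i ∈ Finset.range J, M i := by
  induction J with
  | zero => simp
  | succ J ih =>
    have e1 : ∑ i ∈ Finset.range (J+1), c^(J+1-1-i) * M i = c * (∑ i ∈ Finset.range J, c^(J-1-i) * M i) + M J := by
      rw [Finset.sum_range_succ, Finset.mul_sum]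
      congr 1
      · refine Finset.sum_congr rfl fun i hi => ?_
        have := Finset.mem_range.1 hi
        rw [show J + 1 - 1 - i = (J - 1 - i) + 1 by omega, pow_succ]; ring
      · simp
    rw [e1, Finset.sum_range_succ, Finset.sum_range_succ, mul_add, mul_add, ← ih, ← add_assoc, add_assoc (∑ j ∈ _, _)]
    congr 2
    rw [← mul_assoc]
    conv_lhs => rw [← one_mul (∑ i ∈ Finset.range J, c^(J-1-i) * M i)]
    rw [← mul_assoc, ← add_mul, mul_one, hc]

lemma coef_bound {r C0 : ℝ} (hr : 0 < r) (hC : 0 < C0) {i j : ℕ} (hi : i < j) :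
    63 * (63/62:ℝ)^(j-1-i) * (4096 * C0 / (tt r i)^2) * (72 * tt r i * tt r j) ≤ 18579456 * C0 * (63/64)^(j-1-i) := by
  obtain ⟨n, rfl⟩ : ∃ n, j = i + n + 1 := ⟨j - i - 1, by omega⟩
  rw [show i + n + 1 - 1 - i = n by omega]
  have h1 := tt_pos hr i
  have e1 : tt r (i+n+1) = tt r i * (31/32)^n * (31/32) := by unfold tt; ring
  rw [e1, show (63/64:ℝ) = 63/62 * (31/32) by norm_num, mul_pow]
  have : 63 * (63/62:ℝ)^n * (4096 * C0 / (tt r i)^2) * (72 * tt r i * (tt r i * (31/32)^n * (31/32))) =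
    (63 * 4096 * 72 * (31/32)) * C0 * ((63/62)^n * (31/32)^n) := by field_simp
  rw [this]
  gcongr
  norm_num

lemma RR_overlap {Ω : Set E2} {r : ℝ} (hr : 0 < r) {p : E2} {i j : ℕ} (hi : p ∈ RR Ω r i) (hj : p ∈ RR Ω r j) : j ≤ i + 120 := by
  by_contra hc
  push Not at hc
  have h1 := hi.1
  have h2 := hj.2
  have h3 := tt_anti hr hc.le
  have h4 : tt r (i+120) = tt r i * (31/32)^120 := by unfold tt; ring
  have h5 := tt_pos hr i
  have h6 : ((31:ℝ)/32)^120 < 1/40 := by norm_num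
  nlinarith

lemma KC.hardy_layer {Ω w m C0 k} (h : KC Ω w m C0 k) {r : ℝ} (hr : 0 < r) {u : E2} (hu : ‖u‖ = 1) {k0 : ℝ} {E : ℝ≥0∞}
    (hE : ∀ y ∈ Ω, 2 * (r/160) ≤ D Ω y → ENNReal.ofReal ((k y (r/160) - k0)^2) ≤ E) (j : ℕ) :
    ∫⁻ x in LL Ω r u j, ENNReal.ofReal ((w x - k0)^2) ≤
      2 * (ENNReal.ofReal (2754 * C0) * m (RR Ω r j))
       + (4 * (ENNReal.ofReal (18579456 * C0) * ∑ i ∈ Finset.range j, (ENNReal.ofReal (63/64))^(j-1-i) * m (RR Ω r i))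
       + 4 * E * volume (LL Ω r u j)) := by
  have hfin := h.fin
  have hC := h.pos
  have htj := tt_pos hr j
  obtain ⟨M, hM⟩ : ∃ M : E2 → ℝ≥0∞, M = fun x => ∑ i ∈ Finset.range j, ENNReal.ofReal (63 * (63/62:ℝ)^(j-1-i) * (4096 * C0 / (tt r i)^2)) *
        (m.restrict (RR Ω r i)) (ball x (2 * tt r i)) := ⟨_, rfl⟩
  have hMm : Measurable M := by
    rw [hM]
    exact Finset.measurable_fun_sum _ fun i _ => (meas_ball_fun _ _).const_mul _
  have hpt : ∀ x ∈ LL Ω r u j, ENNReal.ofReal ((w x - k0)^2) ≤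
      2 * ENNReal.ofReal ((w x - k x (tt r j / 16))^2) + (4 * M x + 4 * E) := by
    intro x hx
    have p1 := h.pt hr hu hx
    obtain ⟨c1, c2⟩ := LL_center hr hu (Nat.zero_le j) hx
    rw [tt_zero] at c1
    have p2 := hE (x - (tt r 0 - tt r j) • u) (mem_of_D_pos (by rw [tt_zero]; linarith)) (by rw [tt_zero]; linarith)
    refine (ofReal_sq_split (w x) k0 (k x (tt r j / 16))).trans ?_
    gcongr
    have p3 := ofReal_sq_split k0 (k x (tt r j / 16)) (k (x - (tt r 0 - tt r j) • u) (r/160))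
    have e : ∀ a b : ℝ, (a - b)^2 = (b - a)^2 := fun a b => by ring
    rw [e k0 (k _ (r/160))] at p3
    calc _ ≤ 2 * (2 * E + 2 * M x) := by
          refine mul_le_mul_right (p3.trans ?_) _
          rw [hM]
          gcongr
      _ = 4 * M x + 4 * E := by ring
  calc _ ≤ ∫⁻ x in LL Ω r u j, (2 * ENNReal.ofReal ((w x - k x (tt r j / 16))^2) + (4 * M x + 4 * E)) :=
        setLIntegral_mono' (meas_LL _ _ _ _) hpt
    _ = 2 * (∫⁻ x in LL Ω r u j, ENNReal.ofReal ((w x - k x (tt r j / 16))^2)) + (4 * (∫⁻ x in LL Ω r u j, M x) + 4 * E * volume (LL Ω r u j)) := by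
        rw [lintegral_add_right _ (by fun_prop), lintegral_add_right _ measurable_const, setLIntegral_const,
          lintegral_const_mul' _ _ (by norm_num), lintegral_const_mul' _ _ (by norm_num)]
    _ ≤ _ := by
        gcongr
        · refine h.whit (meas_LL _ _ _ _) (meas_RR _ _ _) (by positivity) fun x hx => ?_
          have a := hx.2.1
          have b := hx.2.2
          rw [tt_succ] at a
          exact ⟨D_ball_le (by linarith), ball_sub_RR (by linarith) (by linarith)⟩
        · rw [hM, lintegral_finsetSum _ (fun i _ => (meas_ball_fun _ _).const_mul _), Finset.mul_sum]
          refine Finset.sum_le_sum fun i hi => ?_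
          have hi := Finset.mem_range.1 hi
          rw [lintegral_const_mul' _ _ ENNReal.ofReal_ne_top, ball_tonelli]
          have hti := tt_pos hr i
          calc _ ≤ ENNReal.ofReal (63 * (63/62:ℝ)^(j-1-i) * (4096 * C0 / (tt r i)^2)) * ∫⁻ y, ENNReal.ofReal (72 * tt r i * tt r j) ∂(m.restrict (RR Ω r i)) := by
                gcongr with y
                exact vol_strip hr hu hi.le y
            _ = ENNReal.ofReal (63 * (63/62:ℝ)^(j-1-i) * (4096 * C0 / (tt r i)^2) * (72 * tt r i * tt r j)) * m (RR Ω r i) := by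
                rw [lintegral_const, Measure.restrict_apply_univ, ENNReal.ofReal_mul (by positivity) (q := 72 * tt r i * tt r j), ← mul_assoc]
            _ ≤ ENNReal.ofReal (18579456 * C0 * (63/64)^(j-1-i)) * m (RR Ω r i) := by
                exact mul_le_mul_left (ENNReal.ofReal_le_ofReal (coef_bound hr hC hi)) _
            _ = _ := by
                rw [ENNReal.ofReal_mul (by positivity), ENNReal.ofReal_pow (by norm_num), mul_assoc]

lemma LL_disj (Ω : Set E2) {r : ℝ} (hr : 0 < r) (u : E2) : Pairwise (fun a b => Disjoint (LL Ω r u a) (LL Ω r u b)) := by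
  have : ∀ a b : ℕ, a < b → Disjoint (LL Ω r u a) (LL Ω r u b) := by
    intro a b hab
    rw [Set.disjoint_left]
    intro x h1 h2
    have := tt_anti hr (Nat.succ_le_of_lt hab)
    have q1 := h1.2.1
    have q2 := h2.2.2
    simp only [Nat.succ_eq_add_one] at this
    linarith
  intro a b hab
  rcases lt_or_gt_of_ne hab with c | c
  · exact this a b c
  · exact (this b a c).symm

lemma KC.hardy {Ω w m C0 k} (h : KC Ω w m C0 k) {r : ℝ} (hr : 0 < r) {u : E2} (hu : ‖u‖ = 1) {k0 : ℝ} {E : ℝ≥0∞}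
    (hE : ∀ y ∈ Ω, 2 * (r/160) ≤ D Ω y → ENNReal.ofReal ((k y (r/160) - k0)^2) ≤ E) :
    ∫⁻ x in ⋃ j, LL Ω r u j, ENNReal.ofReal ((w x - k0)^2) ≤
      ENNReal.ofReal ((2 * 2754 + 4 * 18579456 * 64) * 121 * C0) * m univ + 4 * E * volume Ω := by
  have hC := h.pos
  rw [lintegral_iUnion (meas_LL _ _ _) (LL_disj Ω hr u)]
  refine ENNReal.tsum_le_of_sum_range_le fun J => ?_
  refine (Finset.sum_le_sum fun j _ => h.hardy_layer hr hu hE j).trans ?_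
  rw [Finset.sum_add_distrib, Finset.sum_add_distrib, ← add_assoc]
  have hov := sum_overlap m (RR Ω r) (meas_RR Ω r) J 120 (fun p i j _ _ hi hj => RR_overlap hr hi hj)
  have hg : ∑ j ∈ Finset.range J, ∑ i ∈ Finset.range j, (ENNReal.ofReal (63/64))^(j-1-i) * m (RR Ω r i) ≤
      64 * ∑ i ∈ Finset.range J, m (RR Ω r i) := by
    rw [← geom_conv (ENNReal.ofReal (63/64)) ?_ _ J]
    · exact le_self_add
    · rw [show (64:ℝ≥0∞) = ENNReal.ofReal 64 by simp, show (1:ℝ≥0∞) = ENNReal.ofReal 1 by simp, ← ENNReal.ofReal_mul (by norm_num),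
        ← ENNReal.ofReal_add (by norm_num) (by norm_num)]
      norm_num
  gcongr
  · simp_rw [← Finset.mul_sum]
    calc _ ≤ 2 * (ENNReal.ofReal (2754 * C0) * (((120 + 1 : ℕ) : ℝ≥0∞) * m univ)) +
          4 * (ENNReal.ofReal (18579456 * C0) * (64 * (((120 + 1 : ℕ) : ℝ≥0∞) * m univ))) := by
          gcongr
          exact hg.trans (by gcongr)
      _ = (2 * ENNReal.ofReal (2754 * C0) * ((120 + 1 : ℕ) : ℝ≥0∞) + 4 * ENNReal.ofReal (18579456 * C0) * 64 * ((120 + 1 : ℕ) : ℝ≥0∞)) * m univ := by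
          ring
      _ = _ := by
          congr 1
          rw [show (2:ℝ≥0∞) = ENNReal.ofReal 2 by simp, show (4:ℝ≥0∞) = ENNReal.ofReal 4 by simp, show (64:ℝ≥0∞) = ENNReal.ofReal 64 by simp,
            show ((120 + 1 : ℕ) : ℝ≥0∞) = ENNReal.ofReal 121 by norm_num,
            ← ENNReal.ofReal_mul (by positivity), ← ENNReal.ofReal_mul (by positivity), ← ENNReal.ofReal_mul (by positivity),
            ← ENNReal.ofReal_mul (by positivity), ← ENNReal.ofReal_mul (by positivity), ← ENNReal.ofReal_add (by positivity) (by positivity)]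
          congr 1
          ring
  · rw [← Finset.mul_sum]
    gcongr
    rw [← measure_biUnion_finset (fun a _ b _ hab => LL_disj Ω hr u hab) (fun _ _ => meas_LL _ _ _ _)]
    refine measure_mono (iUnion₂_subset fun j _ x hx => mem_of_D_pos ((tt_pos hr (j+1)).trans hx.2.1))

lemma NF.cover {Ω r ν} (hN : NF Ω r ν) {x : E2} (hx : x ∈ Ω) (hd : D Ω x ≤ r/10) :
    ∃ u ∈ ({e 0, - e 0, e 1, - e 1} : Set E2), x ∈ ⋃ j, LL Ω r u j := by
  have hr := hN.rpos
  obtain ⟨u, hu, hG⟩ := hN.cone hx hd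
  refine ⟨u, hu, ?_⟩
  have hp := hN.D_pos hx
  have hex : ∃ j, tt r (j+1) < D Ω x := by
    obtain ⟨n, hn⟩ := exists_pow_lt_of_lt_one (show 0 < D Ω x / (r/10) by positivity) (show (31/32:ℝ) < 1 by norm_num)
    refine ⟨n, ?_⟩
    rw [lt_div_iff₀ (by positivity)] at hn
    rw [tt_succ]
    have := tt_pos hr n
    unfold tt at *
    linarith
  classical
  rw [mem_iUnion]
  refine ⟨Nat.find hex, hG, Nat.find_spec hex, ?_⟩
  rcases h0 : Nat.find hex with _ | n
  · rw [tt_zero]; exact hd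
  · have := Nat.find_min hex (m := n) (by omega)
    exact not_lt.1 this

lemma main_est (C0 : ℝ) (hC0 : 0 < C0) : ∃ C : ℝ, 0 < C ∧ ∀ (Ω : Set E2) (w : E2 → ℝ) (m : Measure E2) (k : E2 → ℝ → ℝ) (r : ℝ) (ν : E2 → E2),
    KC Ω w m C0 k → NF Ω r ν → ∃ k0 : ℝ,
      ∫⁻ x in Ω, ENNReal.ofReal ((w x - k0)^2) ≤ ENNReal.ofReal (C * (area Ω * perim Ω / r^3)) * m univ := by
  obtain ⟨C1, hC1, hlc⟩ := long_chain C0 hC0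
  obtain ⟨Q, hQ⟩ : ∃ Q : ℝ, Q = (2 * 2754 + 4 * 18579456 * 64) * 121 * C0 := ⟨_, rfl⟩
  have hQ0 : 0 < Q := by rw [hQ]; positivity
  refine ⟨4 * Q + 2 * (2754 * C0) + 18 * C1, by positivity, fun Ω w m k r ν h hN => ?_⟩
  obtain ⟨k0, hk0⟩ := hlc Ω w m k r ν h hN
  refine ⟨k0, ?_⟩
  have hr := hN.rpos
  obtain ⟨E, hE⟩ : ∃ E, E = ENNReal.ofReal (C1 * (perim Ω / r^3)) * m univ := ⟨_, rfl⟩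
  have H : ∀ u : E2, ‖u‖ = 1 → ∫⁻ x in ⋃ j, LL Ω r u j, ENNReal.ofReal ((w x - k0)^2) ≤ ENNReal.ofReal Q * m univ + 4 * E * volume Ω := by
    intro u hu
    rw [hQ, hE]
    exact h.hardy hr hu hk0
  have hDm : MeasurableSet {x : E2 | r/10 < D Ω x} := measurableSet_lt measurable_const D_cont.measurable
  have Hd : ∫⁻ x in {x : E2 | r/10 < D Ω x}, ENNReal.ofReal ((w x - k0)^2) ≤ 2 * (ENNReal.ofReal (2754 * C0) * m univ) + 2 * E * volume Ω := by
    calc _ ≤ ∫⁻ x in {x : E2 | r/10 < D Ω x}, (2 * ENNReal.ofReal ((w x - k x (r/160))^2) + 2 * E) := by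
          refine setLIntegral_mono' hDm fun x hx => ?_
          have hx : r/10 < D Ω x := hx
          have e : ∀ a b : ℝ, (a - b)^2 = (b - a)^2 := fun a b => by ring
          refine (ofReal_sq_split (w x) k0 (k x (r/160))).trans ?_
          rw [e k0, hE]
          gcongr
          exact hk0 x (mem_of_D_pos (by linarith)) (by linarith)
      _ = 2 * (∫⁻ x in {x : E2 | r/10 < D Ω x}, ENNReal.ofReal ((w x - k x (r/160))^2)) + 2 * E * volume {x : E2 | r/10 < D Ω x} := by
          rw [lintegral_add_right _ measurable_const, setLIntegral_const, lintegral_const_mul' _ _ (by norm_num)]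
      _ ≤ _ := by
          gcongr
          · refine h.whit hDm MeasurableSet.univ (by positivity) fun x hx => ?_
            have hx : r/10 < D Ω x := hx
            exact ⟨D_ball_le (by linarith), subset_univ _⟩
          · intro x hx
            have hx : r/10 < D Ω x := hx
            exact mem_of_D_pos (by linarith)
  have hsub : Ω ⊆ ((⋃ j, LL Ω r (e 0) j) ∪ (⋃ j, LL Ω r (- e 0) j) ∪ (⋃ j, LL Ω r (e 1) j) ∪ (⋃ j, LL Ω r (- e 1) j)) ∪ {x : E2 | r/10 < D Ω x} := by
    intro x hx
    rcases lt_or_ge (r/10) (D Ω x) with hd | hd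
    · exact Or.inr hd
    · left
      obtain ⟨u, hu, hxu⟩ := hN.cover hx hd
      rcases hu with rfl | rfl | rfl | hu
      · exact Or.inl (Or.inl (Or.inl hxu))
      · exact Or.inl (Or.inl (Or.inr hxu))
      · exact Or.inl (Or.inr hxu)
      · rw [mem_singleton_iff.1 hu] at hxu
        exact Or.inr hxu
  have hA : volume Ω = ENNReal.ofReal (area Ω) := by rw [area, ENNReal.ofReal_toReal hN.vol_fin]
  have hP := hN.r_le_perim
  have hAr := hN.r_sq_le_area
  have hone : 1 ≤ area Ω * perim Ω / r^3 := by
    rw [le_div_iff₀ (by positivity)]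
    nlinarith [sq_nonneg r]
  have hA0 : 0 ≤ area Ω := by nlinarith [sq_nonneg r]
  have hP0 : 0 ≤ perim Ω := by linarith
  calc _ ≤ _ := lintegral_mono_set hsub
    _ ≤ ((((ENNReal.ofReal Q * m univ + 4 * E * volume Ω) + (ENNReal.ofReal Q * m univ + 4 * E * volume Ω)) + (ENNReal.ofReal Q * m univ + 4 * E * volume Ω))
        + (ENNReal.ofReal Q * m univ + 4 * E * volume Ω)) + (2 * (ENNReal.ofReal (2754 * C0) * m univ) + 2 * E * volume Ω) := by
        refine (lintegral_union_le _ _ _).trans (add_le_add ?_ Hd)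
        refine (lintegral_union_le _ _ _).trans (add_le_add ?_ (H _ (by rw [norm_neg, norm_e])))
        refine (lintegral_union_le _ _ _).trans (add_le_add ?_ (H _ (by rw [norm_e])))
        refine (lintegral_union_le _ _ _).trans (add_le_add (H _ (by rw [norm_e])) (H _ (by rw [norm_neg, norm_e])))
    _ = (4 * ENNReal.ofReal Q + 2 * ENNReal.ofReal (2754 * C0) + 18 * (ENNReal.ofReal (C1 * (perim Ω / r^3)) * ENNReal.ofReal (area Ω))) * m univ := by
        rw [hE, hA]; ring
    _ ≤ _ := by
        gcongr
        rw [show (2:ℝ≥0∞) = ENNReal.ofReal 2 by simp, show (4:ℝ≥0∞) = ENNReal.ofReal 4 by simp, show (18:ℝ≥0∞) = ENNReal.ofReal 18 by simp,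
          ← ENNReal.ofReal_mul (by positivity), ← ENNReal.ofReal_mul (by positivity), ← ENNReal.ofReal_mul (by positivity),
          ← ENNReal.ofReal_mul (by positivity), ← ENNReal.ofReal_add (by positivity) (by positivity), ← ENNReal.ofReal_add (by positivity) (by positivity)]
        apply ENNReal.ofReal_le_ofReal
        have e : 18 * (C1 * (perim Ω / r^3) * area Ω) = 18 * C1 * (area Ω * perim Ω / r^3) := by ring
        rw [e]
        nlinarith

lemma gradsq_om (X : E2 → E2) (x : E2) : gradNormSq X x = symGradNormSq X x + 2 * (om X x)^2 := by
  rw [gradsq_eq, om]; ring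

lemma symsq_le (X : E2 → E2) (x : E2) : symGradNormSq X x ≤ gradNormSq X x := by
  rw [gradsq_om]; nlinarith [sq_nonneg (om X x)]

lemma core1 : ∃ C : ℝ, 0 < C ∧ ∀ Ω : Set E2, IsUBCDomain Ω → ∀ X : E2 → E2, DifferentiableOn ℝ X Ω →
      IntegrableOn (fun x => gradNormSq X x) Ω → 1 ≤ 8 * (area Ω * perim Ω / (ubcRadius Ω)^3) ∧ volume Ω ≠ ⊤ ∧ ∃ k0 : ℝ,
      IntegrableOn (fun x => (om X x - k0)^2) Ω ∧
      ∫ x in Ω, (om X x - k0)^2 ≤ C * (area Ω * perim Ω / (ubcRadius Ω)^3) * ∫ x in Ω, symGradNormSq X x := by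
  obtain ⟨C0, hC0, hK⟩ := K0
  obtain ⟨C, hC, hmain⟩ := main_est C0 hC0
  refine ⟨8 * C, by positivity, fun Ω hΩ X hX hgInt => ?_⟩
  obtain ⟨r, ν, hN, hr0, hr1, hr2⟩ := exists_good_radius hΩ
  have hr := hN.rpos
  have hP := hN.r_le_perim
  have hAr := hN.r_sq_le_area
  have hA0 : 0 ≤ area Ω := by nlinarith [sq_nonneg r]
  have hP0 : 0 ≤ perim Ω := by linarith
  have hOm : MeasurableSet Ω := hN.op.measurableSet
  have hrr : area Ω * perim Ω / r^3 ≤ 8 * (area Ω * perim Ω / (ubcRadius Ω)^3) := by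
    rw [← mul_div_assoc, div_le_div_iff₀ (by positivity) (by positivity)]
    have : (ubcRadius Ω)^3 ≤ (2*r)^3 := by gcongr
    calc _ ≤ area Ω * perim Ω * (2*r)^3 := by gcongr
      _ = _ := by ring
  have hone : 1 ≤ area Ω * perim Ω / r^3 := by
    rw [le_div_iff₀ (by positivity)]
    nlinarith [sq_nonneg r]
  refine ⟨hone.trans hrr, hN.vol_fin, ?_⟩
  have hSint : IntegrableOn (fun x => symGradNormSq X x) Ω := by
    refine Integrable.mono' hgInt (meas_symsq X).aestronglyMeasurable (ae_of_all _ fun x => ?_)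
    rw [Real.norm_of_nonneg (symsq_nonneg X x)]
    exact symsq_le X x
  have hgfin : ∫⁻ x in Ω, ENNReal.ofReal (gradNormSq X x) ≠ ⊤ := by
    rw [← ofReal_integral_eq_lintegral_ofReal hgInt (ae_of_all _ fun x => (symsq_nonneg X x).trans (symsq_le X x))]
    exact ENNReal.ofReal_ne_top
  have hSl := ofReal_integral_eq_lintegral_ofReal hSint (ae_of_all _ fun x => symsq_nonneg X x)
  have hex : ∀ z : E2, ∀ ρ : ℝ, ∃ κ : ℝ, 0 < ρ → ball z (2*ρ) ⊆ Ω →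
      ∫⁻ x in ball z ρ, ENNReal.ofReal ((om X x - κ)^2) ≤ ENNReal.ofReal C0 * ∫⁻ x in ball z (2*ρ), ENNReal.ofReal (symGradNormSq X x) := by
    intro z ρ
    by_cases hh : 0 < ρ ∧ ball z (2*ρ) ⊆ Ω
    · obtain ⟨κ, hκ⟩ := hK z ρ hh.1 X (hX.mono hh.2) (ne_top_of_le_ne_top hgfin (lintegral_mono_set hh.2))
      exact ⟨κ, fun _ _ => hκ⟩
    · exact ⟨0, fun h1 h2 => absurd ⟨h1, h2⟩ hh⟩
  choose k hk using hex
  obtain ⟨m, hm⟩ : ∃ m : Measure E2, m = (volume.restrict Ω).withDensity (fun x => ENNReal.ofReal (symGradNormSq X x)) := ⟨_, rfl⟩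
  have hmu : m univ = ENNReal.ofReal (∫ x in Ω, symGradNormSq X x) := by
    rw [hm, withDensity_apply _ MeasurableSet.univ, Measure.restrict_univ, hSl]
  have hKC : KC Ω (om X) m C0 k := by
    refine ⟨hC0, meas_om X, ⟨by rw [hmu]; exact ENNReal.ofReal_lt_top⟩, fun z ρ hρ hb => ?_⟩
    rw [hm, withDensity_apply _ measurableSet_ball, Measure.restrict_restrict measurableSet_ball, inter_eq_left.2 hb]
    exact hk z ρ hρ hb
  obtain ⟨k0, hk0⟩ := hmain Ω (om X) m k r ν hKC hN
  rw [hmu, ← ENNReal.ofReal_mul (by positivity)] at hk0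
  have hmeas : Measurable fun x => (om X x - k0)^2 := ((meas_om X).sub_const _).pow_const _
  have hI : IntegrableOn (fun x => (om X x - k0)^2) Ω := by
    refine ⟨hmeas.aestronglyMeasurable, ?_⟩
    rw [hasFiniteIntegral_iff_ofReal (ae_of_all _ fun x => sq_nonneg _)]
    exact hk0.trans_lt ENNReal.ofReal_lt_top
  refine ⟨k0, hI, ?_⟩
  have hS0 : 0 ≤ ∫ x in Ω, symGradNormSq X x := integral_nonneg fun x => symsq_nonneg X x
  rw [← ofReal_integral_eq_lintegral_ofReal hI (ae_of_all _ fun x => sq_nonneg _), ENNReal.ofReal_le_ofReal_iff (by positivity)] at hk0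
  refine hk0.trans ?_
  refine mul_le_mul_of_nonneg_right ?_ hS0
  calc C * (area Ω * perim Ω / r^3) ≤ C * (8 * (area Ω * perim Ω / (ubcRadius Ω)^3)) := by gcongr
    _ = _ := by ring

lemma core2 : ∃ C : ℝ, 0 < C ∧ ∀ Ω : Set E2, IsUBCDomain Ω → ∀ X : E2 → E2, DifferentiableOn ℝ X Ω →
      IntegrableOn (fun x => gradNormSq X x) Ω →
      (∀ i j : Fin 2, IntegrableOn (fun x => gradEntry X x i j) Ω) →
      (∀ i j : Fin 2, (∫ x in Ω, gradEntry X x i j) = ∫ x in Ω, gradEntry X x j i) →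
        (∫ x in Ω, gradNormSq X x) ≤
          C * (area Ω * perim Ω / (ubcRadius Ω)^3) * ∫ x in Ω, symGradNormSq X x := by
  obtain ⟨C, hC, h⟩ := core1
  refine ⟨8 + 2 * C, by positivity, fun Ω hΩ X hX hgInt hent hsym => ?_⟩
  obtain ⟨h1, hvol, k0, hI, hle⟩ := h Ω hΩ X hX hgInt
  haveI : IsFiniteMeasure (volume.restrict Ω) := ⟨by rw [Measure.restrict_apply_univ]; exact hvol.lt_top⟩
  have hSint : IntegrableOn (fun x => symGradNormSq X x) Ω := by
    refine Integrable.mono' hgInt (meas_symsq X).aestronglyMeasurable (ae_of_all _ fun x => ?_)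
    rw [Real.norm_of_nonneg (symsq_nonneg X x)]
    exact symsq_le X x
  have hom : IntegrableOn (om X) Ω := by
    have := ((hent 1 0).sub (hent 0 1)).div_const 2
    exact this
  have hom0 : ∫ x in Ω, om X x = 0 := by
    unfold om
    rw [integral_div, integral_sub (hent 1 0) (hent 0 1), hsym 1 0]; simp
  have hom2 : IntegrableOn (fun x => (om X x)^2) Ω := by
    have : (fun x => (om X x)^2) = fun x => (gradNormSq X x - symGradNormSq X x) / 2 := by
      funext x; rw [gradsq_om]; ring
    rw [this]
    exact (hgInt.sub hSint).div_const 2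
  have hcmp : ∫ x in Ω, (om X x)^2 ≤ ∫ x in Ω, (om X x - k0)^2 := by
    have e1 : ∫ x in Ω, ((om X x)^2 - 2 * k0 * om X x) = ∫ x in Ω, (om X x)^2 := by
      rw [integral_sub hom2 (hom.const_mul _), integral_const_mul, hom0]; ring
    rw [← e1]
    refine integral_mono (hom2.sub (hom.const_mul _)) hI fun x => ?_
    simp only [Pi.sub_apply]
    nlinarith [sq_nonneg k0]
  have e2 : ∫ x in Ω, gradNormSq X x = (∫ x in Ω, symGradNormSq X x) + 2 * ∫ x in Ω, (om X x)^2 := by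
    simp_rw [gradsq_om]
    rw [integral_add hSint (hom2.const_mul _), integral_const_mul]
  have hS0 : 0 ≤ ∫ x in Ω, symGradNormSq X x := integral_nonneg fun x => symsq_nonneg X x
  rw [e2]
  nlinarith [mul_le_mul_of_nonneg_right h1 hS0]

lemma grad_sub_lin {X : E2 → E2} {x : E2} (hX : DifferentiableAt ℝ X x) (a : Fin 2 → Fin 2 → ℝ) :
    DifferentiableAt ℝ (fun x => X x - ((a 0 0 * x 0 + a 0 1 * x 1) • e 0 + (a 1 0 * x 0 + a 1 1 * x 1) • e 1)) x ∧
    ∀ i j, gradEntry (fun x => X x - ((a 0 0 * x 0 + a 0 1 * x 1) • e 0 + (a 1 0 * x 0 + a 1 1 * x 1) • e 1)) x i j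
      = gradEntry X x i j - a i j := by
  let p : Fin 2 → (E2 →L[ℝ] ℝ) := fun i => EuclideanSpace.proj i
  let L : E2 →L[ℝ] E2 := (a 0 0 • p 0 + a 0 1 • p 1).smulRight (e 0) + (a 1 0 • p 0 + a 1 1 • p 1).smulRight (e 1)
  have hd := hX.hasFDerivAt.sub (L.hasFDerivAt (x := x))
  refine ⟨hd.differentiableAt, fun i j => ?_⟩
  have h2 : fderiv ℝ (fun x => X x - ((a 0 0 * x 0 + a 0 1 * x 1) • e 0 + (a 1 0 * x 0 + a 1 1 * x 1) • e 1)) x = fderiv ℝ X x - L := hd.fderiv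
  rw [gradEntry, h2, gradEntry, ContinuousLinearMap.sub_apply, inner_sub_left]
  congr 1
  rw [inner_e]
  fin_cases i <;> fin_cases j <;> simp [L, p]

theorem final : 
    ∃ C : ℝ, ∀ Ω : Set E2, IsUBCDomain Ω → ∀ X : E2 → E2,
      DifferentiableOn ℝ X Ω →
      IntegrableOn (fun x => gradNormSq X x) Ω →
      (∀ i j : Fin 2, IntegrableOn (fun x => gradEntry X x i j) Ω) →
      ((∫ x in Ω, ∑ i : Fin 2, ∑ j : Fin 2,
          (gradEntry X x i j - (area Ω)⁻¹ * ∫ y in Ω, gradEntry X y i j)^2) ≤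
        C * (area Ω * perim Ω / (ubcRadius Ω)^3) *
          ∫ x in Ω, ∑ i : Fin 2, ∑ j : Fin 2,
            (symGradEntry X x i j - (area Ω)⁻¹ * ∫ y in Ω, symGradEntry X y i j)^2) ∧
      ((∀ i j : Fin 2, (∫ x in Ω, gradEntry X x i j) = ∫ x in Ω, gradEntry X x j i) →
        (∫ x in Ω, gradNormSq X x) ≤
          C * (area Ω * perim Ω / (ubcRadius Ω)^3) * ∫ x in Ω, symGradNormSq X x) := by
  obtain ⟨C, hC, h⟩ := core2
  refine ⟨C, fun Ω hΩ X hX hgInt hent => ⟨?_, h Ω hΩ X hX hgInt hent⟩⟩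
  obtain ⟨r, ν, hN, -, -, -⟩ := exists_good_radius hΩ
  have hAr := hN.r_sq_le_area
  have hA : 0 < area Ω := lt_of_lt_of_le (by have := hN.rpos; positivity) hAr
  have hOm : MeasurableSet Ω := hN.op.measurableSet
  haveI : IsFiniteMeasure (volume.restrict Ω) := ⟨by rw [Measure.restrict_apply_univ]; exact hN.vol_fin.lt_top⟩
  have hreal : (volume.restrict Ω).real univ = area Ω := by simp [Measure.real, area]
  obtain ⟨a, ha⟩ : ∃ a : Fin 2 → Fin 2 → ℝ, a = fun i j => (area Ω)⁻¹ * ∫ y in Ω, gradEntry X y i j := ⟨_, rfl⟩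
  obtain ⟨Y, hY⟩ : ∃ Y : E2 → E2, Y = fun x => X x - ((a 0 0 * x 0 + a 0 1 * x 1) • e 0 + (a 1 0 * x 0 + a 1 1 * x 1) • e 1) := ⟨_, rfl⟩
  have hdX : ∀ x ∈ Ω, DifferentiableAt ℝ X x := fun x hx => hX.differentiableAt (hN.op.mem_nhds hx)
  have hYd : DifferentiableOn ℝ Y Ω := fun x hx => by
    rw [hY]; exact (grad_sub_lin (hdX x hx) a).1.differentiableWithinAt
  have hYg : ∀ x ∈ Ω, ∀ i j, gradEntry Y x i j = gradEntry X x i j - a i j := fun x hx i j => by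
    rw [hY]; exact (grad_sub_lin (hdX x hx) a).2 i j
  have hYent : ∀ i j, IntegrableOn (fun x => gradEntry Y x i j) Ω := fun i j =>
    IntegrableOn.congr_fun ((hent i j).sub (integrable_const (a i j))) (fun x hx => (hYg x hx i j).symm) hOm
  have hsq : ∀ i j, IntegrableOn (fun x => (gradEntry X x i j)^2) Ω := fun i j => by
    refine Integrable.mono' hgInt ((meas_gradEntry X i j).pow_const 2).aestronglyMeasurable (ae_of_all _ fun x => ?_)
    rw [Real.norm_of_nonneg (sq_nonneg _)]
    exact gradEntry_sq_le X x i j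
  have hYsq : ∀ i j, IntegrableOn (fun x => (gradEntry Y x i j)^2) Ω := fun i j => by
    refine IntegrableOn.congr_fun (((hsq i j).sub ((hent i j).const_mul (2 * a i j))).add (integrable_const ((a i j)^2))) (fun x hx => ?_) hOm
    simp only [Pi.add_apply, Pi.sub_apply]
    rw [hYg x hx]; ring
  have hYint : IntegrableOn (fun x => gradNormSq Y x) Ω := by
    unfold gradNormSq
    exact integrable_finsetSum _ fun i _ => integrable_finsetSum _ fun j _ => hYsq i j
  have hYz : ∀ i j, ∫ x in Ω, gradEntry Y x i j = 0 := fun i j => by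
    rw [setIntegral_congr_fun hOm (fun x hx => hYg x hx i j), integral_sub (hent i j) (integrable_const _), integral_const, hreal, ha]
    simp only [smul_eq_mul]
    field_simp
    ring
  have key := h Ω hΩ Y hYd hYint hYent (fun i j => by rw [hYz, hYz])
  rw [setIntegral_congr_fun (g := fun x => ∑ i : Fin 2, ∑ j : Fin 2,
          (gradEntry X x i j - (area Ω)⁻¹ * ∫ y in Ω, gradEntry X y i j)^2) hOm ?_, 
    setIntegral_congr_fun (f := fun x => symGradNormSq Y x) (g := fun x => ∑ i : Fin 2, ∑ j : Fin 2,
            (symGradEntry X x i j - (area Ω)⁻¹ * ∫ y in Ω, symGradEntry X y i j)^2) hOm ?_] at key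
  · exact key
  · intro x hx
    have hs : ∀ i j, (area Ω)⁻¹ * ∫ y in Ω, symGradEntry X y i j = (a i j + a j i) / 2 := fun i j => by
      unfold symGradEntry
      rw [integral_div, integral_add (hent i j) (hent j i), ha]; ring
    simp only [symGradNormSq, hs]
    refine Finset.sum_congr rfl fun i _ => Finset.sum_congr rfl fun j _ => ?_
    rw [symGradEntry, hYg x hx, hYg x hx, symGradEntry]; ring
  · intro x hx
    simp only [gradNormSq]
    refine Finset.sum_congr rfl fun i _ => Finset.sum_congr rfl fun j _ => ?_
    rw [hYg x hx, ha]

/-- Lemma 2.10, quantified Korn–Poincaré inequality: for UBC domains,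
`∫_Ω |∇X - (∇X)_Ω|² ≤ C (|Ω|P(Ω)/r_Ω³) ∫_Ω |∇_sym X - (∇_sym X)_Ω|²`, and
`∫_Ω |∇X|² ≤ C (|Ω|P(Ω)/r_Ω³) ∫_Ω |∇_sym X|²` whenever `∫_Ω ∇X dx` is symmetric. -/
theorem quantified_korn_poincare :
    ∃ C : ℝ, ∀ Ω : Set E2, IsUBCDomain Ω → ∀ X : E2 → E2,
      DifferentiableOn ℝ X Ω →
      IntegrableOn (fun x => gradNormSq X x) Ω →
      (∀ i j : Fin 2, IntegrableOn (fun x => gradEntry X x i j) Ω) →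
      ((∫ x in Ω, ∑ i : Fin 2, ∑ j : Fin 2,
          (gradEntry X x i j - (area Ω)⁻¹ * ∫ y in Ω, gradEntry X y i j)^2) ≤
        C * (area Ω * perim Ω / (ubcRadius Ω)^3) *
          ∫ x in Ω, ∑ i : Fin 2, ∑ j : Fin 2,
            (symGradEntry X x i j - (area Ω)⁻¹ * ∫ y in Ω, symGradEntry X y i j)^2) ∧
      ((∀ i j : Fin 2, (∫ x in Ω, gradEntry X x i j) = ∫ x in Ω, gradEntry X x j i) →
        (∫ x in Ω, gradNormSq X x) ≤
          C * (area Ω * perim Ω / (ubcRadius Ω)^3) * ∫ x in Ω, symGradNormSq X x) := by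
  exact final

end StokesPaper

end
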